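/- arXiv:math/0608491 — 6 statements merged into one kernel-verified Lean document; each statement's English description precedes it below -/
import Mathlib

section
/- For each integer n ≥ 8, there exist a prime p and a commutative F_p-algebra A_0 of dimension n as an F_p-vector space such that for every commutative ring A that is free of rank n as a Z-module and for which Q ⊗_Z A is a reduced ring (equivalently, an étale Q-algebra), the F_p-algebra A/pA is not isomorphic to A_0. -/
open scoped TensorProduct

namespace Stmt10

/-- symmetric 2-cocycles -/
def Z (B : Type) [CommRing B] : AddSubgroup (B →+ B →+ B) where
  carrier := {f | (∀ x y, f x y = f y x) ∧
    ∀ x y z, x * f y z - f (x*y) z + f x (y*z) - f x y * z = 0}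
  zero_mem' := by simp
  add_mem' := by
    rintro f g ⟨h1, h2⟩ ⟨h3, h4⟩
    refine ⟨fun x y => by simp [h1 x y, h3 x y], fun x y z => ?_⟩
    simp only [AddMonoidHom.add_apply]
    linear_combination h2 x y z + h4 x y z
  neg_mem' := by
    rintro f ⟨h1, h2⟩
    refine ⟨fun x y => by simp [h1 x y], fun x y z => ?_⟩
    simp only [AddMonoidHom.neg_apply]
    linear_combination - h2 x y z

def ZA (A : Type) [CommRing A] : Submodule ℤ (A →ₗ[ℤ] A →ₗ[ℤ] A) where
  carrier := {f | (∀ x y, f x y = f y x) ∧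
    ∀ x y z, x * f y z - f (x*y) z + f x (y*z) - f x y * z = 0}
  zero_mem' := by simp
  add_mem' := by
    rintro f g ⟨h1, h2⟩ ⟨h3, h4⟩
    refine ⟨fun x y => by simp [h1 x y, h3 x y], fun x y z => ?_⟩
    simp only [LinearMap.add_apply]
    linear_combination h2 x y z + h4 x y z
  smul_mem' := by
    rintro c f ⟨h1, h2⟩
    refine ⟨fun x y => by simp [h1 x y], fun x y z => ?_⟩
    have := congrArg (fun t => c • t) (h2 x y z)
    simpa only [LinearMap.smul_apply, smul_add, smul_sub, mul_smul_comm, smul_mul_assoc,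
      smul_zero] using this

/-- coboundary -/
noncomputable def del (A : Type) [CommRing A] : (A →ₗ[ℤ] A) →ₗ[ℤ] ZA A where
  toFun φ := ⟨LinearMap.mk₂ ℤ (fun a b => a * φ b - φ (a * b) + φ a * b)
      (by intros; simp [add_mul]; ring)
      (by intros; simp only [smul_mul_assoc, map_smul, smul_add, smul_sub])
      (by intros; simp [mul_add]; ring)
      (by intros; simp only [mul_smul_comm, map_smul, smul_add, smul_sub]),
      ⟨fun x y => by simp [mul_comm x y]; ring, fun x y z => by
        simp [mul_assoc]; ring⟩⟩
  map_add' φ ψ := by ext; simp; ring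
  map_smul' c φ := by ext; simp; ring

theorem der_zero (A : Type) [CommRing A] [Module.Free ℤ A] [Module.Finite ℤ A]
    [IsReduced (ℚ ⊗[ℤ] A)] (φ : A →ₗ[ℤ] A)
    (h : ∀ a b, a * φ b - φ (a * b) + φ a * b = 0) : φ = 0 := by
  have hl : ∀ a b, φ (a * b) = a • φ b + b • φ a := fun a b => by
    simp only [smul_eq_mul]; linear_combination - h a b
  let D : Derivation ℤ A A := Derivation.mk' φ hl
  have hinj : Function.Injective (Algebra.TensorProduct.includeRight : A →ₐ[ℤ] ℚ ⊗[ℤ] A) :=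
    Algebra.TensorProduct.includeRight_injective (algebraMap ℤ ℚ).injective_int
  ext a
  let x : ℚ ⊗[ℤ] A := Algebra.TensorProduct.includeRight a
  have hx : IsIntegral ℚ x := Algebra.IsIntegral.isIntegral x
  have hm0 := minpoly.ne_zero hx
  have hsq : Squarefree (minpoly ℚ x) := by
    rintro q ⟨r, hr⟩
    have h1 : Polynomial.aeval x (q * r) = 0 := by
      have : (Polynomial.aeval x (q * r)) ^ 2 = 0 := by
        rw [← map_pow, show (q*r)^2 = (minpoly ℚ x) * r by rw [hr]; ring, map_mul, minpoly.aeval,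
          zero_mul]
      exact pow_eq_zero_iff (two_ne_zero) |>.1 this
    obtain ⟨s, hs⟩ := minpoly.dvd ℚ x h1
    have hqr : q * r ≠ 0 := by
      intro h0
      apply hm0
      rw [hr, mul_assoc, h0, mul_zero]
    refine IsUnit.of_mul_eq_one s ?_
    apply mul_left_cancel₀ hqr
    rw [mul_one]
    conv_rhs => rw [hs, hr]
    ring
  have hsep : (minpoly ℚ x).Separable := PerfectField.separable_iff_squarefree.2 hsq
  obtain ⟨u, v, huv⟩ := hsep
  obtain ⟨b, hb, hM⟩ := IsLocalization.integerNormalization_spec (nonZeroDivisors ℤ) (minpoly ℚ x)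
  set M := IsLocalization.integerNormalization (nonZeroDivisors ℤ) (minpoly ℚ x)
  have hb0 : b ≠ 0 := nonZeroDivisors.ne_zero hb
  have key : ∀ P : Polynomial ℤ, Algebra.TensorProduct.includeRight (Polynomial.aeval a P) =
      Polynomial.aeval x (P.map (algebraMap ℤ ℚ)) := fun P => by
    rw [Polynomial.aeval_map_algebraMap, Polynomial.aeval_algHom_apply]
  have h0 : Polynomial.aeval a M = 0 := by
    apply hinj
    rw [key, hM, map_zero, map_zsmul, minpoly.aeval, smul_zero]
  have h1 := D.map_aeval M a
  rw [h0, map_zero, smul_eq_mul] at h1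
  have h2 := congrArg (Algebra.TensorProduct.includeRight : A →ₐ[ℤ] ℚ ⊗[ℤ] A) h1
  rw [map_zero, map_mul, key, ← Polynomial.derivative_map, hM, Polynomial.derivative_smul,
    map_zsmul, smul_mul_assoc] at h2
  have h3 : Polynomial.aeval x (Polynomial.derivative (minpoly ℚ x)) *
      (Algebra.TensorProduct.includeRight (D a) : ℚ ⊗[ℤ] A) = 0 := by
    have h4 : ((b : ℤ) : ℚ) • (Polynomial.aeval x (Polynomial.derivative (minpoly ℚ x)) *
      (Algebra.TensorProduct.includeRight (D a) : ℚ ⊗[ℤ] A)) = 0 := by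
      rw [Int.cast_smul_eq_zsmul]; exact h2.symm
    exact (smul_eq_zero.1 h4).resolve_left (by exact_mod_cast hb0)
  have h5 := congrArg (Polynomial.aeval x) huv
  rw [map_add, map_mul, map_mul, minpoly.aeval, mul_zero, zero_add, map_one] at h5
  have h6 : (Algebra.TensorProduct.includeRight (D a) : ℚ ⊗[ℤ] A) = 0 := by
    rw [← one_mul (Algebra.TensorProduct.includeRight (D a) : ℚ ⊗[ℤ] A), ← h5, mul_assoc, h3,
      mul_zero]
  apply hinj
  rw [LinearMap.zero_apply, map_zero]
  exact h6

theorem exists_red {A B : Type} [CommRing A] [CommRing B] (p : ℕ) (π : A →+* B)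
    (hs : Function.Surjective π) (hk : ∀ a, π a = 0 ↔ ∃ b, a = p * b)
    (f : A →ₗ[ℤ] A →ₗ[ℤ] A) (hf : f ∈ ZA A) :
    ∃ g : Z B, ∀ a b, g.1 (π a) (π b) = π (f a b) := by
  have w : ∀ a a' b, π a = π a' → π (f a b) = π (f a' b) := by
    intro a a' b h
    obtain ⟨c, hc⟩ := (hk (a - a')).1 (by rw [map_sub, h, sub_self])
    have : a = a' + (p : ℤ) • c := by
      rw [zsmul_eq_mul]; push_cast; rw [← hc]; ring
    rw [this, map_add, map_smul, LinearMap.add_apply, LinearMap.smul_apply, map_add,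
      (hk ((p : ℤ) • f c b)).2 ⟨f c b, by simp⟩, add_zero]
  have w' : ∀ a a' b b', π a = π a' → π b = π b' → π (f a b) = π (f a' b') := by
    intro a a' b b' h h'
    rw [w a a' b h, hf.1, w b b' a' h', hf.1]
  obtain ⟨σ, hσ⟩ := hs.hasRightInverse
  have hσ' : ∀ x, π (σ x) = x := hσ
  let g : B →+ B →+ B := AddMonoidHom.mk' (fun x => AddMonoidHom.mk' (fun y => π (f (σ x) (σ y)))
    (fun y z => by
      rw [← map_add, ← map_add]; apply w' _ _ _ _ rfl; simp [hσ']))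
    (fun x y => by
      ext z
      simp only [AddMonoidHom.mk'_apply, AddMonoidHom.add_apply]
      rw [← map_add, ← LinearMap.add_apply, ← map_add]; apply w' _ _ _ _ _ rfl; simp [hσ'])
  have hg : ∀ a b, g (π a) (π b) = π (f a b) := fun a b => w' _ _ _ _ (hσ' _) (hσ' _)
  refine ⟨⟨g, ?_, ?_⟩, hg⟩
  · intro x y
    obtain ⟨x, rfl⟩ := hs x
    obtain ⟨y, rfl⟩ := hs y
    rw [hg, hg, hf.1]
  · intro x y z
    obtain ⟨x, rfl⟩ := hs x
    obtain ⟨y, rfl⟩ := hs y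
    obtain ⟨z, rfl⟩ := hs z
    rw [← map_mul, ← map_mul, hg, hg, hg, hg, ← map_mul, ← map_mul, ← map_sub, ← map_add, ← map_sub,
      hf.2, map_zero]

theorem lower {A B : Type} [CommRing A] [CommRing B] (p : ℕ) [Fact p.Prime]
    [Module.Free ℤ A] [Module.Finite ℤ A] [IsReduced (ℚ ⊗[ℤ] A)] [Finite B] (π : A →+* B)
    (hs : Function.Surjective π) (hk : ∀ a, π a = 0 ↔ ∃ b, a = p * b) :
    p ^ (Module.finrank ℤ A ^ 2) ≤ Nat.card (Z B) := by
  have : Finite (B →+ B) := DFunLike.finite _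
  have : Finite (B →+ B →+ B) := DFunLike.finite _
  have hdel : Function.Injective (del A) := by
    rw [injective_iff_map_eq_zero]
    intro φ hφ
    apply der_zero
    intro a b
    have := congrArg (fun t : ZA A => t.1 a b) hφ
    simpa [del] using this
  have h1 := LinearMap.finrank_le_finrank_of_injective hdel
  rw [Module.finrank_linearMap, ← sq] at h1
  let bs := Module.finBasis ℤ (ZA A)
  set m := Module.finrank ℤ (ZA A)
  choose red hred using fun f : ZA A => exists_red p π hs hk f.1 f.2
  let F : (Fin m → ZMod p) → Z B := fun c => red (∑ i, ((c i).val : ℤ) • bs i)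
  have hF : Function.Injective F := by
    intro c c' h
    set f := ∑ i, ((c i).val : ℤ) • bs i with hf
    set f' := ∑ i, ((c' i).val : ℤ) • bs i with hf'
    have h2 : ∀ a b, ∃ d, (f - f').1 a b = p * d := by
      intro a b
      rw [← hk]
      have e1 := hred f a b
      have e2 := hred f' a b
      have e3 : red f = red f' := h
      rw [e3] at e1
      simp [← e1, ← e2]
    have hp0 : (p : ℤ) ≠ 0 := by exact_mod_cast (Fact.out : p.Prime).ne_zero
    have htf : ∀ x y : A, (p : ℤ) • x = (p : ℤ) • y → x = y := fun x y h =>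
      smul_right_injective A hp0 h
    choose d hd using h2
    have hd' : ∀ a b, (p : ℤ) • d a b = (f - f').1 a b := fun a b => by rw [hd]; simp
    let g : A →ₗ[ℤ] A →ₗ[ℤ] A := LinearMap.mk₂ ℤ d
      (fun x y z => by apply htf; rw [smul_add, hd', hd', hd', map_add, LinearMap.add_apply])
      (fun c x y => by
        apply htf; rw [smul_comm, hd', hd', map_smul, LinearMap.smul_apply])
      (fun x y z => by apply htf; rw [smul_add, hd', hd', hd', map_add])
      (fun c x y => by
        apply htf; rw [smul_comm, hd', hd', map_smul])
    have hgd : ∀ a b, g a b = d a b := fun a b => rfl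
    have hg : g ∈ ZA A := by
      refine ⟨fun x y => ?_, fun x y z => ?_⟩
      · apply htf; rw [hgd, hgd, hd', hd', (f - f').2.1]
      · apply htf
        rw [smul_zero, ← (f - f').2.2 x y z]
        simp only [smul_sub, smul_add, hgd, hd']
        rw [← mul_smul_comm, hd', ← smul_mul_assoc, hd']
    obtain ⟨G, h3⟩ : ∃ G : ZA A, f - f' = (p : ℤ) • G := by
      refine ⟨⟨g, hg⟩, ?_⟩
      ext a b
      exact (hd' a b).symm
    funext i
    have h4 := congrArg (fun t => bs.repr t i) h3
    simp [hf, hf', Finsupp.single_apply] at h4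
    have h5 := congrArg (Int.cast : ℤ → ZMod p) h4
    push_cast at h5
    simpa [sub_eq_zero] using h5
  have h6 := Nat.card_le_card_of_injective F hF
  rw [Nat.card_fun, Nat.card_zmod, Nat.card_fin] at h6
  exact (Nat.pow_le_pow_right (Fact.out : p.Prime).pos h1).trans h6

theorem step (B : Type) [CommRing B] [Algebra (ZMod 2) B] [Finite B] :
    Nat.card (Z (B × ZMod 2)) ≤
      Nat.card (Z B) * (2 ^ Module.finrank (ZMod 2) B * (2 ^ Module.finrank (ZMod 2) B * 2)) := by
  have : Finite (B →+ B) := DFunLike.finite _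
  have : Finite (B →+ B →+ B) := DFunLike.finite _
  have : Finite (B →+ ZMod 2) := DFunLike.finite _
  have cB : Nat.card B = 2 ^ Module.finrank (ZMod 2) B := by
    rw [Module.natCard_eq_pow_finrank (K := ZMod 2), Nat.card_zmod]
  have cD : Nat.card (B →+ ZMod 2) = 2 ^ Module.finrank (ZMod 2) B := by
    have e : Nat.card (B →+ ZMod 2) = Nat.card (Module.Dual (ZMod 2) B) :=
      Nat.card_congr
        { toFun := fun f => f.toZModLinearMap 2
          invFun := fun f => f.toAddMonoidHom
          left_inv := fun f => by ext; rfl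
          right_inv := fun f => by ext; rfl }
    rw [e, Module.natCard_eq_pow_finrank (K := ZMod 2), Nat.card_zmod, Subspace.dual_finrank_eq]
  let F : Z (B × ZMod 2) → Z B × B × (B →+ ZMod 2) × ZMod 2 := fun f =>
    (⟨AddMonoidHom.mk' (fun x => AddMonoidHom.mk' (fun y => (f.1 (x, 0) (y, 0)).1)
      (fun y z => by
        rw [← Prod.fst_add, ← map_add]; simp))
      (fun x y => by
        ext z
        simp only [AddMonoidHom.mk'_apply, AddMonoidHom.add_apply]
        rw [← Prod.fst_add, ← AddMonoidHom.add_apply, ← map_add]; simp), by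
      refine ⟨fun x y => ?_, fun x y z => ?_⟩
      · simp [f.2.1 (x, 0) (y, 0)]
      · have := congrArg Prod.fst (f.2.2 (x, 0) (y, 0) (z, 0))
        simpa using this⟩,
      (f.1 (0, 1) (0, 1)).1,
      AddMonoidHom.mk' (fun y => (f.1 (1, 0) (y, 0)).2) (fun y z => by
        rw [← Prod.snd_add, ← map_add]; simp),
      (f.1 (0, 1) (0, 1)).2)
  have hF : Function.Injective F := by
    intro f f' h
    simp only [F, Prod.mk.injEq] at h
    obtain ⟨h1, h2, h3, h4⟩ := h
    let g := f - f'
    have g1 : ∀ x y, (g.1 (x, 0) (y, 0)).1 = 0 := fun x y => by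
      have := congrArg (fun t : Z B => t.1 x y) h1
      simpa [g, sub_eq_zero] using this
    have g2 : (g.1 (0, 1) (0, 1)) = 0 := by
      ext
      · simpa [g, sub_eq_zero] using h2
      · simpa [g, sub_eq_zero] using h4
    have g3 : ∀ y, (g.1 (1, 0) (y, 0)).2 = 0 := fun y => by
      have := congrArg (fun t => t y) h3
      simpa [g, sub_eq_zero] using this
    have z0 : ∀ x, g.1 x 0 = 0 := fun x => map_zero _
    have z0' : ∀ x, g.1 0 x = 0 := fun x => by simp
    have sy := g.2.1
    have co := g.2.2
    have g4 : ∀ x y, (g.1 (x, 0) (y, 0)).2 = 0 := fun x y => by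
      have := congrArg Prod.snd (co (1, 0) (x, 0) (y, 0))
      simpa [g3] using this
    have g5 : ∀ y, (g.1 (0, 1) (y, 0)) = 0 := fun y => by
      have e1 := congrArg Prod.fst (co (0, 1) (0, 1) (y, 0))
      have e2 := congrArg Prod.snd (co (y, 0) (1, 0) (0, 1))
      have z1 := z0 (0, 1)
      have z2 := z0 (y, 0)
      have z3 := sy (y, 0) (0, 1)
      rw [← Prod.mk_zero_zero] at z1 z2
      ext
      · simpa [g2, z1] using e1
      · simpa [g4, z2, z3] using e2
    have g6 : ∀ x y, g.1 (x, 0) (y, 0) = 0 := fun x y => Prod.ext (g1 x y) (g4 x y)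
    have g7 : ∀ y : B, ∀ t : ZMod 2, g.1 (0, 1) (y, t) = 0 := fun y t => by
      have : (y, t) = (y, 0) + t.val • ((0, 1) : B × ZMod 2) := by
        ext <;> simp
      rw [this, map_add, map_nsmul, g2, g5]; simp
    have g8 : ∀ x y, g.1 x y = 0 := by
      rintro ⟨x, s⟩ ⟨y, t⟩
      have hx : (x, s) = (x, 0) + s.val • ((0, 1) : B × ZMod 2) := by
        ext <;> simp
      have hy : (y, t) = (y, 0) + t.val • ((0, 1) : B × ZMod 2) := by
        ext <;> simp
      rw [hx, map_add, map_nsmul, AddMonoidHom.add_apply, AddMonoidHom.nsmul_apply, g7, hy,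
        map_add, map_nsmul, g6, sy, g5]
      simp
    have : g = 0 := by
      ext x y <;> simp [g8]
    exact sub_eq_zero.1 this
  have := Nat.card_le_card_of_injective F hF
  rwa [Nat.card_prod, Nat.card_prod, Nat.card_prod, cB, cD, Nat.card_zmod] at this

def C : Type := Fin 8 → ZMod 2

instance : AddCommGroup C := inferInstanceAs (AddCommGroup (Fin 8 → ZMod 2))
instance : Module (ZMod 2) C := inferInstanceAs (Module (ZMod 2) (Fin 8 → ZMod 2))
instance : DecidableEq C := inferInstanceAs (DecidableEq (Fin 8 → ZMod 2))
instance : Finite C := inferInstanceAs (Finite (Fin 8 → ZMod 2))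

def C.mul (x y : Fin 8 → ZMod 2) : Fin 8 → ZMod 2 :=
  ![x 0 * y 0, x 0 * y 1 + x 1 * y 0, x 0 * y 2 + x 2 * y 0, x 0 * y 3 + x 3 * y 0,
    x 0 * y 4 + x 4 * y 0,
    x 0 * y 5 + x 5 * y 0 + x 1 * y 3 + x 3 * y 1,
    x 0 * y 6 + x 6 * y 0 + x 1 * y 4 + x 4 * y 1 + x 2 * y 3 + x 3 * y 2,
    x 0 * y 7 + x 7 * y 0 + x 2 * y 4 + x 4 * y 2]

theorem C.mul_comm' (x y : Fin 8 → ZMod 2) : C.mul x y = C.mul y x := by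
  funext i; fin_cases i <;> simp [C.mul] <;> ring

theorem C.mul_assoc' (x y z : Fin 8 → ZMod 2) :
    C.mul (C.mul x y) z = C.mul x (C.mul y z) := by
  funext i; fin_cases i <;> simp [C.mul] <;> ring

theorem C.one_mul' (x : Fin 8 → ZMod 2) : C.mul (Pi.single 0 1) x = x := by
  funext i; fin_cases i <;> simp [C.mul]

theorem C.mul_add' (x y z : Fin 8 → ZMod 2) :
    C.mul x (y + z) = C.mul x y + C.mul x z := by
  funext i; fin_cases i <;> simp [C.mul] <;> ring

theorem C.add_mul' (x y z : Fin 8 → ZMod 2) :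
    C.mul (x + y) z = C.mul x z + C.mul y z := by
  funext i; fin_cases i <;> simp [C.mul] <;> ring

theorem C.zero_mul' (x : Fin 8 → ZMod 2) : C.mul 0 x = 0 := by
  funext i; fin_cases i <;> simp [C.mul]

theorem C.mul_zero' (x : Fin 8 → ZMod 2) : C.mul x 0 = 0 := by
  funext i; fin_cases i <;> simp [C.mul]

theorem C.smul_mul' (c : ZMod 2) (x y : Fin 8 → ZMod 2) :
    C.mul (c • x) y = c • C.mul x y := by
  funext i; fin_cases i <;> simp [C.mul] <;> ring

instance : CommRing C :=
  { (inferInstance : AddCommGroup C) with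
    mul := fun x y => C.mul x y
    one := (Pi.single 0 1 : Fin 8 → ZMod 2)
    mul_assoc := C.mul_assoc'
    mul_comm := C.mul_comm'
    one_mul := C.one_mul'
    mul_one := fun x => (C.mul_comm' _ _).trans (C.one_mul' x)
    left_distrib := C.mul_add'
    right_distrib := C.add_mul'
    zero_mul := C.zero_mul'
    mul_zero := C.mul_zero' }

instance : Algebra (ZMod 2) C := Algebra.ofModule C.smul_mul' (fun c x y => by
  rw [mul_comm, mul_comm x]; exact C.smul_mul' c y x)

theorem C.finrank_eq : Module.finrank (ZMod 2) C = 8 := by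
  have h : Module.finrank (ZMod 2) (Fin 8 → ZMod 2) = 8 := by simp
  exact h

def e (i : Fin 8) : C := (Pi.single i 1 : Fin 8 → ZMod 2)

theorem sum_eq' (x : Fin 8 → ZMod 2) :
    x = ∑ i, (x i).val • (Pi.single i 1 : Fin 8 → ZMod 2) := by
  funext j
  rw [Finset.sum_apply, Finset.sum_eq_single j]
  · rw [Pi.smul_apply, Pi.single_eq_same, nsmul_eq_mul, mul_one, ZMod.natCast_zmod_val]
  · intro i _ hij
    rw [Pi.smul_apply, Pi.single_eq_of_ne (Ne.symm hij), smul_zero]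
  · simp

theorem C.sum_eq (x : C) : x = ∑ i, (x i).val • e i := sum_eq' x

theorem C.e1 (x : C) : e 1 * x = (![0, x 0, 0, 0, 0, x 3, x 4, 0] : Fin 8 → ZMod 2) := by
  change C.mul (Pi.single 1 1) x = _
  funext i; fin_cases i <;> simp [C.mul]
theorem C.e2 (x : C) : e 2 * x = (![0, 0, x 0, 0, 0, 0, x 3, x 4] : Fin 8 → ZMod 2) := by
  change C.mul (Pi.single 2 1) x = _
  funext i; fin_cases i <;> simp [C.mul]
theorem C.e3 (x : C) : e 3 * x = (![0, 0, 0, x 0, 0, x 1, x 2, 0] : Fin 8 → ZMod 2) := by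
  change C.mul (Pi.single 3 1) x = _
  funext i; fin_cases i <;> simp [C.mul]
theorem C.e4 (x : C) : e 4 * x = (![0, 0, 0, 0, x 0, 0, x 1, x 2] : Fin 8 → ZMod 2) := by
  change C.mul (Pi.single 4 1) x = _
  funext i; fin_cases i <;> simp [C.mul]

theorem C.q1 (α β : C) (h : e 4 * α = e 3 * β) :
    α 0 = 0 ∧ β 0 = 0 ∧ β 1 = 0 ∧ α 1 = β 2 ∧ α 2 = 0 := by
  rw [C.e4, C.e3] at h
  have h3 := congrFun h 3
  have h4 := congrFun h 4
  have h5 := congrFun h 5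
  have h6 := congrFun h 6
  have h7 := congrFun h 7
  simp at h3 h4 h5 h6 h7
  exact ⟨h4, h3.symm, h5.symm, h6, h7⟩

theorem C.q2 (α β : C) (h : e 2 * α = e 1 * β) :
    α 0 = 0 ∧ β 0 = 0 ∧ β 3 = 0 ∧ α 3 = β 4 ∧ α 4 = 0 := by
  rw [C.e2, C.e1] at h
  have h3 := congrFun h 1
  have h4 := congrFun h 2
  have h5 := congrFun h 5
  have h6 := congrFun h 6
  have h7 := congrFun h 7
  simp at h3 h4 h5 h6 h7
  exact ⟨h4, h3.symm, h5.symm, h6, h7⟩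

theorem C.q3 (α β γ : C) (h1 : e 4 * α = e 3 * β) (h2 : e 4 * β = e 3 * γ)
    (h3 : e 2 * α = e 1 * β) (h4 : e 2 * β = e 1 * γ)
    (hα : α 5 = 0 ∧ α 6 = 0 ∧ α 7 = 0) (hβ : β 5 = 0 ∧ β 6 = 0 ∧ β 7 = 0)
    (hγ : γ 5 = 0 ∧ γ 6 = 0 ∧ γ 7 = 0) : α = 0 ∧ β = 0 ∧ γ = 0 := by
  obtain ⟨a1, a2, a3, a4, a5⟩ := C.q1 _ _ h1
  obtain ⟨b1, b2, b3, b4, b5⟩ := C.q1 _ _ h2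
  obtain ⟨c1, c2, c3, c4, c5⟩ := C.q2 _ _ h3
  obtain ⟨d1, d2, d3, d4, d5⟩ := C.q2 _ _ h4
  obtain ⟨x1, x2, x3⟩ := hα
  obtain ⟨y1, y2, y3⟩ := hβ
  obtain ⟨z1, z2, z3⟩ := hγ
  rw [b5] at a4
  rw [a3] at b4
  rw [d5] at c4
  rw [c3] at d4
  refine ⟨?_, ?_, ?_⟩
  · funext i; fin_cases i <;> assumption
  · funext i; fin_cases i <;> assumption
  · funext i; fin_cases i
    · assumption
    · assumption
    · exact b4.symm
    · assumption
    · exact d4.symm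
    · assumption
    · assumption
    · assumption

theorem C.ker (f : Z C) (h0 : f.1 1 1 = 0) (h13 : f.1 (e 1) (e 3) = 0)
    (h14 : f.1 (e 1) (e 4) = 0) (h23 : f.1 (e 2) (e 3) = 0) (h24 : f.1 (e 2) (e 4) = 0)
    (h11 : f.1 (e 1) (e 1) 5 = 0 ∧ f.1 (e 1) (e 1) 6 = 0 ∧ f.1 (e 1) (e 1) 7 = 0)
    (h12 : f.1 (e 1) (e 2) 5 = 0 ∧ f.1 (e 1) (e 2) 6 = 0 ∧ f.1 (e 1) (e 2) 7 = 0)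
    (h22 : f.1 (e 2) (e 2) 5 = 0 ∧ f.1 (e 2) (e 2) 6 = 0 ∧ f.1 (e 2) (e 2) 7 = 0)
    (h33 : f.1 (e 3) (e 3) 5 = 0 ∧ f.1 (e 3) (e 3) 6 = 0 ∧ f.1 (e 3) (e 3) 7 = 0)
    (h34 : f.1 (e 3) (e 4) 5 = 0 ∧ f.1 (e 3) (e 4) 6 = 0 ∧ f.1 (e 3) (e 4) 7 = 0)
    (h44 : f.1 (e 4) (e 4) 5 = 0 ∧ f.1 (e 4) (e 4) 6 = 0 ∧ f.1 (e 4) (e 4) 7 = 0) :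
    f = 0 := by
  have sy := f.2.1
  have co := f.2.2
  have h31 := (sy (e 3) (e 1)).trans h13
  have h41 := (sy (e 4) (e 1)).trans h14
  have h32 := (sy (e 3) (e 2)).trans h23
  have h42 := (sy (e 4) (e 2)).trans h24
  have T : ∀ x y z, f.1 x y = 0 → y * z = 0 → x * f.1 y z = f.1 (x * y) z := by
    intro x y z h h'
    have := co x y z
    rw [h, h', map_zero, zero_mul] at this
    linear_combination this
  have T2 : ∀ x y z, x * y = 0 → y * z = 0 → x * f.1 y z = z * f.1 x y := by
    intro x y z h h'
    have := co x y z
    rw [h, h', map_zero, map_zero, AddMonoidHom.zero_apply] at this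
    linear_combination this
  have p43 : e 4 * e 1 = e 3 * e 2 := by decide
  have p21 : e 2 * e 3 = e 1 * e 4 := by decide
  have m11 : e 1 * e 1 = 0 := by decide
  have m12 : e 1 * e 2 = 0 := by decide
  have m21 : e 2 * e 1 = 0 := by decide
  have m22 : e 2 * e 2 = 0 := by decide
  have m33 : e 3 * e 3 = 0 := by decide
  have m34 : e 3 * e 4 = 0 := by decide
  have m43 : e 4 * e 3 = 0 := by decide
  have m44 : e 4 * e 4 = 0 := by decide
  obtain ⟨v11, v12, v22⟩ := C.q3 (f.1 (e 1) (e 1)) (f.1 (e 1) (e 2)) (f.1 (e 2) (e 2))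
    (by rw [T _ _ _ h41 m11, p43, sy (e 1) (e 2), T _ _ _ h32 m21])
    (by rw [T _ _ _ h41 m12, p43, T _ _ _ h32 m22])
    (by rw [T2 _ _ _ m11 m12])
    (by rw [T2 _ _ _ m12 m22])
    h11 h12 h22
  obtain ⟨v33, v34, v44⟩ := C.q3 (f.1 (e 3) (e 3)) (f.1 (e 3) (e 4)) (f.1 (e 4) (e 4))
    (by rw [T2 _ _ _ m33 m34])
    (by rw [T2 _ _ _ m34 m44])
    (by rw [T _ _ _ h23 m33, p21, sy (e 3) (e 4), T _ _ _ h14 m43])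
    (by rw [T _ _ _ h23 m34, p21, T _ _ _ h14 m44])
    h33 h34 h44
  have v21 := (sy (e 2) (e 1)).trans v12
  have v43 := (sy (e 4) (e 3)).trans v34
  have o : ∀ x, f.1 1 x = 0 := by
    intro x
    have := co 1 1 x
    rw [h0] at this
    simpa using this
  have L : ∀ x y z, f.1 x y = 0 → f.1 y z = 0 → y * z = 0 → f.1 (x * y) z = 0 := by
    intro x y z h h1 h2
    rw [← T x y z h h2, h1, mul_zero]
  have e5 : e 5 = e 1 * e 3 := by decide
  have e5' : e 5 = e 3 * e 1 := by decide
  have e6 : e 6 = e 1 * e 4 := by decide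
  have e6' : e 6 = e 4 * e 1 := by decide
  have e7 : e 7 = e 2 * e 4 := by decide
  have e7' : e 7 = e 4 * e 2 := by decide
  have s51 : f.1 (e 5) (e 1) = 0 := by rw [e5']; exact L _ _ _ h31 v11 m11
  have s52 : f.1 (e 5) (e 2) = 0 := by rw [e5']; exact L _ _ _ h31 v12 m12
  have s53 : f.1 (e 5) (e 3) = 0 := by rw [e5]; exact L _ _ _ h13 v33 m33
  have s54 : f.1 (e 5) (e 4) = 0 := by rw [e5]; exact L _ _ _ h13 v34 m34
  have s61 : f.1 (e 6) (e 1) = 0 := by rw [e6']; exact L _ _ _ h41 v11 m11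
  have s62 : f.1 (e 6) (e 2) = 0 := by rw [e6']; exact L _ _ _ h41 v12 m12
  have s63 : f.1 (e 6) (e 3) = 0 := by rw [e6]; exact L _ _ _ h14 v43 m43
  have s64 : f.1 (e 6) (e 4) = 0 := by rw [e6]; exact L _ _ _ h14 v44 m44
  have s71 : f.1 (e 7) (e 1) = 0 := by rw [e7']; exact L _ _ _ h42 v21 m21
  have s72 : f.1 (e 7) (e 2) = 0 := by rw [e7']; exact L _ _ _ h42 v22 m22
  have s73 : f.1 (e 7) (e 3) = 0 := by rw [e7]; exact L _ _ _ h24 v43 m43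
  have s74 : f.1 (e 7) (e 4) = 0 := by rw [e7]; exact L _ _ _ h24 v44 m44
  have z35 : e 3 * e 5 = 0 := by decide
  have z36 : e 3 * e 6 = 0 := by decide
  have z37 : e 3 * e 7 = 0 := by decide
  have z45 : e 4 * e 5 = 0 := by decide
  have z46 : e 4 * e 6 = 0 := by decide
  have z47 : e 4 * e 7 = 0 := by decide
  have s55 : f.1 (e 5) (e 5) = 0 := by
    nth_rw 1 [e5]; exact L _ _ _ h13 ((sy _ _).trans s53) z35
  have s56 : f.1 (e 5) (e 6) = 0 := by
    nth_rw 1 [e5]; exact L _ _ _ h13 ((sy _ _).trans s63) z36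
  have s57 : f.1 (e 5) (e 7) = 0 := by
    nth_rw 1 [e5]; exact L _ _ _ h13 ((sy _ _).trans s73) z37
  have s66 : f.1 (e 6) (e 6) = 0 := by
    nth_rw 1 [e6]; exact L _ _ _ h14 ((sy _ _).trans s64) z46
  have s67 : f.1 (e 6) (e 7) = 0 := by
    nth_rw 1 [e6]; exact L _ _ _ h14 ((sy _ _).trans s74) z47
  have s77 : f.1 (e 7) (e 7) = 0 := by
    nth_rw 1 [e7]; exact L _ _ _ h24 ((sy _ _).trans s74) z47
  have o' : ∀ x, f.1 (e 0) x = 0 := o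
  have le : ∀ i j, i ≤ j → f.1 (e i) (e j) = 0 := by
    intro i j hij
    fin_cases i <;> fin_cases j <;>
      first
      | exact o' _
      | assumption
      | exact (sy _ _).trans (by assumption)
      | exact absurd hij (by decide)
  have all : ∀ i j, f.1 (e i) (e j) = 0 := by
    intro i j
    rcases le_total i j with h | h
    · exact le i j h
    · exact (sy _ _).trans (le j i h)
  have : f.1 = 0 := by
    ext1 x
    ext1 y
    rw [C.sum_eq x, C.sum_eq y]
    simp only [map_sum, map_nsmul, AddMonoidHom.finsetSum_apply, AddMonoidHom.nsmul_apply, all,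
      smul_zero, Finset.sum_const_zero, AddMonoidHom.zero_apply]
  exact Subtype.ext this

theorem C.card_le : Nat.card (Z C) ≤ 2 ^ 58 := by
  let F : Z C → (Fin 5 → C) × (Fin 6 → Fin 3 → ZMod 2) := fun f =>
    (![f.1 1 1, f.1 (e 1) (e 3), f.1 (e 1) (e 4), f.1 (e 2) (e 3), f.1 (e 2) (e 4)],
     ![![f.1 (e 1) (e 1) 5, f.1 (e 1) (e 1) 6, f.1 (e 1) (e 1) 7],
       ![f.1 (e 1) (e 2) 5, f.1 (e 1) (e 2) 6, f.1 (e 1) (e 2) 7],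
       ![f.1 (e 2) (e 2) 5, f.1 (e 2) (e 2) 6, f.1 (e 2) (e 2) 7],
       ![f.1 (e 3) (e 3) 5, f.1 (e 3) (e 3) 6, f.1 (e 3) (e 3) 7],
       ![f.1 (e 3) (e 4) 5, f.1 (e 3) (e 4) 6, f.1 (e 3) (e 4) 7],
       ![f.1 (e 4) (e 4) 5, f.1 (e 4) (e 4) 6, f.1 (e 4) (e 4) 7]])
  have hF : Function.Injective F := by
    intro f f' h
    simp only [F, Prod.mk.injEq] at h
    obtain ⟨h1, h2⟩ := h
    have S : ∀ x y, (f - f').1 x y = f.1 x y - f'.1 x y := fun _ _ => rfl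
    have S' : ∀ x y i, (f - f').1 x y i = f.1 x y i - f'.1 x y i := fun _ _ _ => rfl
    have k : ∀ i j, _ := fun i j => congrFun (congrFun h2 i) j
    rw [← sub_eq_zero]
    apply C.ker
    · rw [S]; exact sub_eq_zero.2 (congrFun h1 0)
    · rw [S]; exact sub_eq_zero.2 (congrFun h1 1)
    · rw [S]; exact sub_eq_zero.2 (congrFun h1 2)
    · rw [S]; exact sub_eq_zero.2 (congrFun h1 3)
    · rw [S]; exact sub_eq_zero.2 (congrFun h1 4)
    · simp only [S']
      exact ⟨sub_eq_zero.2 (k 0 0), sub_eq_zero.2 (k 0 1), sub_eq_zero.2 (k 0 2)⟩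
    · simp only [S']
      exact ⟨sub_eq_zero.2 (k 1 0), sub_eq_zero.2 (k 1 1), sub_eq_zero.2 (k 1 2)⟩
    · simp only [S']
      exact ⟨sub_eq_zero.2 (k 2 0), sub_eq_zero.2 (k 2 1), sub_eq_zero.2 (k 2 2)⟩
    · simp only [S']
      exact ⟨sub_eq_zero.2 (k 3 0), sub_eq_zero.2 (k 3 1), sub_eq_zero.2 (k 3 2)⟩
    · simp only [S']
      exact ⟨sub_eq_zero.2 (k 4 0), sub_eq_zero.2 (k 4 1), sub_eq_zero.2 (k 4 2)⟩
    · simp only [S']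
      exact ⟨sub_eq_zero.2 (k 5 0), sub_eq_zero.2 (k 5 1), sub_eq_zero.2 (k 5 2)⟩
  have := Nat.card_le_card_of_injective F hF
  have hC : Nat.card C = 2 ^ 8 := by
    rw [Module.natCard_eq_pow_finrank (K := ZMod 2), Nat.card_zmod, C.finrank_eq]
  rw [Nat.card_prod, Nat.card_fun, Nat.card_fun, Nat.card_fun, hC, Nat.card_zmod] at this
  simp only [Nat.card_fin] at this
  norm_num at this ⊢
  exact this

theorem exists_alg (n : ℕ) (hn : 8 ≤ n) :
    ∃ (B : Type) (_ : CommRing B) (_ : Algebra (ZMod 2) B), Finite B ∧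
      Module.finrank (ZMod 2) B = n ∧ Nat.card (Z B) < 2 ^ n ^ 2 := by
  induction n, hn using Nat.le_induction with
  | base => exact ⟨C, inferInstance, inferInstance, inferInstance, C.finrank_eq,
      C.card_le.trans_lt (Nat.pow_lt_pow_right (by norm_num) (by norm_num))⟩
  | succ n hn ih =>
    obtain ⟨B, i1, i2, i3, h1, h2⟩ := ih
    refine ⟨B × ZMod 2, inferInstance, inferInstance, inferInstance, ?_, ?_⟩
    · have : Module.Finite (ZMod 2) B := Module.Finite.of_finite
      rw [Module.finrank_prod, h1, Module.finrank_self]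
    · refine (step B).trans_lt ?_
      rw [h1, show 2 ^ (n + 1) ^ 2 = 2 ^ n ^ 2 * (2 ^ n * (2 ^ n * 2)) by ring]
      exact Nat.mul_lt_mul_of_pos_right h2 (by positivity)

end Stmt10

/-- For each `n ≥ 8` there exist a prime `p` and a commutative `F_p`-algebra `A₀`
of dimension `n` such that for every commutative ring `A` that is free of rank `n`
as a `ℤ`-module and with `ℚ ⊗[ℤ] A` reduced (i.e. an order in an étale
`ℚ`-algebra), the `F_p`-algebra `A/pA` is not isomorphic to `A₀`. -/
theorem stmt10 (n : ℕ) (hn : 8 ≤ n) :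
    ∃ (p : ℕ), p.Prime ∧
      ∃ (A₀ : Type) (_ : CommRing A₀) (_ : Algebra (ZMod p) A₀),
        Module.finrank (ZMod p) A₀ = n ∧
        ∀ (A : Type) (_ : CommRing A), Module.Free ℤ A → Module.finrank ℤ A = n →
          IsReduced (ℚ ⊗[ℤ] A) →
          ¬ Nonempty ((A ⧸ Ideal.span {(p : A)}) ≃+* A₀) := by
  obtain ⟨B, i1, i2, i3, h1, h2⟩ := Stmt10.exists_alg n hn
  refine ⟨2, Nat.prime_two, B, i1, i2, h1, ?_⟩
  rintro A iA hfree hrk hred ⟨E⟩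
  have : Module.Finite ℤ A := Module.finite_of_finrank_pos (by omega)
  have := Stmt10.lower 2 (E.toRingHom.comp (Ideal.Quotient.mk (Ideal.span {((2 : ℕ) : A)})))
    (E.surjective.comp Ideal.Quotient.mk_surjective) (fun a => by
      rw [← dvd_def, ← Ideal.mem_span_singleton, ← Ideal.Quotient.eq_zero_iff_mem]
      exact E.map_eq_zero_iff)
  rw [hrk] at this
  omega
end

section
/- Let k be a field and n ≥ 3 an integer. Let m be the kernel of the k-algebra homomorphism R¹_n(k) → k sending c_{ijl} to 0 for all i,j ≥ 2 and c_{1jl} to δ_{jl} and c_{i1l} to δ_{il} (this is the point • of B^1_{n,k} corresponding to the algebra k[x_1,...,x_{n-1}]/(x_1,...,x_{n-1})^2 with basis 1, x_1, ..., x_{n-1}). Then the k-vector space m/m^2 has dimension n(n-1)^2/2; equivalently, the Zariski tangent space of B^1_{n,k} at • has dimension n(n-1)^2/2. -/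
open MvPolynomial in
/-- The defining relations of the moduli space `B¹_n` of rank-`n` algebras with a
basis whose first vector is the identity: commutativity `c_{ijl} - c_{jil}`,
associativity `Σ_m c_{ijm} c_{mkl} - Σ_m c_{jkm} c_{iml}`, and `c_{1jl} - δ_{jl}`
(indices are `0`-based, so the first basis vector has index `0`). -/
def structRels1 (k : Type) [CommRing k] (n : ℕ) [NeZero n] :
    Set (MvPolynomial (Fin n × Fin n × Fin n) k) :=
  (Set.range fun t : Fin n × Fin n × Fin n =>
      (X (t.1, t.2.1, t.2.2) : MvPolynomial (Fin n × Fin n × Fin n) k)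
        - X (t.2.1, t.1, t.2.2))
  ∪ (Set.range fun t : Fin n × Fin n × Fin n × Fin n =>
      (∑ m : Fin n, X (t.1, t.2.1, m) * X (m, t.2.2.1, t.2.2.2))
        - ∑ m : Fin n, X (t.2.1, t.2.2.1, m) * X (t.1, m, t.2.2.2))
  ∪ (Set.range fun t : Fin n × Fin n =>
      (X (0, t.1, t.2) : MvPolynomial (Fin n × Fin n × Fin n) k)
        - if t.1 = t.2 then 1 else 0)

/-- `R1ring k n` is the coordinate ring of the moduli space `B¹_{n,k}` of rank-`n`
algebras equipped with a basis whose first vector equals `1`. -/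
abbrev R1ring (k : Type) [CommRing k] (n : ℕ) [NeZero n] : Type :=
  MvPolynomial (Fin n × Fin n × Fin n) k ⧸ Ideal.span (structRels1 k n)

/-- The point `•` of `B¹_{n,k}`: the values of the structure constants of the
algebra `k[x₁,…,x_{n-1}]/(x₁,…,x_{n-1})²` with basis `1, x₁, …, x_{n-1}`:
`c_{1jl} = δ_{jl}`, `c_{i1l} = δ_{il}`, and `c_{ijl} = 0` for `i, j ≥ 2`. -/
def ptVal (k : Type) [CommRing k] (n : ℕ) [NeZero n] : Fin n × Fin n × Fin n → k :=
  fun t =>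
    if t.1 = 0 then (if t.2.1 = t.2.2 then 1 else 0)
    else if t.2.1 = 0 then (if t.1 = t.2.2 then 1 else 0)
    else 0

namespace S13

section gen
variable {A : Type} [CommRing A] {n : ℕ} [NeZero n] 

lemma assoc_of (c : Fin n × Fin n × Fin n → A)
    (hs : ∀ i j l, c (i, j, l) = c (j, i, l))
    (h0 : ∀ j l, c (0, j, l) = if j = l then 1 else 0)
    (hz : ∀ i j k l m, i ≠ 0 → j ≠ 0 → k ≠ 0 → c (i, j, m) * c (m, k, l) = 0)
    (i j k l : Fin n) :
    (∑ m : Fin n, c (i, j, m) * c (m, k, l)) = ∑ m : Fin n, c (j, k, m) * c (i, m, l) := by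
  have h0' : ∀ j l, c (j, 0, l) = if j = l then 1 else 0 := fun j l => by rw [hs, h0]
  by_cases hi : i = 0
  · subst hi; simp [h0]
  by_cases hj : j = 0
  · subst hj; simp [h0, h0']
  by_cases hk : k = 0
  · subst hk; simp [h0']
  rw [Finset.sum_eq_zero, Finset.sum_eq_zero]
  · intro m _
    rw [hs i m l]; exact hz _ _ _ _ _ hj hk hi
  · intro m _
    exact hz _ _ _ _ _ hi hj hk

/-- lift a system of structure constants to a homomorphism -/
lemma exists_lift (k : Type) [Field k] [Algebra k A] (c : Fin n × Fin n × Fin n → A)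
    (hs : ∀ i j l, c (i, j, l) = c (j, i, l))
    (h0 : ∀ j l, c (0, j, l) = if j = l then 1 else 0)
    (hz : ∀ i j k l m, i ≠ 0 → j ≠ 0 → k ≠ 0 → c (i, j, m) * c (m, k, l) = 0) :
    ∃ φ : R1ring k n →ₐ[k] A, ∀ t, φ (Ideal.Quotient.mk _ (MvPolynomial.X t)) = c t := by
  have key : ∀ a ∈ Ideal.span (structRels1 k n), MvPolynomial.aeval (R := k) c a = 0 := by
    intro a ha
    have : Ideal.span (structRels1 k n) ≤ RingHom.ker (MvPolynomial.aeval (R := k) c) := by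
      rw [Ideal.span_le]
      rintro _ ((⟨t, rfl⟩ | ⟨t, rfl⟩) | ⟨t, rfl⟩)
      · simp [RingHom.mem_ker, hs t.1 t.2.1]
      · simp only [SetLike.mem_coe, RingHom.mem_ker, map_sub, map_sum, map_mul,
          MvPolynomial.aeval_X]
        rw [assoc_of c hs h0 hz, sub_self]
      · simp only [SetLike.mem_coe, RingHom.mem_ker, map_sub, MvPolynomial.aeval_X, h0]
        split_ifs <;> simp
    exact this ha
  refine ⟨Ideal.Quotient.liftₐ _ (MvPolynomial.aeval (R := k) c) key, fun t => ?_⟩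
  exact MvPolynomial.aeval_X c t
end gen

section main
variable (k : Type) [Field k] (n : ℕ) [NeZero n]

abbrev J : Type := {i : Fin n // i ≠ 0}
abbrev I : Type := Sym2 (J n) × J n
abbrev W : Type := I n → k

open Classical in
noncomputable def e (t : Fin n × Fin n × Fin n) : W k n :=
  if h : t.1 ≠ 0 ∧ t.2.1 ≠ 0 ∧ t.2.2 ≠ 0 then
    Pi.single (s(⟨t.1, h.1⟩, ⟨t.2.1, h.2.1⟩), ⟨t.2.2, h.2.2⟩) 1 else 0

lemma e_symm (i j l : Fin n) : e k n (i, j, l) = e k n (j, i, l) := by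
  unfold e
  by_cases h : i ≠ 0 ∧ j ≠ 0 ∧ l ≠ 0
  · have h' : j ≠ 0 ∧ i ≠ 0 ∧ l ≠ 0 := ⟨h.2.1, h.1, h.2.2⟩
    rw [dif_pos h, dif_pos h', Sym2.eq_swap]
  · have h' : ¬ (j ≠ 0 ∧ i ≠ 0 ∧ l ≠ 0) := by tauto
    rw [dif_neg h, dif_neg h']

lemma pt_symm (i j l : Fin n) : ptVal k n (i, j, l) = ptVal k n (j, i, l) := by
  unfold ptVal
  by_cases hi : i = 0 <;> by_cases hj : j = 0 <;> simp [hi, hj]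

lemma pt_zero (i j l : Fin n) (hi : i ≠ 0) (hj : j ≠ 0) : ptVal k n (i, j, l) = 0 := by
  simp [ptVal, hi, hj]

lemma exists_psi : ∃ ψ : R1ring k n →ₐ[k] k,
      ∀ t, ψ (Ideal.Quotient.mk _ (MvPolynomial.X t)) = ptVal k n t := by
  apply exists_lift k (ptVal k n) (pt_symm k n)
  · intro j l; simp [ptVal]
  · intro i j p l m hi hj hp
    simp [pt_zero k n i j m hi hj]

lemma exists_Phi : ∃ φ : R1ring k n →ₐ[k] TrivSqZeroExt k (W k n),
      ∀ t, φ (Ideal.Quotient.mk _ (MvPolynomial.X t)) =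
        TrivSqZeroExt.inl (ptVal k n t) + TrivSqZeroExt.inr (e k n t) := by
  apply exists_lift k (fun t => TrivSqZeroExt.inl (ptVal k n t) + TrivSqZeroExt.inr (e k n t))
  · intro i j l
    simp only [pt_symm k n i j l, e_symm k n i j l]
  · intro j l
    have : e k n (0, j, l) = 0 := by simp [e]
    rw [this]
    simp only [ptVal]
    simp
    split_ifs <;> simp
  · intro i j p l m hi hj hp
    by_cases hm : m = 0
    · have : e k n (i, j, m) = 0 := by simp [e, hm]
      simp [this, pt_zero k n i j m hi hj]
    · simp [pt_zero k n i j m hi hj, pt_zero k n m p l hm hp]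

lemma card_I : Fintype.card (I n) = n * (n - 1) ^ 2 / 2 := by
  have hJ : Fintype.card (J n) = n - 1 := by
    simp [J, Fintype.card_subtype_compl]
  rw [Fintype.card_prod, Sym2.card, hJ]
  obtain ⟨m, rfl⟩ : ∃ m, n = m + 1 := ⟨n - 1, by have := NeZero.pos n; omega⟩
  simp only [Nat.add_sub_cancel]
  rw [Nat.choose_two_right, Nat.add_sub_cancel]
  have h2 : 2 ∣ (m + 1) * m := by
    rw [mul_comm]; exact (Nat.even_mul_succ_self m).two_dvd
  obtain ⟨q, hq⟩ := h2
  have : (m + 1) * m ^ 2 = 2 * (q * m) := by rw [pow_two, ← mul_assoc, hq]; ring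
  rw [this, hq]; simp

noncomputable abbrev x (t : Fin n × Fin n × Fin n) : R1ring k n := Ideal.Quotient.mk _ (MvPolynomial.X t)

lemma smul_eq (a : k) (r : R1ring k n) : a • r = algebraMap k (R1ring k n) a * r := by
  obtain ⟨f, rfl⟩ := Ideal.Quotient.mk_surjective r
  change Ideal.Quotient.mk (Ideal.span (structRels1 k n)) (a • f) =
    Ideal.Quotient.mk (Ideal.span (structRels1 k n)) (MvPolynomial.C a) * _
  rw [MvPolynomial.smul_eq_C_mul, map_mul]

lemma x_symm (i j l : Fin n) : x k n (i, j, l) = x k n (j, i, l) := by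
  apply Ideal.Quotient.eq.2
  apply Ideal.subset_span
  exact Or.inl (Or.inl ⟨(i, j, l), rfl⟩)

lemma x_zero (j l : Fin n) : x k n (0, j, l) = if j = l then 1 else 0 := by
  have : x k n (0, j, l) = Ideal.Quotient.mk _ (if j = l then 1 else 0) := by
    apply Ideal.Quotient.eq.2
    apply Ideal.subset_span
    exact Or.inr ⟨(j, l), rfl⟩
  rw [this]; split_ifs <;> simp

lemma x_assoc (i j p l : Fin n) : (∑ m : Fin n, x k n (i, j, m) * x k n (m, p, l)) =
    ∑ m : Fin n, x k n (j, p, m) * x k n (i, m, l) := by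
  have := Ideal.Quotient.eq (I := Ideal.span (structRels1 k n)).2
    (Ideal.subset_span (Or.inl (Or.inr ⟨(i, j, p, l), rfl⟩)))
  simpa only [map_sum, map_mul] using this

noncomputable def y (t : I n) : R1ring k n :=
  Sym2.lift ⟨fun i j : J n => x k n (i.1, j.1, t.2.1), fun i j => x_symm k n _ _ _⟩ t.1

noncomputable def sig : W k n →ₗ[k] R1ring k n := Fintype.linearCombination k (y k n)

lemma sig_e (i j l : Fin n) (hi : i ≠ 0) (hj : j ≠ 0) (hl : l ≠ 0) :
    sig k n (e k n (i, j, l)) = x k n (i, j, l) := by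
  classical
  have h : i ≠ 0 ∧ j ≠ 0 ∧ l ≠ 0 := ⟨hi, hj, hl⟩
  rw [e, dif_pos h, sig]
  have := Fintype.linearCombination_apply_single k (y k n)
    (s(⟨i, hi⟩, ⟨j, hj⟩), ⟨l, hl⟩) 1
  rw [one_smul] at this
  convert this using 2
  rfl

variable {k n}
variable (ψ : R1ring k n →ₐ[k] k) (hψ : ∀ t, ψ (x k n t) = ptVal k n t)
include hψ

lemma x_mem (i j l : Fin n) (hi : i ≠ 0) (hj : j ≠ 0) : x k n (i, j, l) ∈ RingHom.ker ψ := by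
  rw [RingHom.mem_ker, hψ, pt_zero k n i j l hi hj]

lemma sig_mem (w : W k n) : sig k n w ∈ RingHom.ker ψ := by
  rw [sig, Fintype.linearCombination_apply]
  refine Ideal.sum_mem _ fun t _ => ?_
  rw [smul_eq]
  apply Ideal.mul_mem_left
  obtain ⟨z, l⟩ := t
  induction z using Sym2.ind with
  | _ i j => exact x_mem ψ hψ _ _ _ i.2 j.2

lemma x_sq (hn : 3 ≤ n) (i j : Fin n) (hi : i ≠ 0) (hj : j ≠ 0) :
    x k n (i, j, 0) ∈ RingHom.ker ψ ^ 2 := by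
  obtain ⟨p, hp⟩ : ∃ p : Fin n, p ∉ ({0, i} : Finset (Fin n)) := by
    by_contra! h
    have h1 : Finset.univ ⊆ ({0, i} : Finset (Fin n)) := fun a _ => h a
    have := (Finset.card_le_card h1).trans Finset.card_le_two
    simp at this; omega
  simp only [Finset.mem_insert, Finset.mem_singleton, not_or] at hp
  obtain ⟨hp0, hpi⟩ := hp
  have h := x_assoc k n i j p p
  rw [← Finset.add_sum_erase _ _ (Finset.mem_univ 0),
    ← Finset.add_sum_erase _ _ (Finset.mem_univ 0), x_zero, x_symm k n i 0, x_zero,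
    if_pos rfl, if_neg (Ne.symm hpi), mul_one, mul_zero, zero_add] at h
  rw [eq_sub_of_add_eq h, pow_two]
  apply Ideal.sub_mem
  · refine Ideal.sum_mem _ fun m hm => ?_
    have hm := Finset.ne_of_mem_erase hm
    exact Ideal.mul_mem_mul (x_mem ψ hψ _ _ _ hj hp0) (x_mem ψ hψ _ _ _ hi hm)
  · refine Ideal.sum_mem _ fun m hm => ?_
    have hm := Finset.ne_of_mem_erase hm
    exact Ideal.mul_mem_mul (x_mem ψ hψ _ _ _ hi hj) (x_mem ψ hψ _ _ _ hm hp0)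

variable (φ : R1ring k n →ₐ[k] TrivSqZeroExt k (W k n))
  (hφ : ∀ t, φ (x k n t) = TrivSqZeroExt.inl (ptVal k n t) + TrivSqZeroExt.inr (e k n t))
include hφ

lemma fst_phi (r : R1ring k n) : (φ r).fst = ψ r := by
  have : (TrivSqZeroExt.fstHom k k (W k n)).comp φ = ψ := by
    apply Ideal.Quotient.algHom_ext
    apply MvPolynomial.algHom_ext
    intro t
    have h1 := hφ t
    have h2 := hψ t
    simp only [x] at h1 h2
    simp [h1, h2]
  exact DFunLike.congr_fun this r

lemma gen (hn : 3 ≤ n) (t : Fin n × Fin n × Fin n) :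
    x k n t - algebraMap k _ (ψ (x k n t)) - sig k n (φ (x k n t)).snd ∈ RingHom.ker ψ ^ 2 := by
  have hs : (φ (x k n t)).snd = e k n t := by rw [hφ]; simp
  rw [hs, hψ]
  obtain ⟨i, j, l⟩ := t
  by_cases hi : i = 0
  · subst hi
    have : e k n (0, j, l) = 0 := by simp [e]
    rw [this, x_zero]
    simp only [ptVal]
    simp
  by_cases hj : j = 0
  · subst hj
    have : e k n (i, 0, l) = 0 := by simp [e]
    rw [this, x_symm, x_zero]
    simp only [ptVal, hi]
    simp
  rw [pt_zero k n i j l hi hj]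
  by_cases hl : l = 0
  · subst hl
    have : e k n (i, j, 0) = 0 := by simp [e]
    rw [this]
    simpa using x_sq ψ hψ hn i j hi hj
  · rw [sig_e k n i j l hi hj hl]; simp

lemma approx (hn : 3 ≤ n) (r : R1ring k n) :
    r - algebraMap k _ (ψ r) - sig k n (φ r).snd ∈ RingHom.ker ψ ^ 2 := by
  obtain ⟨f, rfl⟩ := Ideal.Quotient.mk_surjective r
  induction f using MvPolynomial.induction_on with
  | C a =>
    have h : (Ideal.Quotient.mk (Ideal.span (structRels1 k n))) (MvPolynomial.C a)
      = algebraMap k (R1ring k n) a := rfl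
    rw [h, AlgHom.commutes, AlgHom.commutes]
    have : (algebraMap k (TrivSqZeroExt k (W k n)) a).snd = 0 := by
      simp [TrivSqZeroExt.algebraMap_eq_inl]
    rw [this]; simp
  | add f g hf hg =>
    have := Ideal.add_mem _ hf hg
    convert this using 1
    simp only [map_add, TrivSqZeroExt.snd_add]
    ring
  | mul_X f t hf =>
    have ht := gen ψ hψ φ hφ hn t
    rw [map_mul]
    change (Ideal.Quotient.mk (Ideal.span (structRels1 k n)) f) * x k n t - _ - _ ∈ _
    set r := Ideal.Quotient.mk (Ideal.span (structRels1 k n)) f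
    change r * x k n t - algebraMap k _ (ψ (r * x k n t)) - sig k n (φ (r * x k n t)).snd ∈ _
    set s := x k n t
    have e1 : sig k n (φ (r * s)).snd = algebraMap k _ (ψ r) * sig k n (φ s).snd
        + algebraMap k _ (ψ s) * sig k n (φ r).snd := by
      rw [map_mul, TrivSqZeroExt.snd_mul, fst_phi ψ hψ φ hφ, fst_phi ψ hψ φ hφ]
      have hsm : ∀ (a : k) (w : W k n), sig k n (a • w) = algebraMap k _ a * sig k n w :=
        fun a w => (map_smul (sig k n) a w).trans (smul_eq k n _ _)
      rw [op_smul_eq_smul, map_add, hsm, hsm]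
    rw [e1, map_mul, map_mul]
    have h1 := Ideal.mul_mem_left _ s hf
    have h2 := Ideal.mul_mem_left _ (algebraMap k _ (ψ r)) ht
    have h3 : (s - algebraMap k _ (ψ s)) * sig k n (φ r).snd ∈ RingHom.ker ψ ^ 2 := by
      rw [pow_two]
      apply Ideal.mul_mem_mul _ (sig_mem ψ hψ _)
      simp [RingHom.mem_ker]
    have := Ideal.add_mem _ (Ideal.add_mem _ h1 h2) h3
    convert this using 1
    ring

lemma sq_le (r : R1ring k n) (hr : r ∈ RingHom.ker ψ ^ 2) : (φ r).snd = 0 := by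
  rw [pow_two] at hr
  induction hr using Submodule.mul_induction_on' with
  | mem_mul_mem a ha b hb =>
    rw [RingHom.mem_ker] at ha hb
    rw [map_mul, TrivSqZeroExt.snd_mul, fst_phi ψ hψ φ hφ, fst_phi ψ hψ φ hφ, ha, hb]
    simp
  | add a _ b _ ha hb => rw [map_add, TrivSqZeroExt.snd_add, ha, hb, add_zero]

lemma final (hn : 3 ≤ n) : Module.finrank k
        (↥(Submodule.restrictScalars k (RingHom.ker ψ : Ideal (R1ring k n))) ⧸
          Submodule.comap
            (Submodule.restrictScalars k (RingHom.ker ψ : Ideal (R1ring k n))).subtype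
            (Submodule.restrictScalars k ((RingHom.ker ψ : Ideal (R1ring k n)) ^ 2)))
        = n * (n - 1) ^ 2 / 2 := by
  let D : R1ring k n →ₗ[k] W k n := (TrivSqZeroExt.sndHom k (W k n)).comp φ.toLinearMap
  have hD : ∀ r, D r = (φ r).snd := fun r => rfl
  let L := D.comp (Submodule.restrictScalars k (RingHom.ker ψ : Ideal (R1ring k n))).subtype
  have hker : Submodule.comap
            (Submodule.restrictScalars k (RingHom.ker ψ : Ideal (R1ring k n))).subtype
            (Submodule.restrictScalars k ((RingHom.ker ψ : Ideal (R1ring k n)) ^ 2))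
      = LinearMap.ker L := by
    ext ⟨r, hr⟩
    have hr' : ψ r = 0 := hr
    change r ∈ RingHom.ker ψ ^ 2 ↔ (φ r).snd = 0
    constructor
    · exact sq_le ψ hψ φ hφ r
    · intro h
      have := approx ψ hψ φ hφ hn r
      rw [h, hr'] at this
      simpa using this
  have hsurj : Function.Surjective L := by
    classical
    rw [← LinearMap.range_eq_top, eq_top_iff, ← (Pi.basisFun k (I n)).span_eq,
      Submodule.span_le]
    rintro _ ⟨⟨z, l⟩, rfl⟩
    induction z using Sym2.ind with
    | _ i j =>
      refine ⟨⟨x k n (i.1, j.1, l.1), x_mem ψ hψ _ _ _ i.2 j.2⟩, ?_⟩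
      change (φ (x k n (i.1, j.1, l.1))).snd = _
      rw [hφ]
      have h : i.1 ≠ 0 ∧ j.1 ≠ 0 ∧ l.1 ≠ 0 := ⟨i.2, j.2, l.2⟩
      rw [TrivSqZeroExt.snd_add, TrivSqZeroExt.snd_inl, TrivSqZeroExt.snd_inr, zero_add, e,
        dif_pos h, Pi.basisFun_apply]
  rw [hker, (L.quotKerEquivOfSurjective hsurj).finrank_eq, Module.finrank_fintype_fun_eq_card,
    card_I]

end main
end S13

/-- For a field `k` and `n ≥ 3`, there is a (unique) `k`-algebra homomorphism
`ψ : R¹_n(k) → k` sending `c_{ijl}` to the structure constants of the point `•`,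
and for its kernel `m = ker ψ` the `k`-vector space `m/m²` (the Zariski tangent
space of `B¹_{n,k}` at `•`) has dimension `n(n-1)²/2`. -/
theorem stmt13 (k : Type) [Field k] (n : ℕ) [NeZero n] (hn : 3 ≤ n) :
    (∃ ψ : R1ring k n →ₐ[k] k,
      ∀ t, ψ (Ideal.Quotient.mk _ (MvPolynomial.X t)) = ptVal k n t) ∧
    ∀ ψ : R1ring k n →ₐ[k] k,
      (∀ t, ψ (Ideal.Quotient.mk _ (MvPolynomial.X t)) = ptVal k n t) →
      Module.finrank k
        (↥(Submodule.restrictScalars k (RingHom.ker ψ : Ideal (R1ring k n))) ⧸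
          Submodule.comap
            (Submodule.restrictScalars k (RingHom.ker ψ : Ideal (R1ring k n))).subtype
            (Submodule.restrictScalars k ((RingHom.ker ψ : Ideal (R1ring k n)) ^ 2)))
        = n * (n - 1) ^ 2 / 2 := by

  refine ⟨S13.exists_psi k n, fun ψ hψ => ?_⟩
  obtain ⟨φ, hφ⟩ := S13.exists_Phi k n
  exact S13.final ψ hψ φ hφ hn
end

section
/- Let V and W be finite-dimensional vector spaces over a field k and let β : V × V → W be any symmetric bilinear map. Then there exists a subspace U ≤ V with dim U ≤ dim W + 1 such that the span of β(U × U) equals the span of β(V × V). -/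
namespace Stmt16

variable {k : Type} [Field k] {V W : Type} [AddCommGroup V] [Module k V]
    [AddCommGroup W] [Module k W]

def State (β : V →ₗ[k] V →ₗ[k] W) (S : Submodule k W) : Prop :=
  (∀ x, β x x ∈ S) ∧ ∃ U : Submodule k V, S ≤ Submodule.map₂ β U U ∧
    Module.finrank k U ≤ Module.finrank k S + 1 ∧
    (Module.finrank k U ≤ Module.finrank k S ∨
      ∃ (U0 : Submodule k V) (S0 : Submodule k W) (v w : V), w ∈ U0 ∧ U0 ≤ U ∧ v ∈ U ∧
        S0 ≤ Submodule.map₂ β U0 U0 ∧ S ≤ S0 ⊔ Submodule.span k {β w v} ∧ S0 ≤ S ∧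
        Module.finrank k U0 ≤ Module.finrank k S)

theorem finrank_sup_single [FiniteDimensional k V] (U : Submodule k V) (v : V) :
    Module.finrank k (U ⊔ Submodule.span k {v} : Submodule k V) ≤ Module.finrank k U + 1 := by
  have h1 := Submodule.finrank_add_le_finrank_add_finrank U (Submodule.span k {v})
  have h2 := finrank_span_le_card (R := k) ({v} : Set V)
  simp at h2
  omega

theorem finrank_sup_lt [FiniteDimensional k W] (S : Submodule k W) (z : W) (hz : z ∉ S) :
    S < S ⊔ Submodule.span k {z} := by
  refine lt_of_le_of_ne le_sup_left fun h => hz ?_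
  rw [h]
  exact Submodule.mem_sup_right (Submodule.mem_span_singleton_self z)

theorem state_next [FiniteDimensional k V] [FiniteDimensional k W]
    (β : V →ₗ[k] V →ₗ[k] W) (S : Submodule k W)
    (hD : ∀ x, β x x ∈ S) (U0 : Submodule k V) (v w : V) (hw : w ∈ U0)
    (hS : S ≤ Submodule.map₂ β U0 U0) (hd : Module.finrank k U0 ≤ Module.finrank k S + 1)
    (hz : β w v ∉ S) : ∃ S', S < S' ∧ State β S' := by
  have hlt := finrank_sup_lt S _ hz
  have hr := Submodule.finrank_lt_finrank_of_lt hlt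
  have hv : v ∈ U0 ⊔ Submodule.span k {v} :=
    Submodule.mem_sup_right (Submodule.mem_span_singleton_self v)
  refine ⟨_, hlt, fun x => hlt.le (hD x), U0 ⊔ Submodule.span k {v}, ?_, ?_, Or.inr
    ⟨U0, S, v, w, hw, le_sup_left, hv, hS, le_rfl, le_sup_left, by omega⟩⟩
  · refine sup_le (hS.trans (Submodule.map₂_le_map₂ le_sup_left le_sup_left)) ?_
    rw [Submodule.span_singleton_le_iff_mem]
    exact Submodule.apply_mem_map₂ _ (Submodule.mem_sup_left hw) hv
  · have := finrank_sup_single U0 v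
    omega

theorem state_base [FiniteDimensional k V] [FiniteDimensional k W]
    (β : V →ₗ[k] V →ₗ[k] W) : ∃ S, State β S := by
  obtain ⟨f, hf, hspan, -⟩ := Submodule.exists_fun_fin_finrank_span_eq k
    (Set.range fun x => β x x)
  choose g hg using hf
  have hd : Module.finrank k (Submodule.span k (Set.range g)) ≤
      Module.finrank k (Submodule.span k (Set.range fun x => β x x)) := by
    have := finrank_range_le_card (R := k) g
    simpa [Set.finrank] using this
  refine ⟨Submodule.span k (Set.range fun x => β x x), fun x => Submodule.subset_span ⟨x, rfl⟩, Submodule.span k (Set.range g), ?_,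
    by omega, Or.inl hd⟩
  refine hspan.symm.le.trans ?_
  rw [Submodule.span_le]
  rintro _ ⟨i, rfl⟩
  rw [← hg i]
  exact Submodule.apply_mem_map₂ _ (Submodule.subset_span ⟨i, rfl⟩)
    (Submodule.subset_span ⟨i, rfl⟩)

theorem state_step [FiniteDimensional k V] [FiniteDimensional k W]
    (β : V →ₗ[k] V →ₗ[k] W) (hsymm : ∀ x y : V, β x y = β y x) (S : Submodule k W)
    (h : State β S) (x y : V) (hxy : β x y ∉ S) : ∃ S', S < S' ∧ State β S' := by
  obtain ⟨hD, U, hS, hd, hc⟩ := h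
  by_cases hU : ∀ u ∈ U, ∀ v, β u v ∈ S
  swap
  · push Not at hU
    obtain ⟨u, hu, v, hv⟩ := hU
    exact state_next β S hD U v u hu hS hd hv
  rcases hc with hc | ⟨U0, S0, v, w, hw, hU0, hv, hS0, hSS, hS0S, hd0⟩
  · refine state_next β S hD (U ⊔ Submodule.span k {x}) y x
      (Submodule.mem_sup_right (Submodule.mem_span_singleton_self x))
      (hS.trans (Submodule.map₂_le_map₂ le_sup_left le_sup_left)) ?_ hxy
    have := finrank_sup_single U x
    omega
  have key : ∃ x' y', β x' y' ∉ S ∧ β w x' ∈ S0 := by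
    have hx := hSS (hU w (hU0 hw) x)
    have hy := hSS (hU w (hU0 hw) y)
    rw [Submodule.mem_sup] at hx hy
    obtain ⟨s, hs, t, ht, hst⟩ := hx
    obtain ⟨s', hs', t', ht', hst'⟩ := hy
    obtain ⟨a, rfl⟩ := Submodule.mem_span_singleton.1 ht
    obtain ⟨b, rfl⟩ := Submodule.mem_span_singleton.1 ht'
    by_cases ha : a = 0
    · refine ⟨x, y, hxy, ?_⟩
      rw [← hst, ha]
      simpa using hs
    · refine ⟨y - (b / a) • x, x, fun hmem => hxy ?_, ?_⟩
      · have := S.add_mem hmem (S.smul_mem (b / a) (hD x))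
        simpa [hsymm y x] using this
      · have : β w (y - (b / a) • x) = s' - (b / a) • s := by
          rw [map_sub, map_smul, ← hst, ← hst', smul_add, smul_smul, div_mul_cancel₀ _ ha]
          abel
        rw [this]
        exact S0.sub_mem hs' (S0.smul_mem _ hs)
  obtain ⟨x', y', h1, h2⟩ := key
  have hm : v + x' ∈ U0 ⊔ Submodule.span k {v + x'} :=
    Submodule.mem_sup_right (Submodule.mem_span_singleton_self _)
  have hS0' : S0 ≤ Submodule.map₂ β (U0 ⊔ Submodule.span k {v + x'})
      (U0 ⊔ Submodule.span k {v + x'}) :=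
    hS0.trans (Submodule.map₂_le_map₂ le_sup_left le_sup_left)
  refine state_next β S hD (U0 ⊔ Submodule.span k {v + x'}) y' (v + x') hm ?_ ?_ ?_
  · refine hSS.trans (sup_le hS0' ?_)
    rw [Submodule.span_singleton_le_iff_mem]
    have e : β w v = β w (v + x') - β w x' := by simp
    rw [e]
    exact Submodule.sub_mem _
      (Submodule.apply_mem_map₂ _ (Submodule.mem_sup_left hw) hm) (hS0' h2)
  · have := finrank_sup_single U0 (v + x')
    omega
  · intro hmem
    apply h1
    have := S.sub_mem hmem (hU v hv y')
    simpa using this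

end Stmt16

/-- For any symmetric bilinear map `β : V × V → W` between finite-dimensional
`k`-vector spaces, there is a subspace `U ≤ V` with `dim U ≤ dim W + 1` such that
the span of `β(U × U)` equals the span of `β(V × V)`. -/
theorem stmt16 (k : Type) [Field k] (V W : Type) [AddCommGroup V] [Module k V]
    [AddCommGroup W] [Module k W] [FiniteDimensional k V] [FiniteDimensional k W]
    (β : V →ₗ[k] V →ₗ[k] W) (hsymm : ∀ x y : V, β x y = β y x) :
    ∃ U : Submodule k V, Module.finrank k U ≤ Module.finrank k W + 1 ∧
      Submodule.span k (Set.image2 (fun u v => β u v) (U : Set V) (U : Set V)) =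
        Submodule.span k (Set.image2 (fun u v => β u v) (Set.univ : Set V) Set.univ) := by
  obtain ⟨S, hS, hmax⟩ := (wellFounded_gt (α := Submodule k W)).has_min
    {S | Stmt16.State β S} (Stmt16.state_base β)
  have hall : ∀ x y, β x y ∈ S := by
    intro x y
    by_contra hxy
    obtain ⟨S', hlt, hS'⟩ := Stmt16.state_step β hsymm S hS x y hxy
    exact hmax S' hS' hlt
  obtain ⟨-, U, hSU, hd, -⟩ := hS
  refine ⟨U, hd.trans (by have := Submodule.finrank_le S; omega), le_antisymm ?_ ?_⟩
  · exact Submodule.span_mono (Set.image2_subset (Set.subset_univ _) (Set.subset_univ _))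
  · rw [Submodule.span_le]
    rintro _ ⟨x, -, y, -, rfl⟩
    have := hSU (hall x y)
    rw [Submodule.map₂_eq_span_image2] at this
    exact this
end

section
/- There exists a constant C > 0 such that for every prime power q, all finite-dimensional F_q-vector spaces V and W with dim V = m and dim W = n, and every positive integer s, the number of symmetric bilinear maps β : V × V → W such that the span of β(U × U) equals W for some s-dimensional subspace U ≤ V, but the span of β(U' × U') does not equal W for any (s-1)-dimensional subspace U' ≤ V, is at most q^{(m^2/2)(n-s) + C(m+n)^{8/3}}. -/
open Module

namespace Sym17

variable {F : Type} [Field F] {V W N : Type} [AddCommGroup V] [Module F V] [AddCommGroup W]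
  [Module F W] [AddCommGroup N] [Module F N]

lemma fr_map [FiniteDimensional F V] (f : V →ₗ[F] W) (P : Submodule F V) :
    finrank F P = finrank F (P.map f) + finrank F (P ⊓ LinearMap.ker f : Submodule F V) := by
  have h := (f.domRestrict P).finrank_range_add_finrank_ker
  rw [LinearMap.range_domRestrict] at h
  rw [← h]
  congr 1
  rw [LinearMap.ker_domRestrict, inf_comm]
  rw [← Submodule.finrank_map_subtype_eq, Submodule.map_comap_subtype, inf_comm]

lemma fr_comap [FiniteDimensional F W] (Q : Submodule F W) (R : Submodule F (W ⧸ Q)) :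
    finrank F (R.comap Q.mkQ) = finrank F R + finrank F Q := by
  rw [fr_map Q.mkQ (R.comap Q.mkQ), Submodule.map_comap_eq_of_surjective Q.mkQ_surjective,
    Submodule.ker_mkQ, inf_eq_right.2 (Submodule.le_comap_mkQ Q R)]

lemma halving [FiniteDimensional F V] [FiniteDimensional F W] (f g : V →ₗ[F] W) (r : ℕ)
    (hg : finrank F (LinearMap.range g) = r) (hf : finrank F (LinearMap.range f) ≤ r)
    (hfg : finrank F (LinearMap.range (f + g)) ≤ r) :
    2 * finrank F ((LinearMap.ker g).map ((LinearMap.range g).mkQ ∘ₗ f)) ≤ r := by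
  set h := (LinearMap.range g).mkQ ∘ₗ f with hh
  have hh' : h = (LinearMap.range g).mkQ ∘ₗ (f + g) := by
    ext x; simp [hh]
  have key : ∀ k : V →ₗ[F] W, h = (LinearMap.range g).mkQ ∘ₗ k →
      finrank F (LinearMap.range k) =
        finrank F (LinearMap.range h) + finrank F ((LinearMap.ker h).map k) := by
    intro k hk
    have h1 := k.finrank_range_add_finrank_ker
    have h2 := h.finrank_range_add_finrank_ker
    have h3 := fr_map k (LinearMap.ker h)
    have : LinearMap.ker k ≤ LinearMap.ker h := by rw [hk]; exact LinearMap.ker_le_ker_comp _ _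
    rw [inf_eq_right.2 this] at h3
    omega
  have k1 := key f rfl
  have k2 := key (f + g) hh'
  have k3 : finrank F ((LinearMap.ker h).map g) ≤
      finrank F ((LinearMap.ker h).map f) + finrank F ((LinearMap.ker h).map (f + g)) := by
    refine le_trans (Submodule.finrank_mono ?_) (Submodule.finrank_add_le_finrank_add_finrank _ _)
    rintro _ ⟨x, hx, rfl⟩
    have : g x = - f x + (f + g) x := by simp
    rw [this]
    exact Submodule.add_mem_sup (Submodule.neg_mem _ ⟨x, hx, rfl⟩) ⟨x, hx, rfl⟩
  have h2 := h.finrank_range_add_finrank_ker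
  have h4 := g.finrank_range_add_finrank_ker
  have h5 := fr_map g (LinearMap.ker h)
  have h6 := fr_map h (LinearMap.ker g)
  rw [inf_comm] at h6
  have h7 : finrank F ((LinearMap.ker g).map h) ≤ finrank F (LinearMap.range h) :=
    Submodule.finrank_mono LinearMap.map_le_range
  omega

lemma bounded_rank (ρ : ℕ) :
    ∀ (N W : Type) [AddCommGroup W] [Module F W] [AddCommGroup N] [Module F N]
    [FiniteDimensional F W] [FiniteDimensional F N] (γ : V →ₗ[F] N →ₗ[F] W),
    (∀ v, finrank F (LinearMap.range (γ v)) ≤ ρ) →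
    ∃ (P : Submodule F N) (R : Submodule F W), finrank F N ≤ finrank F P + 2 * ρ ∧
      finrank F R ≤ 2 * ρ ∧ ∀ v, ∀ x ∈ P, γ v x ∈ R := by
  induction ρ using Nat.strong_induction_on with
  | _ ρ ih =>
  intro N W _ _ _ _ _ _ γ hγ
  rcases Nat.eq_zero_or_pos ρ with rfl | hρ
  · refine ⟨⊤, ⊥, by simp, by simp, fun v x _ => ?_⟩
    have := hγ v
    simp only [nonpos_iff_eq_zero, Submodule.finrank_eq_zero, LinearMap.range_eq_bot] at this
    simp [this]
  obtain ⟨v0, hv0⟩ : ∃ v0, ∀ v, finrank F (LinearMap.range (γ v)) ≤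
      finrank F (LinearMap.range (γ v0)) := by
    have hb : BddAbove (Set.range fun v => finrank F (LinearMap.range (γ v))) :=
      ⟨ρ, by rintro _ ⟨v, rfl⟩; exact hγ v⟩
    obtain ⟨v0, h0⟩ := Nat.sSup_mem (Set.range_nonempty _) hb
    exact ⟨v0, fun v => by
      have := le_csSup hb ⟨v, rfl⟩
      rw [← h0] at this; exact this⟩
  set g := γ v0 with hg
  set r := finrank F (LinearMap.range g) with hr
  have hrρ : r ≤ ρ := hγ v0
  obtain ⟨P, R, h1, h2, h3⟩ := ih (r / 2) (by omega) (LinearMap.ker g) (W ⧸ LinearMap.range g)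
    ((γ.compl₂ (LinearMap.ker g).subtype).compr₂ (LinearMap.range g).mkQ) (by
      intro v
      have := halving (γ v) g r rfl (hv0 v) (by rw [hg, ← map_add]; exact hv0 _)
      have e : LinearMap.range (((γ.compl₂ (LinearMap.ker g).subtype).compr₂ (LinearMap.range g).mkQ) v)
        = (LinearMap.ker g).map ((LinearMap.range g).mkQ ∘ₗ γ v) := by
        ext y; simp
      rw [e]; omega)
  refine ⟨P.map (LinearMap.ker g).subtype, R.comap (LinearMap.range g).mkQ, ?_, ?_, ?_⟩
  · have e := g.finrank_range_add_finrank_ker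
    rw [Submodule.finrank_map_subtype_eq]
    omega
  · rw [fr_comap]; omega
  · rintro v _ ⟨x, hx, rfl⟩
    simpa using h3 v x hx

lemma exists_sub (k : ℕ) [FiniteDimensional F V] (h : k ≤ finrank F V) :
    ∃ Q : Submodule F V, finrank F Q = k := by
  obtain ⟨f, hf⟩ := exists_linearIndependent_of_le_finrank h
  exact ⟨Submodule.span F (Set.range f), by rw [finrank_span_eq_card hf]; simp⟩

lemma exists_mid (k : ℕ) [FiniteDimensional F V] (P : Submodule F V) (h : finrank F P ≤ k)
    (h' : k ≤ finrank F V) : ∃ Q : Submodule F V, P ≤ Q ∧ finrank F Q = k := by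
  have e := P.finrank_quotient_add_finrank
  obtain ⟨Q, hQ⟩ := exists_sub (F := F) (V := V ⧸ P) (k - finrank F P) (by omega)
  exact ⟨Q.comap P.mkQ, Submodule.le_comap_mkQ _ _, by rw [fr_comap]; omega⟩

lemma exists_lift (f : V →ₗ[F] W) [FiniteDimensional F V] :
    ∃ T : Submodule F V, T.map f = LinearMap.range f ∧ finrank F T = finrank F (LinearMap.range f) := by
  obtain ⟨T, hT⟩ := Submodule.exists_isCompl (LinearMap.ker f)
  have h1 := Submodule.finrank_add_eq_of_isCompl hT
  have h2 := f.finrank_range_add_finrank_ker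
  refine ⟨T, ?_, by omega⟩
  have hz : (LinearMap.ker f).map f = ⊥ := by
    rw [eq_bot_iff]; rintro _ ⟨x, hx, rfl⟩; simpa using hx
  rw [← Submodule.map_top, ← hT.sup_eq_top, Submodule.map_sup, hz, bot_sup_eq]

lemma quot_top (R M : Submodule F W) (h : R ≤ M) (h' : M.map R.mkQ = ⊤) : M = ⊤ := by
  have := Submodule.comap_map_mkQ R M
  rw [h', Submodule.comap_top, sup_eq_right.2 h] at this
  exact this.symm

lemma fr_sup [FiniteDimensional F W] (Q R : Submodule F W) :
    finrank F (Q ⊔ R : Submodule F W) = finrank F (Q.map R.mkQ) + finrank F R := by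
  rw [← fr_comap, Submodule.comap_map_mkQ, sup_comm]

lemma fr_sup_span (Q : Submodule F V) [FiniteDimensional F V] (x : V) :
    finrank F (Q ⊔ Submodule.span F {x} : Submodule F V) ≤ finrank F Q + 1 := by
  refine (Submodule.finrank_add_le_finrank_add_finrank _ _).trans ?_
  have := finrank_span_le_card (R := F) ({x} : Set V)
  simp at this
  omega

lemma fill_pairs [FiniteDimensional F V] [FiniteDimensional F W] (β : V →ₗ[F] V →ₗ[F] W)
    (hβ : Submodule.map₂ β ⊤ ⊤ = ⊤) (k : ℕ) : ∀ U : Submodule F V,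
    finrank F W ≤ finrank F (Submodule.map₂ β U U) + k →
    ∃ U' : Submodule F V, U ≤ U' ∧ Submodule.map₂ β U' U' = ⊤ ∧
      finrank F U' ≤ finrank F U + 2 * k := by
  induction k with
  | zero =>
    intro U hU
    exact ⟨U, le_rfl, Submodule.eq_top_of_finrank_eq
      (le_antisymm (Submodule.finrank_le _) (by simpa using hU)), by simp⟩
  | succ k ih =>
    intro U hU
    by_cases h : Submodule.map₂ β U U = ⊤
    · exact ⟨U, le_rfl, h, by omega⟩
    obtain ⟨x, y, hxy⟩ : ∃ x y, β x y ∉ Submodule.map₂ β U U := by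
      by_contra! hc
      apply h
      rw [eq_top_iff, ← hβ, Submodule.map₂_le]
      intro x _ y _
      exact hc x y
    set U1 := (U ⊔ Submodule.span F {x}) ⊔ Submodule.span F {y} with hU1
    have hUU : U ≤ U1 := le_sup_left.trans le_sup_left
    have hx : x ∈ U1 := (le_sup_right.trans le_sup_left : Submodule.span F {x} ≤ U1)
      (Submodule.mem_span_singleton_self x)
    have hy : y ∈ U1 := (le_sup_right : Submodule.span F {y} ≤ U1)
      (Submodule.mem_span_singleton_self y)
    have hlt : Submodule.map₂ β U U < Submodule.map₂ β U1 U1 := by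
      refine lt_of_le_of_ne (Submodule.map₂_le_map₂ hUU hUU) fun he => hxy ?_
      rw [he]
      exact Submodule.apply_mem_map₂ _ hx hy
    have h1 := Submodule.finrank_lt_finrank_of_lt hlt
    obtain ⟨U', a, b, c⟩ := ih U1 (by omega)
    refine ⟨U', hUU.trans a, b, ?_⟩
    have h2 := fr_sup_span (U ⊔ Submodule.span F {x}) y
    have h3 := fr_sup_span U x
    rw [← hU1] at h2
    omega

lemma spanA [FiniteDimensional F V] (K : ℕ) (n : ℕ) :
    ∀ (W : Type) [AddCommGroup W] [Module F W] [FiniteDimensional F W]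
    (β : V →ₗ[F] V →ₗ[F] W), finrank F W = n → (∀ x y, β x y = β y x) →
    Submodule.map₂ β ⊤ ⊤ = ⊤ →
    ∃ U : Submodule F V, Submodule.map₂ β U U = ⊤ ∧
      K * finrank F U ≤ K * n + n + 6 * K ^ 2 := by
  induction n using Nat.strong_induction_on with
  | _ n ih =>
  intro W _ _ _ β hn hs hβ
  by_cases hK : ∀ v, finrank F (LinearMap.range (β v)) ≤ K
  · obtain ⟨P, R, h1, h2, h3⟩ := bounded_rank K V W β hK
    obtain ⟨T, hT⟩ := Submodule.exists_isCompl P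
    have h4 := Submodule.finrank_add_eq_of_isCompl hT
    have h5 : R ⊔ Submodule.map₂ β T T = ⊤ := by
      rw [eq_top_iff, ← hβ, Submodule.map₂_le]
      intro x _ y _
      have hx : x ∈ P ⊔ T := by rw [hT.sup_eq_top]; trivial
      have hy : y ∈ P ⊔ T := by rw [hT.sup_eq_top]; trivial
      obtain ⟨p, hp, t, ht, rfl⟩ := Submodule.mem_sup.1 hx
      obtain ⟨p', hp', t', ht', rfl⟩ := Submodule.mem_sup.1 hy
      have e : β (p + t) (p' + t') = (β (p + t) p' + β t' p) + β t t' := by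
        rw [hs t' p]; simp only [map_add, LinearMap.add_apply]; abel
      rw [e]
      exact Submodule.add_mem_sup (R.add_mem (h3 _ _ hp') (h3 _ _ hp))
        (Submodule.apply_mem_map₂ _ ht ht')
    have h6 : finrank F W ≤ finrank F (Submodule.map₂ β T T) + 2 * K := by
      have := Submodule.finrank_add_le_finrank_add_finrank R (Submodule.map₂ β T T)
      rw [h5, finrank_top] at this
      omega
    obtain ⟨U, -, hU, hU'⟩ := fill_pairs β hβ (2 * K) T h6
    refine ⟨U, hU, ?_⟩
    have : finrank F U ≤ 6 * K := by omega
    nlinarith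
  · push Not at hK
    obtain ⟨v, hv⟩ := hK
    obtain ⟨T, hT, hT'⟩ := exists_lift (β v)
    set R := LinearMap.range (β v)
    have e := R.finrank_quotient_add_finrank
    obtain ⟨U', h1, h2⟩ := ih (finrank F (W ⧸ R)) (by omega) (W ⧸ R) (β.compr₂ R.mkQ) rfl
      (by intro x y; simp [hs x y])
      (by rw [← Submodule.map_map₂, hβ, Submodule.map_top, Submodule.range_mkQ])
    set U := (T ⊔ U') ⊔ Submodule.span F {v} with hU
    have hTU : T ≤ U := le_sup_left.trans le_sup_left
    have hUU : U' ≤ U := le_sup_right.trans le_sup_left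
    have hvU : v ∈ U := (le_sup_right : Submodule.span F {v} ≤ U)
      (Submodule.mem_span_singleton_self v)
    refine ⟨U, quot_top R _ ?_ ?_, ?_⟩
    · rw [← hT]
      rintro _ ⟨t, ht, rfl⟩
      exact Submodule.apply_mem_map₂ _ hvU (hTU ht)
    · rw [eq_top_iff, ← h1, ← Submodule.map_map₂]
      exact Submodule.map_mono (Submodule.map₂_le_map₂ hUU hUU)
    · have a1 := fr_sup_span (T ⊔ U') v
      have a2 := Submodule.finrank_add_le_finrank_add_finrank T U'
      rw [← hU] at a1
      have a3 : finrank F U ≤ finrank F R + finrank F U' + 1 := by omega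
      have : n = finrank F (W ⧸ R) + finrank F R := by omega
      nlinarith

lemma exists_inj [Fintype F] [FiniteDimensional F V] [FiniteDimensional F W]
    (γ : V →ₗ[F] V →ₗ[F] W) (K : ℕ) (P : Submodule F V) (hP : finrank F P = K)
    (h : ∀ f ∈ P, f ≠ 0 → K ≤ finrank F (LinearMap.range (γ f))) :
    ∃ u, ∀ f ∈ P, γ f u = 0 → f = 0 := by
  classical
  by_contra! hc
  have : Finite V := Module.finite_of_finite F
  have := Fintype.ofFinite V
  set q := Fintype.card F with hq
  have hKm : K ≤ finrank F V := hP ▸ Submodule.finrank_le P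
  have q1 : 1 < q := Fintype.one_lt_card
  let S : Finset V := Finset.univ.filter fun f => f ∈ P ∧ f ≠ 0
  have hS : S.card + 1 = q ^ K := by
    have e1 : Fintype.card P = q ^ K := by rw [← hP]; exact Module.card_eq_pow_finrank
    rw [← e1, Fintype.card_subtype]
    have : S = (Finset.univ.filter fun f => f ∈ P).erase 0 := by
      ext x; simp [S, and_comm]
    rw [this, Finset.card_erase_add_one (by simp)]
  have hcov : (Finset.univ : Finset V) ⊆
      S.biUnion fun f => Finset.univ.filter fun u => γ f u = 0 := by
    intro u _
    obtain ⟨f, a, b, c⟩ := hc u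
    simp only [Finset.mem_biUnion, S, Finset.mem_filter, Finset.mem_univ, true_and]
    exact ⟨f, ⟨a, c⟩, b⟩
  have h1 := (Finset.card_le_card hcov).trans (Finset.card_biUnion_le_card_mul S _
    (q ^ (finrank F V - K)) (by
      intro f hf
      simp only [S, Finset.mem_filter, Finset.mem_univ, true_and] at hf
      have e2 : Fintype.card (LinearMap.ker (γ f)) = q ^ finrank F (LinearMap.ker (γ f)) :=
        Module.card_eq_pow_finrank
      rw [Fintype.card_subtype] at e2
      simp only [LinearMap.mem_ker] at e2
      rw [e2]
      apply Nat.pow_le_pow_right (by omega)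
      have := (γ f).finrank_range_add_finrank_ker
      have := h f hf.1 hf.2
      omega))
  rw [Finset.card_univ, Module.card_eq_pow_finrank (K := F), ← hq] at h1
  have h2 : q ^ finrank F V = q ^ K * q ^ (finrank F V - K) := by
    rw [← pow_add]; congr 1; omega
  rw [h2, ← hS] at h1
  have : 0 < q ^ (finrank F V - K) := by positivity
  nlinarith

lemma gainD [Fintype F] [FiniteDimensional F V] [FiniteDimensional F W]
    (β : V →ₗ[F] V →ₗ[F] W) (K : ℕ) (P : Submodule F V) (hP : finrank F P = K)
    (W1 : Submodule F W)
    (h : ∀ f ∈ P, f ≠ 0 →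
      finrank F W1 + 2 * K ^ 2 ≤ finrank F (LinearMap.range (β f) ⊔ W1 : Submodule F W)) (j : ℕ) :
    j ≤ K → ∃ (T : Submodule F V) (W2 : Submodule F W), finrank F T ≤ j ∧ W1 ≤ W2 ∧
      W2 ≤ W1 ⊔ Submodule.map₂ β P T ∧ finrank F W2 = finrank F W1 + j * K := by
  induction j with
  | zero => exact fun _ => ⟨⊥, W1, by simp, le_rfl, le_sup_left, by simp⟩
  | succ j ih =>
    intro hj
    obtain ⟨T, W2, h1, h2, h3, h4⟩ := ih (by omega)
    obtain ⟨u, hu⟩ := exists_inj (β.compr₂ W2.mkQ) K P hP (by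
      intro f hf hf0
      have a := h f hf hf0
      have b : finrank F (LinearMap.range (β f) ⊔ W1 : Submodule F W) ≤
        finrank F (LinearMap.range (β f) ⊔ W2 : Submodule F W) :=
        Submodule.finrank_mono (sup_le_sup_left h2 _)
      have c := fr_sup (LinearMap.range (β f)) W2
      have e : (LinearMap.range (β f)).map W2.mkQ = LinearMap.range (β.compr₂ W2.mkQ f) := by
        rw [← LinearMap.range_comp]; rfl
      rw [e] at c
      nlinarith)
    refine ⟨T ⊔ Submodule.span F {u}, P.map (β.flip u) ⊔ W2, ?_, h2.trans le_sup_right, ?_, ?_⟩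
    · have := fr_sup_span T u
      omega
    · apply sup_le
      · rintro _ ⟨p, hp, rfl⟩
        exact (le_sup_right : _ ≤ W1 ⊔ _) (Submodule.apply_mem_map₂ _ hp
          ((le_sup_right : _ ≤ T ⊔ _) (Submodule.mem_span_singleton_self u)))
      · exact h3.trans (sup_le_sup_left (Submodule.map₂_le_map₂_right le_sup_left) _)
    · rw [fr_sup, h4, ← Submodule.map_comp]
      have := fr_map (W2.mkQ ∘ₗ β.flip u) P
      have hb : P ⊓ LinearMap.ker (W2.mkQ ∘ₗ β.flip u) = ⊥ := by
        rw [eq_bot_iff]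
        rintro f ⟨hf, hf'⟩
        exact hu f hf (by simpa using hf')
      rw [hb, finrank_bot, hP] at this
      rw [← add_zero (finrank F (Submodule.map _ _)), ← this]
      ring

lemma phase1 [Fintype F] [FiniteDimensional F V] [FiniteDimensional F W]
    (β : V →ₗ[F] V →ₗ[F] W) (K : ℕ) (hK : 0 < K) (k : ℕ) : ∀ (U : Submodule F V)
    (W1 : Submodule F W), W1 ≤ Submodule.map₂ β U U → K * finrank F U ≤ 2 * finrank F W1 →
    finrank F W ≤ finrank F W1 + k →
    ∃ (U : Submodule F V)
    (W1 : Submodule F W), W1 ≤ Submodule.map₂ β U U ∧ K * finrank F U ≤ 2 * finrank F W1 ∧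
    finrank F V < finrank F (Submodule.span F {v : V | finrank F
      (LinearMap.range (β v) ⊔ W1 : Submodule F W) < finrank F W1 + 2 * K ^ 2}) + K := by
  induction k using Nat.strong_induction_on with
  | _ k ih =>
  intro U W1 h1 h2 h3
  by_cases hlow : finrank F V < finrank F (Submodule.span F {v : V | finrank F
      (LinearMap.range (β v) ⊔ W1 : Submodule F W) < finrank F W1 + 2 * K ^ 2}) + K
  · exact ⟨U, W1, h1, h2, hlow⟩
  set L := {v : V | finrank F
      (LinearMap.range (β v) ⊔ W1 : Submodule F W) < finrank F W1 + 2 * K ^ 2} with hL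
  obtain ⟨T, hT⟩ := Submodule.exists_isCompl (Submodule.span F L)
  have h4 := Submodule.finrank_add_eq_of_isCompl hT
  obtain ⟨Q, hQ⟩ := exists_sub (F := F) (V := T) K (by omega)
  obtain ⟨T2, W2, a1, a2, a3, a4⟩ := gainD β K (Q.map T.subtype)
    (by rw [Submodule.finrank_map_subtype_eq, hQ]) W1 (by
      rintro _ ⟨f, hf, rfl⟩ hf0
      by_contra hc
      push Not at hc
      apply hf0
      have : (f : V) ∈ Submodule.span F L ⊓ T := ⟨Submodule.subset_span hc, f.2⟩
      rwa [hT.inf_eq_bot, Submodule.mem_bot] at this) K le_rfl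
  have hlt : finrank F W1 < finrank F W2 := by nlinarith
  have hW2 := Submodule.finrank_le W2
  set P := Q.map T.subtype with hP
  have hP' : finrank F P = K := by rw [hP, Submodule.finrank_map_subtype_eq, hQ]
  refine ih (finrank F W - finrank F W2) (by omega) (U ⊔ (P ⊔ T2)) W2 ?_ ?_ (by omega)
  · refine a3.trans (sup_le (h1.trans (Submodule.map₂_le_map₂ le_sup_left le_sup_left)) ?_)
    exact Submodule.map₂_le_map₂ (le_sup_left.trans le_sup_right) (le_sup_right.trans le_sup_right)
  · have b1 := Submodule.finrank_add_le_finrank_add_finrank U (P ⊔ T2)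
    have b2 := Submodule.finrank_add_le_finrank_add_finrank P T2
    have b3 : finrank F (U ⊔ (P ⊔ T2) : Submodule F V) ≤ finrank F U + 2 * K := by omega
    nlinarith

lemma structure_s [Fintype F] [FiniteDimensional F V] [FiniteDimensional F W]
    (β : V →ₗ[F] V →ₗ[F] W) (K : ℕ) (hK : 0 < K) (s : ℕ) (hs : 0 < s)
    (hsym : ∀ x y, β x y = β y x)
    (hU : ∃ U : Submodule F V, finrank F U = s ∧ Submodule.map₂ β U U = ⊤)
    (hU' : ∀ U : Submodule F V, finrank F U = s - 1 → Submodule.map₂ β U U ≠ ⊤) :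
    ∃ W1 : Submodule F W, K * s + K * finrank F W1 ≤ K * finrank F W + 3 * finrank F W + 6 * K ^ 2 ∧
    finrank F V < finrank F (Submodule.span F {v : V | finrank F
      (LinearMap.range (β v) ⊔ W1 : Submodule F W) < finrank F W1 + 2 * K ^ 2}) + K := by
  obtain ⟨U0, hU0, hU0'⟩ := hU
  obtain ⟨U, W1, h1, h2, h3⟩ := phase1 β K hK (finrank F W) ⊥ ⊥ (by simp) (by simp) (by simp)
  refine ⟨W1, ?_, h3⟩
  have htop : Submodule.map₂ β ⊤ ⊤ = ⊤ := by
    rw [eq_top_iff, ← hU0']; exact Submodule.map₂_le_map₂ le_top le_top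
  obtain ⟨U2, a1, a2⟩ := spanA K _ (W ⧸ W1) (β.compr₂ W1.mkQ) rfl
      (by intro x y; simp [hsym x y])
      (by rw [← Submodule.map_map₂, htop, Submodule.map_top, Submodule.range_mkQ])
  have e := W1.finrank_quotient_add_finrank
  have b : Submodule.map₂ β (U ⊔ U2) (U ⊔ U2) = ⊤ := by
    apply quot_top W1
    · exact h1.trans (Submodule.map₂_le_map₂ le_sup_left le_sup_left)
    · rw [eq_top_iff, ← a1, ← Submodule.map_map₂]
      exact Submodule.map_mono (Submodule.map₂_le_map₂ le_sup_right le_sup_right)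
  have c : s ≤ finrank F (U ⊔ U2 : Submodule F V) := by
    by_contra hc
    have := Submodule.finrank_le U0
    obtain ⟨Q, hQ, hQ'⟩ := exists_mid (s - 1) (U ⊔ U2) (by omega) (by omega)
    apply hU' Q hQ'
    rw [eq_top_iff, ← b]
    exact Submodule.map₂_le_map₂ hQ hQ
  have d := Submodule.finrank_add_le_finrank_add_finrank U U2
  have : s ≤ finrank F U + finrank F U2 := c.trans d
  have hw := Submodule.finrank_le W1
  rw [← e]
  nlinarith

lemma factor_rank [FiniteDimensional F V] [FiniteDimensional F W] (f : V →ₗ[F] W)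
    (W1 : Submodule F W) (r : ℕ)
    (h : finrank F (LinearMap.range f ⊔ W1 : Submodule F W) < finrank F W1 + r) :
    ∃ p : ((Fin r → F) →ₗ[F] W) × (V →ₗ[F] (Fin r → F)), ∀ x, f x - p.1 (p.2 x) ∈ W1 := by
  set g := W1.mkQ ∘ₗ f with hg
  have h1 : finrank F (LinearMap.range g) ≤ finrank F (Fin r → F) := by
    rw [fr_sup, ← LinearMap.range_comp] at h
    rw [hg, finrank_fin_fun]; omega
  obtain ⟨i, hi⟩ := finrank_le_iff_exists_linearMap.1 h1
  obtain ⟨l, hl⟩ := LinearMap.exists_leftInverse_of_injective i (LinearMap.ker_eq_bot.2 hi)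
  obtain ⟨t, ht⟩ := LinearMap.exists_rightInverse_of_surjective W1.mkQ (Submodule.range_mkQ W1)
  refine ⟨(t ∘ₗ (LinearMap.range g).subtype ∘ₗ l, i ∘ₗ g.rangeRestrict), fun x => ?_⟩
  have e1 : l (i (g.rangeRestrict x)) = g.rangeRestrict x := LinearMap.congr_fun hl _
  have e2 : ∀ y, W1.mkQ (t y) = y := fun y => LinearMap.congr_fun ht y
  have e3 : W1.mkQ (f x - t (l (i (g.rangeRestrict x)) : W ⧸ W1)) = 0 := by
    rw [map_sub, e2, e1]
    simp [hg]
  exact (Submodule.Quotient.mk_eq_zero W1).1 e3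

lemma exists_tuple (S : Set V) [FiniteDimensional F V] (k : ℕ)
    (hk : finrank F (Submodule.span F S) ≤ k) (h0 : (0 : V) ∈ S) :
    ∃ b : Fin k → V, (∀ i, b i ∈ S) ∧ Submodule.span F (Set.range b) = Submodule.span F S := by
  obtain ⟨f, h1, h2, -⟩ := Submodule.exists_fun_fin_finrank_span_eq F S
  refine ⟨fun i => if h : i.1 < finrank F (Submodule.span F S) then f ⟨i, h⟩ else 0, ?_, ?_⟩
  · intro i
    dsimp only
    split_ifs
    · exact h1 _
    · exact h0
  · apply le_antisymm
    · rw [Submodule.span_le]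
      rintro _ ⟨i, rfl⟩
      dsimp only
      split_ifs
      · exact Submodule.subset_span (h1 _)
      · exact Submodule.zero_mem _
    · refine h2.symm.le.trans ?_
      rw [Submodule.span_le]
      rintro _ ⟨i, rfl⟩
      apply Submodule.subset_span
      exact ⟨⟨i, i.2.trans_le hk⟩, by simp⟩

/-- the parameter space -/
abbrev Par (F V W : Type) [Field F] [AddCommGroup V] [Module F V] [AddCommGroup W]
    [Module F W] (m n K r : ℕ) : Type :=
  (Fin n → W) × (Fin m → V) × (Fin K → V) ×
    (Fin m → ((Fin r → F) →ₗ[F] W) × (V →ₗ[F] (Fin r → F))) × (Fin K → (V →ₗ[F] W))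

/-- a bilinear map is coded by a parameter -/
def Codes {m n K r : ℕ} (w : ℕ) (β : V →ₗ[F] V →ₗ[F] W) (y : Par F V W m n K r) : Prop :=
  finrank F (Submodule.span F (Set.range y.1)) ≤ w ∧
  Submodule.span F (Set.range y.2.1) ⊔ Submodule.span F (Set.range y.2.2.1) = ⊤ ∧
  (∀ i x, β (y.2.1 i) x - (y.2.2.2.1 i).1 ((y.2.2.2.1 i).2 x) ∈
    Submodule.span F (Set.range y.1)) ∧
  ∀ j, β (y.2.2.1 j) = y.2.2.2.2 j

lemma exists_code [FiniteDimensional F V] [FiniteDimensional F W] (m n K r w : ℕ)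
    (hr : 0 < r)
    (hm : finrank F V = m) (hn : finrank F W = n) (β : V →ₗ[F] V →ₗ[F] W) (W1 : Submodule F W)
    (hw : finrank F W1 ≤ w)
    (h : finrank F V < finrank F (Submodule.span F {v : V | finrank F
      (LinearMap.range (β v) ⊔ W1 : Submodule F W) < finrank F W1 + r}) + K) :
    ∃ y : Par F V W m n K r, Codes w β y := by
  set L := {v : V | finrank F
      (LinearMap.range (β v) ⊔ W1 : Submodule F W) < finrank F W1 + r} with hL
  obtain ⟨ω, -, hω⟩ := exists_tuple (F := F) (W1 : Set W) n
    (by rw [Submodule.span_eq, ← hn]; exact Submodule.finrank_le _) W1.zero_mem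
  rw [Submodule.span_eq] at hω
  obtain ⟨b, hb, hb'⟩ := exists_tuple (F := F) L m (by rw [← hm]; exact Submodule.finrank_le _)
    (by
      have e : LinearMap.range (β 0) ⊔ W1 = W1 := by simp [LinearMap.range_zero]
      change finrank F (LinearMap.range (β 0) ⊔ W1 : Submodule F W) < _
      rw [e]; omega)
  obtain ⟨T, hT⟩ := Submodule.exists_isCompl (Submodule.span F L)
  have h4 := Submodule.finrank_add_eq_of_isCompl hT
  obtain ⟨c, -, hc⟩ := exists_tuple (F := F) (T : Set V) K
    (by rw [Submodule.span_eq]; omega) T.zero_mem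
  rw [Submodule.span_eq] at hc
  have : ∀ i, ∃ p : ((Fin r → F) →ₗ[F] W) × (V →ₗ[F] (Fin r → F)),
      ∀ x, β (b i) x - p.1 (p.2 x) ∈ W1 := fun i => factor_rank _ W1 r (hb i)
  choose p hp using this
  refine ⟨(ω, b, c, p, fun j => β (c j)), ?_, ?_, ?_, ?_⟩
  · change finrank F (Submodule.span F (Set.range ω)) ≤ w
    rw [hω]; exact hw
  · simp only [hb', hc]; exact hT.sup_eq_top
  · simpa [hω] using hp
  · intro j; rfl

lemma codes_diff {m n K r w : ℕ} {β β' : V →ₗ[F] V →ₗ[F] W} {y : Par F V W m n K r}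
    (h : Codes w β y) (h' : Codes w β' y) (x z : V) :
    (β - β') x z ∈ Submodule.span F (Set.range y.1) := by
  set W1 := Submodule.span F (Set.range y.1)
  have : (⊤ : Submodule F V) ≤ W1.comap ((β - β').flip z) := by
    rw [← h.2.1, sup_le_iff, Submodule.span_le, Submodule.span_le]
    constructor
    · rintro _ ⟨i, rfl⟩
      have := W1.sub_mem (h.2.2.1 i z) (h'.2.2.1 i z)
      simpa using this
    · rintro _ ⟨j, rfl⟩
      have e : β (y.2.2.1 j) = β' (y.2.2.1 j) := (h.2.2.2 j).trans (h'.2.2.2 j).symm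
      simp [e]
  exact this (Submodule.mem_top (x := x))

instance finHom [Finite F] [FiniteDimensional F V] [FiniteDimensional F W] :
    Finite (V →ₗ[F] W) := Module.finite_of_finite F

lemma fibre [Fintype F] [FiniteDimensional F V] [FiniteDimensional F W] {m n K r w : ℕ}
    (hm : finrank F V = m) (y : Par F V W m n K r) :
    Nat.card {β : V →ₗ[F] V →ₗ[F] W // (∀ x z, β x z = β z x) ∧ Codes w β y} ≤
      Fintype.card F ^ (w * (m + 1).choose 2) := by
  classical
  have : Finite W := Module.finite_of_finite F
  by_cases hne : Nonempty {β : V →ₗ[F] V →ₗ[F] W // (∀ x z, β x z = β z x) ∧ Codes w β y}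
  swap
  · rw [not_nonempty_iff] at hne
    simp
  obtain ⟨β0, hs0, h0⟩ := hne
  set W1 := Submodule.span F (Set.range y.1) with hW1
  let e := Module.finBasisOfFinrankEq F V hm
  let Φ : {β : V →ₗ[F] V →ₗ[F] W // (∀ x z, β x z = β z x) ∧ Codes w β y} →
      (Sym2 (Fin m) → W1) := fun β => Sym2.lift ⟨fun i j => ⟨(β.1 - β0) (e i) (e j),
        codes_diff β.2.2 h0 _ _⟩, by
        intro i j
        ext
        simp [β.2.1 (e i), hs0 (e i)]⟩
  have hΦ : Function.Injective Φ := by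
    rintro ⟨β, hβ⟩ ⟨β', hβ'⟩ h
    ext1
    refine e.ext fun i => e.ext fun j => ?_
    have := congrArg Subtype.val (congrFun h s(i, j))
    simpa [Φ] using this
  refine (Nat.card_le_card_of_injective Φ hΦ).trans ?_
  rw [Nat.card_fun, Module.natCard_eq_pow_finrank (K := F), Nat.card_eq_fintype_card,
    Nat.card_eq_fintype_card, Sym2.card, Fintype.card_fin, ← pow_mul]
  apply Nat.pow_le_pow_right Fintype.card_pos
  exact Nat.mul_le_mul_right _ h0.1

lemma card_par [Fintype F] [FiniteDimensional F V] [FiniteDimensional F W] {m n K r : ℕ}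
    (hm : finrank F V = m) (hn : finrank F W = n) :
    Nat.card (Par F V W m n K r) = Fintype.card F ^
      (n * n + (m * m + (m * K + ((r * n + m * r) * m + m * n * K)))) := by
  have hW : Nat.card W = Fintype.card F ^ n := by
    rw [Module.natCard_eq_pow_finrank (K := F), hn, Nat.card_eq_fintype_card]
  have hV : Nat.card V = Fintype.card F ^ m := by
    rw [Module.natCard_eq_pow_finrank (K := F), hm, Nat.card_eq_fintype_card]
  have h1 : Nat.card ((Fin r → F) →ₗ[F] W) = Fintype.card F ^ (r * n) := by
    rw [Module.natCard_eq_pow_finrank (K := F), finrank_linearMap, hn, Nat.card_eq_fintype_card]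
    simp
  have h2 : Nat.card (V →ₗ[F] (Fin r → F)) = Fintype.card F ^ (m * r) := by
    rw [Module.natCard_eq_pow_finrank (K := F), finrank_linearMap, hm, Nat.card_eq_fintype_card]
    simp
  have h3 : Nat.card (V →ₗ[F] W) = Fintype.card F ^ (m * n) := by
    rw [Module.natCard_eq_pow_finrank (K := F), finrank_linearMap, hm, hn,
      Nat.card_eq_fintype_card]
  simp only [Par, Nat.card_prod, Nat.card_fun, hW, hV, h1, h2, h3, Nat.card_eq_fintype_card,
    Fintype.card_fin, ← pow_mul, ← pow_add]

lemma count [Fintype F] [FiniteDimensional F V] [FiniteDimensional F W] {m n K r w : ℕ}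
    (hm : finrank F V = m) (hn : finrank F W = n) (p : (V →ₗ[F] V →ₗ[F] W) → Prop)
    (hp : ∀ β, p β → (∀ x z, β x z = β z x) ∧ ∃ y : Par F V W m n K r, Codes w β y) :
    Nat.card {β // p β} ≤ Fintype.card F ^ (w * (m + 1).choose 2 +
      (n * n + (m * m + (m * K + ((r * n + m * r) * m + m * n * K))))) := by
  classical
  have : Finite W := Module.finite_of_finite F
  have : Finite V := Module.finite_of_finite F
  have := Fintype.ofFinite (Par F V W m n K r)
  have := Fintype.ofFinite {β // p β}
  choose f hf using fun β : {β // p β} => (hp β.1 β.2).2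
  have := Finset.card_le_mul_card_image_of_maps_to (s := (Finset.univ : Finset {β // p β}))
    (t := Finset.univ) (f := f) (fun _ _ => Finset.mem_univ _)
    (Fintype.card F ^ (w * (m + 1).choose 2)) (by
      intro y _
      refine le_trans ?_ (fibre (w := w) hm y)
      rw [← Fintype.card_subtype, ← Nat.card_eq_fintype_card]
      refine Nat.card_le_card_of_injective
        (fun β => ⟨β.1.1, (hp _ β.1.2).1, by have := hf β.1; rwa [β.2] at this⟩) ?_
      intro a b hab
      simp only [Subtype.mk.injEq] at hab
      exact Subtype.ext (Subtype.ext hab))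
  have c1 := (Nat.card_eq_fintype_card (α := Par F V W m n K r)).symm.trans (card_par hm hn)
  rw [Finset.card_univ, Finset.card_univ, c1, ← pow_add] at this
  rw [Nat.card_eq_fintype_card]
  exact this

lemma real_bound (m n s K w : ℕ) (t : ℝ) (ht1 : 1 ≤ t) (ht : t ^ 3 = (m : ℝ) + n)
    (hK1 : t ≤ K) (hK2 : (K : ℝ) ≤ 2 * t)
    (hw : K * s + K * w ≤ K * n + 3 * n + 6 * K ^ 2) :
    ((w * (m + 1).choose 2 +
      (n * n + (m * m + (m * K + (((2 * K ^ 2) * n + m * (2 * K ^ 2)) * m + m * n * K)))) : ℕ) : ℝ) ≤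
    ((m : ℝ) ^ 2 / 2) * ((n : ℝ) - (s : ℝ)) + 40 * t ^ 8 := by
  have hw' : (K : ℝ) * s + K * w ≤ K * n + 3 * n + 6 * K ^ 2 := by exact_mod_cast hw
  have hm0 : (0 : ℝ) ≤ m := Nat.cast_nonneg _
  have hn0 : (0 : ℝ) ≤ n := Nat.cast_nonneg _
  have hs0 : (0 : ℝ) ≤ s := Nat.cast_nonneg _
  have hmt : (m : ℝ) ≤ t ^ 3 := by linarith
  have hnt : (n : ℝ) ≤ t ^ 3 := by linarith
  have t0 : 0 < t := by linarith
  have K0 : (0 : ℝ) < K := by linarith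
  have hwr : (w : ℝ) ≤ n - s + 15 * t ^ 2 := by
    have h1 : (n : ℝ) ≤ K * t ^ 2 := by
      calc (n : ℝ) ≤ t * t ^ 2 := by linarith [show t * t ^ 2 = t ^ 3 by ring]
        _ ≤ _ := by gcongr
    have h2 : (K : ℝ) ^ 2 ≤ K * (2 * t ^ 2) := by
      rw [sq]; gcongr; nlinarith
    have : (K : ℝ) * w ≤ K * (n - s + 15 * t ^ 2) := by nlinarith
    exact le_of_mul_le_mul_left this K0
  have hch : (((m + 1).choose 2 : ℕ) : ℝ) = (m : ℝ) ^ 2 / 2 + m / 2 := by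
    rw [Nat.cast_choose_two]; push_cast; ring
  push_cast
  rw [hch]
  have p4 : t ^ 4 ≤ t ^ 8 := pow_le_pow_right₀ ht1 (by norm_num)
  have p5 : t ^ 5 ≤ t ^ 8 := pow_le_pow_right₀ ht1 (by norm_num)
  have p6 : t ^ 6 ≤ t ^ 8 := pow_le_pow_right₀ ht1 (by norm_num)
  have p7 : t ^ 7 ≤ t ^ 8 := pow_le_pow_right₀ ht1 (by norm_num)
  have q1 : (w : ℝ) * ((m : ℝ) ^ 2 / 2) ≤ (m : ℝ) ^ 2 / 2 * (n - s) + 15 / 2 * t ^ 8 := by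
    have a : (m : ℝ) ^ 2 ≤ t ^ 6 := by
      calc (m : ℝ) ^ 2 ≤ (t ^ 3) ^ 2 := by gcongr
        _ = t ^ 6 := by ring
    have b : (m : ℝ) ^ 2 * t ^ 2 ≤ t ^ 8 := by
      calc (m : ℝ) ^ 2 * t ^ 2 ≤ t ^ 6 * t ^ 2 := by gcongr
        _ = t ^ 8 := by ring
    nlinarith [sq_nonneg (m : ℝ)]
  have q2 : (w : ℝ) * (m / 2) ≤ 8 * t ^ 8 := by
    calc (w : ℝ) * (m / 2) ≤ (t ^ 3 + 15 * t ^ 2) * (t ^ 3 / 2) := by gcongr; linarith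
      _ = t ^ 6 / 2 + 15 / 2 * t ^ 5 := by ring
      _ ≤ _ := by linarith
  have q3 : (n : ℝ) * n ≤ t ^ 8 := by
    calc (n : ℝ) * n ≤ t ^ 3 * t ^ 3 := by gcongr
      _ = t ^ 6 := by ring
      _ ≤ _ := p6
  have q4 : (m : ℝ) * m ≤ t ^ 8 := by
    calc (m : ℝ) * m ≤ t ^ 3 * t ^ 3 := by gcongr
      _ = t ^ 6 := by ring
      _ ≤ _ := p6
  have q5 : (m : ℝ) * K ≤ 2 * t ^ 8 := by
    calc (m : ℝ) * K ≤ t ^ 3 * (2 * t) := by gcongr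
      _ = 2 * t ^ 4 := by ring
      _ ≤ _ := by linarith
  have q6 : (2 * (K : ℝ) ^ 2 * n + m * (2 * (K : ℝ) ^ 2)) * m ≤ 8 * t ^ 8 := by
    calc (2 * (K : ℝ) ^ 2 * n + m * (2 * (K : ℝ) ^ 2)) * m = 2 * (K : ℝ) ^ 2 * (t ^ 3) * m := by
          rw [ht]; ring
      _ ≤ 2 * (2 * t) ^ 2 * t ^ 3 * t ^ 3 := by gcongr
      _ = _ := by ring
  have q7 : (m : ℝ) * n * K ≤ 2 * t ^ 8 := by
    calc (m : ℝ) * n * K ≤ t ^ 3 * t ^ 3 * (2 * t) := by gcongr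
      _ = 2 * t ^ 7 := by ring
      _ ≤ _ := by linarith
  have : 0 < t ^ 8 := by positivity
  rw [mul_add]
  linarith

end Sym17

/-- There is a constant `C > 0` such that for every finite field `F` of
cardinality `q`, all finite-dimensional `F`-vector spaces `V`, `W` of dimensions
`m`, `n`, and every `s > 0`, the number of symmetric bilinear maps
`β : V × V → W` such that the span of `β(U × U)` is all of `W` for some
`s`-dimensional subspace `U ≤ V` but not for any `(s-1)`-dimensional subspace, is
at most `q^((m²/2)(n-s) + C(m+n)^(8/3))`. -/
theorem stmt17 :
    ∃ C : ℝ, 0 < C ∧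
      ∀ (F : Type) [Field F] [Fintype F]
        (V W : Type) [AddCommGroup V] [Module F V] [AddCommGroup W] [Module F W]
        [FiniteDimensional F V] [FiniteDimensional F W] (m n s : ℕ),
        Module.finrank F V = m → Module.finrank F W = n → 0 < s →
        (Nat.card {β : V →ₗ[F] V →ₗ[F] W //
            (∀ x y : V, β x y = β y x) ∧
            (∃ U : Submodule F V, Module.finrank F U = s ∧
              Submodule.span F (Set.image2 (fun u v => β u v) (U : Set V) (U : Set V)) = ⊤) ∧
            ∀ U' : Submodule F V, Module.finrank F U' = s - 1 →
              Submodule.span F (Set.image2 (fun u v => β u v) (U' : Set V) (U' : Set V)) ≠ ⊤} : ℝ)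
          ≤ (Fintype.card F : ℝ) ^
              (((m : ℝ) ^ 2 / 2) * ((n : ℝ) - (s : ℝ)) + C * ((m : ℝ) + (n : ℝ)) ^ ((8 : ℝ) / 3)) := by
  refine ⟨40, by norm_num, ?_⟩
  intro F _ _ V W _ _ _ _ _ _ m n s hm hn hs
  simp only [← Submodule.map₂_eq_span_image2]
  set p : (V →ₗ[F] V →ₗ[F] W) → Prop := fun β => (∀ x y : V, β x y = β y x) ∧
            (∃ U : Submodule F V, Module.finrank F U = s ∧ Submodule.map₂ β U U = ⊤) ∧
            ∀ U' : Submodule F V, Module.finrank F U' = s - 1 → Submodule.map₂ β U' U' ≠ ⊤ with hp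
  change (Nat.card {β // p β} : ℝ) ≤ _
  have q1 : (1 : ℝ) ≤ Fintype.card F := by exact_mod_cast Fintype.card_pos
  by_cases hne : Nonempty {β // p β}
  swap
  · rw [not_nonempty_iff] at hne
    simp only [Nat.card_of_isEmpty, Nat.cast_zero]
    positivity
  have hm1 : 1 ≤ m := by
    obtain ⟨β, -, ⟨U, hU, -⟩, -⟩ := hne
    have := Submodule.finrank_le U
    omega
  set x : ℝ := (m : ℝ) + n with hx
  have hx1 : 1 ≤ x := by
    have : (1 : ℝ) ≤ m := by exact_mod_cast hm1
    have : (0 : ℝ) ≤ n := Nat.cast_nonneg _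
    linarith
  have hx0 : 0 ≤ x := by linarith
  set t : ℝ := x ^ ((1 : ℝ) / 3) with ht
  have ht1 : 1 ≤ t := Real.one_le_rpow hx1 (by norm_num)
  have ht3 : t ^ 3 = x := by
    rw [ht, ← Real.rpow_natCast, ← Real.rpow_mul hx0]; norm_num
  have ht8 : x ^ ((8 : ℝ) / 3) = t ^ 8 := by
    rw [ht, ← Real.rpow_natCast, ← Real.rpow_mul hx0]; norm_num
  set K := ⌈t⌉₊ with hK
  have hK1 : t ≤ K := Nat.le_ceil t
  have hK2 : (K : ℝ) ≤ 2 * t := by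
    have := Nat.ceil_lt_add_one (by linarith : 0 ≤ t)
    linarith
  have hK0 : 0 < K := Nat.ceil_pos.2 (by linarith)
  have key : ∀ β, p β → ∃ W1 : Submodule F W,
      K * s + K * Module.finrank F W1 ≤ K * n + 3 * n + 6 * K ^ 2 ∧
      Module.finrank F V < Module.finrank F (Submodule.span F {v : V | Module.finrank F
      (LinearMap.range (β v) ⊔ W1 : Submodule F W) < Module.finrank F W1 + 2 * K ^ 2}) + K := by
    intro β hβ
    have := Sym17.structure_s β K hK0 s hs hβ.1 hβ.2.1 hβ.2.2
    rwa [hn] at this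
  set w := (K * n + 3 * n + 6 * K ^ 2 - K * s) / K with hw
  have hwK : K * s + K * w ≤ K * n + 3 * n + 6 * K ^ 2 := by
    obtain ⟨β, hβ⟩ := hne
    obtain ⟨W1, h1, -⟩ := key β hβ
    have := Nat.mul_div_le (K * n + 3 * n + 6 * K ^ 2 - K * s) K
    rw [← hw] at this
    omega
  have hcount := Sym17.count (K := K) (r := 2 * K ^ 2) (w := w) hm hn p (by
    intro β hβ
    obtain ⟨W1, h1, h2⟩ := key β hβ
    refine ⟨hβ.1, Sym17.exists_code m n K (2 * K ^ 2) w (by positivity) hm hn β W1 ?_ h2⟩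
    rw [hw, Nat.le_div_iff_mul_le hK0, mul_comm]
    omega)
  have hr := Sym17.real_bound m n s K w t ht1 ht3 hK1 hK2 hwK
  rw [ht8]
  refine (Nat.cast_le (α := ℝ).2 hcount).trans ?_
  rw [Nat.cast_pow, ← Real.rpow_natCast]
  exact Real.rpow_le_rpow_of_exponent_le q1 hr
end

section
/- There exists a constant C > 0 such that for every prime power q and every integer n ≥ 1, the number L(q,n) of isomorphism classes of n-dimensional commutative F_q-algebras A that are local rings and whose residue field is F_q (i.e., the composite map F_q → A → A/m is an isomorphism, where m is the maximal ideal of A) satisfies q^{(2/27)n^3 - C n^{8/3}} ≤ L(q,n) ≤ q^{(2/27)n^3 + C n^{8/3}}. -/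
/-- A (commutative, associative, unital) `F`-algebra of dimension `n` as an
`F`-vector space that is a local ring whose residue field is `F` itself, i.e.
the composite `F → A → A/m` (with `m` the maximal ideal) is bijective. -/
structure LocalFinDimAlg (F : Type) [Field F] (n : ℕ) : Type 1 where
  carrier : Type
  [commRing : CommRing carrier]
  [algebra : Algebra F carrier]
  finrank_eq : Module.finrank F carrier = n
  isLocalRing : IsLocalRing carrier
  residue_bijective :
    Function.Bijective fun x : F =>
      Ideal.Quotient.mk (@IsLocalRing.maximalIdeal carrier _ isLocalRing)
        (algebraMap F carrier x)

attribute [instance] LocalFinDimAlg.commRing LocalFinDimAlg.algebra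

/-- Two bundled algebras are isomorphic when there is an `F`-algebra isomorphism
between them. -/
def LocalFinDimAlg.Iso {F : Type} [Field F] {n : ℕ} (A B : LocalFinDimAlg F n) : Prop :=
  Nonempty (A.carrier ≃ₐ[F] B.carrier)

/-- `L(q,n)`: the number of isomorphism classes of `n`-dimensional local
`F`-algebras with residue field `F`. -/
noncomputable def localAlgCount (F : Type) [Field F] (n : ℕ) : ℕ :=
  Nat.card (Quot (LocalFinDimAlg.Iso (F := F) (n := n)))

open Module

lemma rank_aux {F V U : Type} [Field F] [AddCommGroup V] [Module F V] [AddCommGroup U] [Module F U]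
    [FiniteDimensional F V] [FiniteDimensional F U] (f g : V →ₗ[F] U) :
    finrank F (LinearMap.range f) + 2 * finrank F
      (LinearMap.range ((LinearMap.range f).mkQ ∘ₗ g ∘ₗ (LinearMap.ker f).subtype))
      ≤ finrank F (LinearMap.range g) + finrank F (LinearMap.range (f + g)) := by
  set W := LinearMap.range f
  set G := Submodule.map g (LinearMap.ker f)
  have hr : LinearMap.range (W.mkQ ∘ₗ g ∘ₗ (LinearMap.ker f).subtype) = Submodule.map W.mkQ G := by
    rw [LinearMap.range_comp, LinearMap.range_comp, Submodule.range_subtype]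
  have hr2 : Submodule.map W.mkQ G = Submodule.map W.mkQ (W ⊔ G) := by
    rw [Submodule.map_sup, Submodule.mkQ_map_self, bot_sup_eq]
  have h1 : finrank F (Submodule.map W.mkQ G) + finrank F W = finrank F (W ⊔ G : Submodule F U) := by
    rw [hr2]
    have := LinearMap.finrank_range_add_finrank_ker (W.mkQ.domRestrict (W ⊔ G))
    rw [LinearMap.range_domRestrict] at this
    rw [← this]
    congr 1
    have : LinearMap.ker (W.mkQ.domRestrict (W ⊔ G)) = Submodule.comap (W ⊔ G).subtype W := by
      rw [LinearMap.ker_domRestrict, Submodule.ker_mkQ]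
    rw [this]
    exact (LinearEquiv.finrank_eq (Submodule.comapSubtypeEquivOfLe le_sup_left)).symm
  have h0 : finrank F (Submodule.map W.mkQ G) ≤ finrank F G := Submodule.finrank_map_le _ _
  have h2 : W ⊔ G ≤ LinearMap.range g ⊔ LinearMap.range (f + g) := by
    apply sup_le
    · rintro _ ⟨x, rfl⟩
      have : f x = -(g x) + (f + g) x := by simp
      rw [this]
      exact Submodule.add_mem_sup (Submodule.neg_mem _ ⟨x, rfl⟩) ⟨x, rfl⟩
    · exact (LinearMap.map_le_range).trans le_sup_left
  have h3 : G ≤ LinearMap.range g ⊓ LinearMap.range (f + g) := by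
    apply le_inf LinearMap.map_le_range
    rintro _ ⟨x, hx, rfl⟩
    exact ⟨x, by have : f x = 0 := hx
                 simp [this]⟩
  have h4 := Submodule.finrank_mono h2
  have h5 := Submodule.finrank_mono h3
  have h6 := Submodule.finrank_sup_add_finrank_inf_eq (LinearMap.range g) (LinearMap.range (f + g))
  rw [hr]
  omega

lemma compress {F : Type} [Field F] (ρ : ℕ) : ∀ (V U : Type) [AddCommGroup V] [Module F V]
    [AddCommGroup U] [Module F U] [FiniteDimensional F V] [FiniteDimensional F U]
    (S : Submodule F (V →ₗ[F] U)), (∀ f ∈ S, finrank F (LinearMap.range f) ≤ ρ) →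
    ∃ (K : Submodule F V) (W : Submodule F U), finrank F V ≤ finrank F K + 2 * ρ ∧
      finrank F W ≤ 2 * ρ ∧ ∀ f ∈ S, ∀ k ∈ K, f k ∈ W := by
  induction ρ using Nat.strong_induction_on with
  | _ ρ ih =>
  intro V U _ _ _ _ _ _ S hS
  rcases Nat.eq_zero_or_pos ρ with h0 | hpos
  · subst h0
    refine ⟨⊤, ⊥, by simp, by simp, fun f hf k _ => ?_⟩
    have := hS f hf
    have h := Submodule.finrank_eq_zero.1 (Nat.le_zero.1 this)
    rw [LinearMap.range_eq_bot] at h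
    simp [h]
  by_cases hex : ∃ f ∈ S, finrank F (LinearMap.range f) = ρ
  swap
  · push Not at hex
    obtain ⟨K, W, h1, h2, h3⟩ := ih (ρ - 1) (by omega) V U S (fun f hf => by
      have := hS f hf
      have := hex f hf
      omega)
    exact ⟨K, W, by omega, by omega, h3⟩
  obtain ⟨f, hf, hfr⟩ := hex
  set W := LinearMap.range f with hW
  set N := LinearMap.ker f with hN
  let Ψ : (V →ₗ[F] U) →ₗ[F] (N →ₗ[F] U ⧸ W) :=
    { toFun := fun g => W.mkQ ∘ₗ g ∘ₗ N.subtype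
      map_add' := fun a b => by ext; simp
      map_smul' := fun a b => by ext; simp }
  obtain ⟨K', W', h1, h2, h3⟩ := ih (ρ / 2) (by omega) N (U ⧸ W) (S.map Ψ) (by
    rintro _ ⟨g, hg, rfl⟩
    have a1 := rank_aux f g
    have a2 := hS g hg
    have a3 := hS (f + g) (S.add_mem hf hg)
    change finrank F (LinearMap.range (W.mkQ ∘ₗ g ∘ₗ N.subtype)) ≤ _
    rw [← hW, ← hN] at a1
    omega)
  refine ⟨K'.map N.subtype, W'.comap W.mkQ, ?_, ?_, ?_⟩
  · have b1 := LinearMap.finrank_range_add_finrank_ker f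
    have b2 : finrank F (K'.map N.subtype) = finrank F K' :=
      (LinearEquiv.finrank_eq (Submodule.equivMapOfInjective N.subtype N.injective_subtype K')).symm
    rw [b2]
    rw [← hW, ← hN] at b1
    omega
  · have := LinearMap.finrank_range_add_finrank_ker (W.mkQ.domRestrict (W'.comap W.mkQ))
    rw [LinearMap.range_domRestrict, LinearMap.ker_domRestrict, Submodule.ker_mkQ] at this
    have c1 : finrank F (Submodule.comap (W'.comap W.mkQ).subtype W) = finrank F W := by
      apply LinearEquiv.finrank_eq (Submodule.comapSubtypeEquivOfLe _)
      intro x hx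
      have : W.mkQ x = 0 := by simpa using hx
      simp [this]
    have c2 : finrank F (Submodule.map W.mkQ (W'.comap W.mkQ)) ≤ finrank F W' :=
      Submodule.finrank_mono (Submodule.map_comap_le _ _)
    omega
  · rintro g hg _ ⟨k, hk, rfl⟩
    exact h3 (Ψ g) ⟨g, hg, rfl⟩ k hk

lemma exists_fam {F R : Type} [Field F] [AddCommGroup R] [Module F R] [FiniteDimensional F R]
    (W : Submodule F R) (k : ℕ) (h : finrank F W ≤ k) :
    ∃ f : Fin k → R, Submodule.span F (Set.range f) = W := by
  let b := Module.finBasis F W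
  refine ⟨fun i => if h : i.1 < finrank F W then (b ⟨i.1, h⟩ : R) else 0, le_antisymm ?_ ?_⟩
  · rw [Submodule.span_le]
    rintro _ ⟨i, rfl⟩
    dsimp only
    split_ifs
    · exact (b _).2
    · exact W.zero_mem
  · intro x hx
    have h1 := b.sum_repr ⟨x, hx⟩
    have h2 : x = ∑ i, b.repr ⟨x, hx⟩ i • (b i : R) := by
      have := congrArg W.subtype h1
      simp only [map_sum, map_smul, Submodule.subtype_apply] at this
      exact this.symm
    rw [h2]
    refine Submodule.sum_mem _ fun i _ => Submodule.smul_mem _ _ (Submodule.subset_span ?_)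
    refine ⟨⟨i.1, lt_of_lt_of_le i.2 h⟩, ?_⟩
    simp

lemma finset_fam {R : Type} [Zero R] (s : Finset R) (k : ℕ) (h : s.card ≤ k) :
    ∃ f : Fin k → R, (∀ i, f i ∈ s ∨ f i = 0) ∧ (s : Set R) ⊆ Set.range f := by
  refine ⟨fun i => if h : i.1 < s.card then (s.equivFin.symm ⟨i.1, h⟩ : R) else 0, ?_, ?_⟩
  · intro i
    dsimp only
    split_ifs
    · left; exact (s.equivFin.symm _).2
    · right; rfl
  · intro x hx
    refine ⟨⟨(s.equivFin ⟨x, hx⟩).1, lt_of_lt_of_le (s.equivFin ⟨x, hx⟩).2 h⟩, ?_⟩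
    simp

lemma greedy {F R : Type} [Field F] [CommRing R] [Algebra F R] [FiniteDimensional F R]
    (m : Ideal R) (a : ℕ) (ha : 1 ≤ a) :
    ∃ Y : Finset R, (Y : Set R) ⊆ m ∧ a * Y.card ≤ finrank F R ∧
      ∀ v ∈ m, finrank F (((Ideal.span {v}).restrictScalars F).map
        ((Ideal.span (Y : Set R)).restrictScalars F).mkQ) ≤ a := by
  classical
  let Q : ℕ → Prop := fun k => ∃ Y : Finset R, (Y : Set R) ⊆ m ∧ Y.card = k ∧
    a * k ≤ finrank F ((Ideal.span (Y : Set R)).restrictScalars F)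
  have hQ0 : Q 0 := ⟨∅, by simp, by simp, by simp⟩
  have hb : ∀ k, Q k → k ≤ finrank F R := by
    rintro k ⟨Y, -, -, h⟩
    have h1 := Submodule.finrank_le ((Ideal.span (Y : Set R)).restrictScalars F)
    have h2 : 1 * k ≤ a * k := Nat.mul_le_mul_right _ ha
    omega
  have hsp : Q (Nat.findGreatest Q (finrank F R)) := Nat.findGreatest_spec (Nat.zero_le _) hQ0
  obtain ⟨Y, hYm, hYc, hY⟩ := hsp
  have hmax : ¬ Q (Y.card + 1) := by
    intro h
    have := Nat.le_findGreatest (hb _ h) h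
    omega
  rw [← hYc] at hY
  refine ⟨Y, hYm, hY.trans (Submodule.finrank_le _), fun v hv => ?_⟩
  by_contra hlt
  push Not at hlt
  apply hmax
  set P := (Ideal.span (Y : Set R)).restrictScalars F with hP
  have hvY : v ∉ Y := by
    intro hvY
    have : ((Ideal.span {v}).restrictScalars F).map P.mkQ = ⊥ := by
      rw [← le_bot_iff, Submodule.map_le_iff_le_comap, Submodule.comap_bot, Submodule.ker_mkQ]
      intro x hx
      exact (Ideal.span_mono (by simpa using hvY)) hx
    rw [this] at hlt
    simp at hlt
  refine ⟨insert v Y, ?_, Finset.card_insert_of_notMem hvY, ?_⟩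
  · intro x hx
    rcases Finset.mem_insert.1 hx with rfl | h
    · exact hv
    · exact hYm h
  · set P' := (Ideal.span ((insert v Y : Finset R) : Set R)).restrictScalars F with hP'
    have hPP : P ≤ P' := Ideal.span_mono (by simp)
    have hvP : (Ideal.span {v}).restrictScalars F ≤ P' := Ideal.span_mono (by simp)
    have := LinearMap.finrank_range_add_finrank_ker (P.mkQ.domRestrict P')
    rw [LinearMap.range_domRestrict, LinearMap.ker_domRestrict, Submodule.ker_mkQ] at this
    have c1 : finrank F (Submodule.comap P'.subtype P) = finrank F P :=
      LinearEquiv.finrank_eq (Submodule.comapSubtypeEquivOfLe hPP)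
    have c2 := Submodule.finrank_mono (Submodule.map_mono (f := P.mkQ) hvP)
    rw [mul_add]
    omega

lemma few_gens {F R : Type} [Field F] [CommRing R] [Algebra F R] [FiniteDimensional F R]
    (m : Ideal R) (a K : ℕ) (ha : 1 ≤ a) (hK : ∀ k, a * k ≤ finrank F R → k + 4 * a ≤ K) :
    ∃ w : Fin K → R, (∀ k, w k ∈ m) ∧ m * m ≤ Ideal.span (Set.range w) := by
  classical
  obtain ⟨Y, hYm, hYc, hY⟩ := greedy (F := F) m a ha
  set P := (Ideal.span (Y : Set R)).restrictScalars F with hP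
  let mF : Submodule F R := m.restrictScalars F
  let Φ : mF →ₗ[F] mF →ₗ[F] (R ⧸ P) := ((LinearMap.mul F R).compr₂ P.mkQ).domRestrict₁₂ mF mF
  have hΦ : ∀ v k : mF, Φ v k = P.mkQ ((v : R) * k) := fun v k => rfl
  obtain ⟨K', W', h1, h2, h3⟩ := compress a mF (R ⧸ P) (LinearMap.range Φ) (by
    rintro _ ⟨v, rfl⟩
    refine le_trans (Submodule.finrank_mono ?_) (hY v v.2)
    rintro _ ⟨k, rfl⟩
    rw [hΦ]
    exact Submodule.mem_map_of_mem (Ideal.mul_mem_right _ _ (Ideal.mem_span_singleton_self _)))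
  obtain ⟨C, hC⟩ := Submodule.exists_isCompl K'
  have hCr := Submodule.finrank_add_eq_of_isCompl hC
  obtain ⟨c, hc⟩ := exists_fam C (2 * a) (by omega)
  obtain ⟨l, hl⟩ := exists_fam (W' ⊓ mF.map P.mkQ) (2 * a)
    ((Submodule.finrank_mono inf_le_left).trans h2)
  have hlm : ∀ i, ∃ z ∈ m, P.mkQ z = l i := by
    intro i
    have : l i ∈ W' ⊓ mF.map P.mkQ := by
      rw [← hl]; exact Submodule.subset_span ⟨i, rfl⟩
    obtain ⟨z, hz, hz2⟩ := this.2
    exact ⟨z, hz, hz2⟩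
  choose z hzm hz using hlm
  let s : Finset R := Y ∪ (Finset.univ.image fun i => (c i : R)) ∪ Finset.univ.image z
  have hs : s.card ≤ K := by
    have e1 := Finset.card_union_le (Y ∪ (Finset.univ.image fun i => (c i : R))) (Finset.univ.image z)
    have e2 := Finset.card_union_le Y (Finset.univ.image fun i => (c i : R))
    have e3 := Finset.card_image_le (s := Finset.univ) (f := fun i => (c i : R))
    have e4 := Finset.card_image_le (s := Finset.univ) (f := z)
    simp only [Finset.card_univ, Fintype.card_fin] at e3 e4
    have := hK _ hYc
    change ((Y ∪ (Finset.univ.image fun i => (c i : R))) ∪ Finset.univ.image z).card ≤ K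
    omega
  obtain ⟨w, hw1, hw2⟩ := finset_fam s K hs
  have hsm : ∀ x ∈ s, x ∈ m := by
    intro x hx
    simp only [s, Finset.mem_union, Finset.mem_image, Finset.mem_univ, true_and] at hx
    rcases hx with (hx | ⟨i, rfl⟩) | ⟨i, rfl⟩
    · exact hYm hx
    · exact (c i).2
    · exact hzm i
  refine ⟨w, fun k => (hw1 k).elim (hsm _) (fun h => h ▸ m.zero_mem), ?_⟩
  set J := Ideal.span (Set.range w) with hJ
  have hsJ : ∀ x ∈ s, x ∈ J := fun x hx => Ideal.subset_span (hw2 hx)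
  have hPJ : ∀ x ∈ P, x ∈ J := by
    intro x hx
    have : Ideal.span (Y : Set R) ≤ J := Ideal.span_le.2 fun y hy => hsJ y (by
      simp only [s, Finset.mem_union]; exact Or.inl (Or.inl hy))
    exact this hx
  have hWJ : ∀ x : R, P.mkQ x ∈ W' ⊓ mF.map P.mkQ → x ∈ J := by
    intro x hx
    have hle : W' ⊓ mF.map P.mkQ ≤ (J.restrictScalars F).map P.mkQ := by
      rw [← hl, Submodule.span_le]
      rintro _ ⟨i, rfl⟩
      exact ⟨z i, hsJ _ (by simp [s]), hz i⟩
    obtain ⟨y, hy, hyx⟩ := hle hx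
    have : x - y ∈ P := by
      have : P.mkQ (x - y) = 0 := by rw [map_sub, hyx, sub_self]
      exact (Submodule.Quotient.mk_eq_zero P).1 this
    have h := J.add_mem (hPJ _ this) hy
    simpa using h
  have hCJ : ∀ x ∈ C, (x : R) ∈ J := by
    intro x hx
    rw [← hc] at hx
    have : Submodule.span F (Set.range c) ≤ (J.restrictScalars F).comap mF.subtype := by
      rw [Submodule.span_le]
      rintro _ ⟨i, rfl⟩
      exact hsJ _ (by simp [s])
    exact this hx
  rw [Ideal.mul_le]
  intro v hv u hu
  have hu' : (⟨u, hu⟩ : mF) ∈ K' ⊔ C := by rw [hC.sup_eq_top]; trivial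
  obtain ⟨k, hk, c', hc', hkc⟩ := Submodule.mem_sup.1 hu'
  have : u = (k : R) + c' := by
    have := congrArg Subtype.val hkc
    simpa using this.symm
  rw [this, mul_add]
  refine J.add_mem (hWJ _ ⟨?_, ?_⟩) (J.mul_mem_left _ (hCJ _ hc'))
  · exact h3 (Φ ⟨v, hv⟩) ⟨_, rfl⟩ k hk
  · exact Submodule.mem_map_of_mem (m.mul_mem_left _ k.2)

lemma iter_span {F R : Type} [Field F] [CommRing R] [Algebra F R] (m : Ideal R)
    (hm : IsNilpotent m) (hR : ∀ r : R, ∃ c : F, r - algebraMap F R c ∈ m) {K : ℕ}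
    (w : Fin K → R) (hwm : ∀ k, w k ∈ m) (T : Submodule F R) (hwT : ∀ k, w k ∈ T)
    (hT : ∀ k, ∀ t ∈ T, w k * t ∈ T)
    (h : ∀ a ∈ m, ∃ t ∈ T, a - t ∈ Ideal.span (Set.range w)) : ∀ a ∈ m, a ∈ T := by
  obtain ⟨N, hN⟩ := hm
  have key : ∀ j : ℕ, ∀ a ∈ m, ∃ t ∈ T, a - t ∈ m ^ j := by
    intro j
    induction j with
    | zero => intro a _; exact ⟨0, T.zero_mem, by simp⟩
    | succ j ih =>
      intro a ha
      obtain ⟨t, ht, hat⟩ := h a ha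
      obtain ⟨c, hc⟩ := (Submodule.mem_span_range_iff_exists_fun R).1 hat
      choose f hf using hR
      have := fun k => ih _ (hf (c k))
      choose t' ht' hr using this
      refine ⟨t + ∑ k, (f (c k) • w k + w k * t' k), T.add_mem ht (T.sum_mem fun k _ =>
        T.add_mem (T.smul_mem _ (hwT k)) (hT k _ (ht' k))), ?_⟩
      have : a - (t + ∑ k, (f (c k) • w k + w k * t' k))
          = ∑ k, w k * (c k - algebraMap F R (f (c k)) - t' k) := by
        rw [← sub_sub, ← hc, ← Finset.sum_sub_distrib]
        refine Finset.sum_congr rfl fun k _ => ?_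
        rw [smul_eq_mul, Algebra.smul_def]; ring
      rw [this, pow_succ']
      exact Ideal.sum_mem _ fun k _ => Ideal.mul_mem_mul (hwm k) (hr k)
  intro a ha
  obtain ⟨t, ht, hat⟩ := key N a ha
  rw [hN] at hat
  have : a = t := sub_eq_zero.1 hat
  rwa [this]

lemma iso_of_data {F R R' : Type} [Field F] [CommRing R] [Algebra F R] [CommRing R'] [Algebra F R']
    (m : Ideal R) (hm : IsNilpotent m) (hR : ∀ r : R, ∃ c : F, r - algebraMap F R c ∈ m)
    {K d : ℕ} (w : Fin K → R) (hwm : ∀ k, w k ∈ m) (x : Fin d → R)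
    (hx : ∀ a ∈ m, ∃ t ∈ Submodule.span F (Set.range x), a - t ∈ Ideal.span (Set.range w))
    (φ : R ≃ₗ[F] R') (h1 : φ 1 = 1) (hxx : ∀ i j, φ (x i * x j) = φ (x i) * φ (x j))
    (hw : ∀ k b, φ (w k * b) = φ (w k) * φ b) : Nonempty (R ≃ₐ[F] R') := by
  have full : ∀ T : Submodule F R, (1 : R) ∈ T → (∀ k, w k ∈ T) → (∀ k, ∀ t ∈ T, w k * t ∈ T) →
      (∀ i, x i ∈ T) → ∀ b, b ∈ T := by
    intro T h1T hwT hT hxT b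
    have hmT := iter_span m hm hR w hwm T hwT hT (by
      intro a ha
      obtain ⟨t, ht, hh⟩ := hx a ha
      refine ⟨t, ?_, hh⟩
      have : Submodule.span F (Set.range x) ≤ T := by
        rw [Submodule.span_le]; rintro _ ⟨i, rfl⟩; exact hxT i
      exact this ht)
    obtain ⟨c, hc⟩ := hR b
    have := T.add_mem (hmT _ hc) (T.smul_mem c h1T)
    rwa [Algebra.smul_def, mul_one, sub_add_cancel] at this
  let Tm : R → Submodule F R := fun a =>
    { carrier := {b | φ (a * b) = φ a * φ b}
      add_mem' := by intro p q hp hq; simp only [Set.mem_ofPred_eq] at *; simp [mul_add, hp, hq]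
      zero_mem' := by simp
      smul_mem' := by
        intro c p hp; simp only [Set.mem_ofPred_eq] at *
        rw [mul_smul_comm, map_smul, map_smul, hp, mul_smul_comm] }
  have hTm : ∀ a b, b ∈ Tm a ↔ φ (a * b) = φ a * φ b := fun a b => Iff.rfl
  have hxi : ∀ i b, φ (x i * b) = φ (x i) * φ b := by
    intro i b
    refine full (Tm (x i)) ?_ ?_ ?_ ?_ b
    · rw [hTm]; simp [h1]
    · intro k; rw [hTm, mul_comm, hw, mul_comm]
    · intro k t ht
      rw [hTm] at *
      rw [mul_left_comm, hw, ht, hw]; ring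
    · intro j; exact hxx i j
  have hall : ∀ a b, φ (a * b) = φ a * φ b := by
    intro a b
    rw [mul_comm, mul_comm (φ a)]
    refine full (Tm b) ?_ ?_ ?_ ?_ a
    · rw [hTm]; simp [h1]
    · intro k; rw [hTm, mul_comm, hw, mul_comm]
    · intro k t ht
      rw [hTm] at *
      rw [mul_left_comm, hw, ht, hw]; ring
    · intro i; rw [hTm, mul_comm, hxi, mul_comm]
  exact ⟨AlgEquiv.ofLinearEquiv φ h1 hall⟩

abbrev CodeD (F : Type) [Field F] (n K d : ℕ) : Type :=
  (Fin n → F) × (Fin d → Fin n → F) × (Fin (n - d) → Fin n → F) ×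
    (Sym2 (Fin d) → Fin (n - d) → F) × (Fin K → Fin n → F) ×
    (Fin K → ((Fin n → F) →ₗ[F] (Fin n → F)))

structure HasCode {F : Type} [Field F] {n : ℕ} (K : ℕ) (A : LocalFinDimAlg F n)
    (c : Σ d : Fin (n + 1), CodeD F n K d) : Prop where
  ex : ∃ (m : Ideal A.carrier) (e : A.carrier ≃ₗ[F] (Fin n → F)) (w : Fin K → A.carrier)
    (x : Fin c.1 → A.carrier) (y : Fin (n - c.1) → A.carrier),
    IsNilpotent m ∧ (∀ r : A.carrier, ∃ c : F, r - algebraMap F A.carrier c ∈ m) ∧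
    (∀ k, w k ∈ m) ∧
    (∀ a ∈ m, ∃ t ∈ Submodule.span F (Set.range x), a - t ∈ Ideal.span (Set.range w)) ∧
    e 1 = c.2.1 ∧ (∀ i, e (x i) = c.2.2.1 i) ∧ (∀ i, e (y i) = c.2.2.2.1 i) ∧
    (∀ i j, x i * x j = ∑ l, c.2.2.2.2.1 s(i, j) l • y l) ∧
    (∀ k, e (w k) = c.2.2.2.2.2.1 k) ∧ (∀ k b, e (w k * b) = c.2.2.2.2.2.2 k (e b))

lemma HasCode.iso {F : Type} [Field F] {n K : ℕ} {A B : LocalFinDimAlg F n} 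
    {c : Σ d : Fin (n + 1), CodeD F n K d} (hA : HasCode K A c) (hB : HasCode K B c) :
    A.Iso B := by
  obtain ⟨m, e, w, x, y, h1, h2, h3, h4, h5, h6, h7, h8, h9, h10⟩ := hA.ex
  obtain ⟨m', e', w', x', y', -, -, -, -, k5, k6, k7, k8, k9, k10⟩ := hB.ex
  have hx : ∀ i, (e.trans e'.symm) (x i) = x' i := by
    intro i; simp [h6, ← k6]
  have hy : ∀ i, (e.trans e'.symm) (y i) = y' i := by
    intro i; simp [h7, ← k7]
  have hw : ∀ i, (e.trans e'.symm) (w i) = w' i := by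
    intro i; simp [h9, ← k9]
  refine iso_of_data m h1 h2 w h3 x h4 (e.trans e'.symm) ?_ ?_ ?_
  · simp [h5, ← k5]
  · intro i j
    rw [hx, hx, h8, k8, map_sum]
    simp only [map_smul, hy]
  · intro k b
    rw [hw]
    apply e'.injective
    rw [k10]
    simp [h10]

lemma exists_code {F : Type} [Field F] {n : ℕ} (hn : 1 ≤ n) (a K : ℕ) (ha : 1 ≤ a)
    (hK : ∀ k, a * k ≤ n → k + 4 * a ≤ K) (A : LocalFinDimAlg F n) : ∃ c, HasCode K A c := by
  have hfr := A.finrank_eq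
  have : FiniteDimensional F A.carrier := FiniteDimensional.of_finrank_pos (by omega)
  have := A.isLocalRing
  have : IsArtinianRing A.carrier := IsArtinianRing.of_finite F A.carrier
  let m := IsLocalRing.maximalIdeal A.carrier
  have hnil : IsNilpotent m := by
    have := IsArtinianRing.isNilpotent_jacobson_bot (R := A.carrier)
    rwa [IsLocalRing.jacobson_eq_maximalIdeal ⊥ bot_ne_top] at this
  have hR : ∀ r : A.carrier, ∃ c : F, r - algebraMap F A.carrier c ∈ m := by
    intro r
    obtain ⟨c, hc⟩ := A.residue_bijective.2 (Ideal.Quotient.mk _ r)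
    exact ⟨c, Ideal.Quotient.eq.1 hc.symm⟩
  obtain ⟨w, hwm, hw⟩ := few_gens (F := F) m a K ha (by rwa [hfr])
  let M : Submodule F A.carrier := m.restrictScalars F
  let M2 : Submodule F A.carrier := (m * m).restrictScalars F
  have hle : M2 ≤ M := Ideal.mul_le_left
  obtain ⟨C, hC⟩ := Submodule.exists_isCompl M2
  have hd := Submodule.finrank_add_eq_of_isCompl hC
  have hd' : finrank F (C ⊓ M : Submodule F A.carrier) ≤ finrank F C :=
    Submodule.finrank_mono inf_le_left
  rw [hfr] at hd
  let d : ℕ := finrank F (C ⊓ M : Submodule F A.carrier)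
  obtain ⟨x, hx⟩ := exists_fam (C ⊓ M) d le_rfl
  obtain ⟨y, hy⟩ := exists_fam M2 (n - d) (by omega)
  have hxm : ∀ i, x i ∈ m := by
    intro i
    have : x i ∈ C ⊓ M := by rw [← hx]; exact Submodule.subset_span ⟨i, rfl⟩
    exact this.2
  have hxx : ∀ i j, ∃ c : Fin (n - d) → F, ∑ l, c l • y l = x i * x j := by
    intro i j
    apply (Submodule.mem_span_range_iff_exists_fun F).1
    rw [hy]
    exact Ideal.mul_mem_mul (hxm i) (hxm j)
  have hxs : ∀ s : Sym2 (Fin d), ∃ c : Fin (n - d) → F, ∀ i j, s = s(i, j) →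
      ∑ l, c l • y l = x i * x j := by
    intro s
    induction s using Sym2.ind with
    | _ i j =>
    obtain ⟨c, hc⟩ := hxx i j
    refine ⟨c, fun i' j' h => ?_⟩
    rw [hc]
    rcases Sym2.eq_iff.1 h with ⟨rfl, rfl⟩ | ⟨rfl, rfl⟩
    · rfl
    · exact mul_comm _ _
  choose cs hcs using hxs
  let e : A.carrier ≃ₗ[F] (Fin n → F) := (Module.finBasisOfFinrankEq F A.carrier hfr).equivFun
  refine ⟨⟨⟨d, by omega⟩, e 1, fun i => e (x i), fun i => e (y i), cs, fun k => e (w k),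
    fun k => e.toLinearMap ∘ₗ LinearMap.mulLeft F (w k) ∘ₗ e.symm.toLinearMap⟩, ⟨?_⟩⟩
  refine ⟨m, e, w, x, y, hnil, hR, hwm, ?_, rfl, fun _ => rfl, fun _ => rfl, ?_, fun _ => rfl, ?_⟩
  · intro b hb
    have hb' : b ∈ M2 ⊔ C := by rw [hC.sup_eq_top]; trivial
    obtain ⟨p, hp, t, ht, rfl⟩ := Submodule.mem_sup.1 hb'
    refine ⟨t, ?_, ?_⟩
    · rw [hx]
      refine ⟨ht, ?_⟩
      have := M.sub_mem hb (hle hp)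
      simpa using this
    · rw [add_sub_cancel_right]; exact hw hp
  · intro i j
    exact (hcs _ i j rfl).symm
  · intro k b
    simp

lemma code_rank {F : Type} [Field F] (n K d : ℕ) : finrank F (CodeD F n K d) =
    n + (d * n + ((n - d) * n + ((d + 1).choose 2 * (n - d) + (K * n + K * (n * n))))) := by
  simp [CodeD, Module.finrank_prod, Module.finrank_pi_fintype, Module.finrank_linearMap, Sym2.card]

lemma upper_finite {F : Type} [Field F] [Fintype F] {n : ℕ} (hn : 1 ≤ n) (a K : ℕ) (ha : 1 ≤ a)
    (hK : ∀ k, a * k ≤ n → k + 4 * a ≤ K) :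
    Finite (Quot (LocalFinDimAlg.Iso (F := F) (n := n))) ∧
    localAlgCount F n ≤ ∑ d : Fin (n + 1), Fintype.card F ^ finrank F (CodeD F n K d) := by
  choose f hf using exists_code (F := F) hn a K ha hK
  have hfin : ∀ d, Finite (CodeD F n K d) := fun d => Module.finite_of_finite F
  have hinj : Function.Injective fun q : Quot (LocalFinDimAlg.Iso (F := F) (n := n)) => f q.out := by
    intro p q hpq
    have h1 := hf p.out
    have h2 := hf q.out
    dsimp only at hpq
    rw [hpq] at h1
    have := Quot.sound (r := LocalFinDimAlg.Iso) (h1.iso h2)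
    simpa [Quot.out_eq] using this
  refine ⟨Finite.of_injective _ hinj, ?_⟩
  refine (Nat.card_le_card_of_injective _ hinj).trans (le_of_eq ?_)
  rw [Nat.card_sigma]
  refine Finset.sum_congr rfl fun d _ => ?_
  rw [Module.natCard_eq_pow_finrank (K := F), Nat.card_eq_fintype_card]

lemma upper_num (n d K : ℕ) (hd : d ≤ n) (hn : 1 ≤ n) (hK : K = 5 * (Nat.sqrt n + 1)) :
    ((n + (d * n + ((n - d) * n + ((d + 1).choose 2 * (n - d) + (K * n + K * (n * n))))) : ℕ) : ℝ)
      + n ≤ (2 / 27 : ℝ) * (n : ℝ) ^ 3 + 30 * (n : ℝ) ^ ((8 : ℝ) / 3) := by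
  have hn0 : (0 : ℝ) < n := by exact_mod_cast hn
  have hn1 : (1 : ℝ) ≤ n := by exact_mod_cast hn
  have hd0 : (0 : ℝ) ≤ d := by positivity
  have hdn : (d : ℝ) ≤ n := by exact_mod_cast hd
  set s : ℝ := (n : ℝ) ^ ((2 : ℝ) / 3) with hs
  have h83 : (n : ℝ) ^ ((8 : ℝ) / 3) = n ^ 2 * s := by
    rw [hs, ← Real.rpow_natCast, ← Real.rpow_add hn0]; norm_num
  have hs1 : 1 ≤ s := Real.one_le_rpow hn1 (by norm_num)
  have hsq : (Nat.sqrt n : ℝ) ≤ s := by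
    refine (Real.nat_sqrt_le_real_sqrt).trans ?_
    rw [Real.sqrt_eq_rpow]
    exact Real.rpow_le_rpow_of_exponent_le hn1 (by norm_num)
  have hKs : (K : ℝ) ≤ 10 * s := by
    rw [hK]; push_cast; linarith
  rw [h83]
  push_cast [Nat.cast_sub hd, Nat.cast_choose_two]
  have e1 : (d : ℝ) ^ 2 * (n - d) ≤ 4 / 27 * n ^ 3 := by
    nlinarith [mul_nonneg (sq_nonneg ((d : ℝ) - 2 / 3 * n)) (by positivity : (0 : ℝ) ≤ d + n / 3)]
  have e2 : (d : ℝ) * (n - d) ≤ n ^ 2 := by nlinarith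
  have e3 : (n : ℝ) ≤ n ^ 2 := by nlinarith
  have e4 : (n : ℝ) ^ 2 ≤ n ^ 2 * s := by nlinarith [sq_nonneg (n : ℝ)]
  have e5 : (K : ℝ) * (n + n * n) ≤ 10 * s * (2 * n ^ 2) := by
    apply mul_le_mul hKs _ (by positivity) (by positivity)
    nlinarith
  nlinarith

lemma upper_bound {F : Type} [Field F] [Fintype F] {n : ℕ} (hn : 1 ≤ n) :
    Finite (Quot (LocalFinDimAlg.Iso (F := F) (n := n))) ∧
    (localAlgCount F n : ℝ)
      ≤ (Fintype.card F : ℝ) ^ ((2 / 27 : ℝ) * (n : ℝ) ^ 3 + 30 * (n : ℝ) ^ ((8 : ℝ) / 3)) := by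
  obtain ⟨h1, h2⟩ := upper_finite (F := F) hn (Nat.sqrt n + 1) (5 * (Nat.sqrt n + 1)) (by omega) (by
    intro k hk
    have : n < (Nat.sqrt n + 1) * (Nat.sqrt n + 1) := Nat.lt_succ_sqrt n
    have : k < Nat.sqrt n + 1 := by
      by_contra hh
      push Not at hh
      have := Nat.mul_le_mul_left (Nat.sqrt n + 1) hh
      omega
    omega)
  refine ⟨h1, ?_⟩
  have hq : (2 : ℝ) ≤ Fintype.card F := by exact_mod_cast Fintype.one_lt_card (α := F)
  have hq0 : (0 : ℝ) < Fintype.card F := by linarith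
  set X := (2 / 27 : ℝ) * (n : ℝ) ^ 3 + 30 * (n : ℝ) ^ ((8 : ℝ) / 3) with hX
  have h3 : (localAlgCount F n : ℝ) ≤ ∑ d : Fin (n + 1), (Fintype.card F : ℝ) ^ (X - n) := by
    refine le_trans (Nat.cast_le.2 h2) ?_
    push_cast
    refine Finset.sum_le_sum fun d _ => ?_
    rw [← Real.rpow_natCast]
    apply Real.rpow_le_rpow_of_exponent_le (by linarith)
    rw [code_rank]
    have := upper_num n d _ (by omega) hn rfl
    linarith
  refine h3.trans ?_
  rw [Finset.sum_const, Finset.card_univ, Fintype.card_fin, nsmul_eq_mul]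
  have h4 : ((n + 1 : ℕ) : ℝ) ≤ (Fintype.card F : ℝ) ^ (n : ℝ) := by
    rw [Real.rpow_natCast]
    calc ((n + 1 : ℕ) : ℝ) ≤ ((2 ^ n : ℕ) : ℝ) := by exact_mod_cast Nat.lt_two_pow_self
      _ = 2 ^ n := by push_cast; rfl
      _ ≤ _ := pow_le_pow_left₀ (by norm_num) hq n
  calc _ ≤ (Fintype.card F : ℝ) ^ (n : ℝ) * (Fintype.card F : ℝ) ^ (X - n) := by
        apply mul_le_mul_of_nonneg_right h4 (by positivity)
    _ = _ := by rw [← Real.rpow_add hq0]; congr 1; ring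

section Lower
variable {F : Type} [Field F] {d r : ℕ}

noncomputable def symB (c : Sym2 (Fin d) → Fin r → F) :
    (Fin d → F) →ₗ[F] (Fin d → F) →ₗ[F] (Fin r → F) :=
  LinearMap.mk₂ F (fun v w => ∑ i, ∑ j, (v i * w j) • c s(i, j))
    (by intros; simp [add_mul, add_smul, Finset.sum_add_distrib])
    (by intros; simp [Finset.smul_sum, mul_assoc, mul_smul])
    (by intros; simp [mul_add, add_smul, Finset.sum_add_distrib])
    (by intros; simp [Finset.smul_sum, smul_smul, mul_left_comm, mul_assoc])

lemma symB_apply (c : Sym2 (Fin d) → Fin r → F) (v w) :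
    symB c v w = ∑ i, ∑ j, (v i * w j) • c s(i, j) := rfl

lemma symB_comm (c : Sym2 (Fin d) → Fin r → F) (v w) : symB c v w = symB c w v := by
  rw [symB_apply, symB_apply, Finset.sum_comm]
  refine Finset.sum_congr rfl fun i _ => Finset.sum_congr rfl fun j _ => ?_
  rw [mul_comm, Sym2.eq_swap]

lemma symB_single (c : Sym2 (Fin d) → Fin r → F) (i j : Fin d) :
    symB c (Pi.single i 1) (Pi.single j 1) = c s(i, j) := by
  rw [symB_apply, Finset.sum_eq_single i, Finset.sum_eq_single j]
  · simp
  · intro b _ hb; simp [hb]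
  · simp
  · intro b _ hb; simp [hb]
  · simp

abbrev Sp3 (F : Type) [Field F] (d r : ℕ) : Type := F × (Fin d → F) × (Fin r → F)

def Alg3 (_c : Sym2 (Fin d) → Fin r → F) : Type := Sp3 F d r

variable (c : Sym2 (Fin d) → Fin r → F)

instance : AddCommGroup (Alg3 c) := inferInstanceAs (AddCommGroup (Sp3 F d r))
instance : Module F (Alg3 c) := inferInstanceAs (Module F (Sp3 F d r))

noncomputable def mul3 (c : Sym2 (Fin d) → Fin r → F) (x y : Sp3 F d r) : Sp3 F d r :=
  (x.1 * y.1, x.1 • y.2.1 + y.1 • x.2.1, x.1 • y.2.2 + y.1 • x.2.2 + symB c x.2.1 y.2.1)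

lemma mul3_comm (x y : Sp3 F d r) : mul3 c x y = mul3 c y x := by
  simp only [mul3]
  rw [mul_comm, symB_comm, add_comm (x.1 • y.2.1), add_comm (x.1 • y.2.2)]

lemma mul3_add (x y z : Sp3 F d r) : mul3 c x (y + z) = mul3 c x y + mul3 c x z := by
  simp only [mul3, Prod.fst_add, Prod.snd_add, Prod.mk_add_mk, map_add, smul_add, add_smul]
  refine Prod.ext ?_ (Prod.ext ?_ ?_)
  · simp only; ring
  · simp only; abel
  · simp only; abel

lemma mul3_assoc (x y z : Sp3 F d r) : mul3 c (mul3 c x y) z = mul3 c x (mul3 c y z) := by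
  simp only [mul3, map_add, map_smul, smul_add, add_smul, LinearMap.add_apply, LinearMap.smul_apply,
    smul_smul]
  refine Prod.ext ?_ (Prod.ext ?_ ?_)
  · simp only; ring
  · simp only [mul_comm, mul_left_comm]; abel
  · simp only [mul_comm, mul_left_comm]; abel

lemma mul3_one (x : Sp3 F d r) : mul3 c (1, 0, 0) x = x := by
  simp [mul3]

lemma mul3_smul (a : F) (x y : Sp3 F d r) : mul3 c (a • x) y = a • mul3 c x y := by
  simp only [mul3, Prod.smul_fst, Prod.smul_snd, map_smul, LinearMap.smul_apply, Prod.smul_mk,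
    smul_add, smul_smul, smul_eq_mul]
  refine Prod.ext ?_ (Prod.ext ?_ ?_)
  · simp only; ring
  · simp only [mul_comm]
  · simp only [mul_comm]

noncomputable instance instCR : CommRing (Alg3 c) :=
  { (inferInstance : AddCommGroup (Alg3 c)) with
    mul := mul3 c
    one := ((1, 0, 0) : Sp3 F d r)
    mul_assoc := mul3_assoc c
    mul_comm := mul3_comm c
    one_mul := mul3_one c
    mul_one := fun x => (mul3_comm c _ _).trans (mul3_one c x)
    left_distrib := mul3_add c
    right_distrib := fun x y z => (mul3_comm c _ _).trans <| (mul3_add c z x y).trans <| by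
      rw [mul3_comm c z x, mul3_comm c z y]; rfl
    zero_mul := fun x => by
      have := mul3_smul c (0 : F) 0 x
      rw [zero_smul, zero_smul] at this
      exact this
    mul_zero := fun x => by
      have := mul3_smul c (0 : F) 0 x
      rw [zero_smul, zero_smul] at this
      exact (mul3_comm c _ _).trans this }

noncomputable instance instAl : Algebra F (Alg3 c) :=
  Algebra.ofModule (fun a x y => mul3_smul c a x y)
    (fun a x y => (mul3_comm c _ _).trans <| (mul3_smul c a y x).trans <| by
      rw [mul3_comm c y x]; rfl)

def fst3 : Alg3 c →+* F where
  toFun x := (show Sp3 F d r from x).1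
  map_one' := rfl
  map_mul' _ _ := rfl
  map_zero' := rfl
  map_add' _ _ := rfl

lemma algebraMap3 (a : F) : algebraMap F (Alg3 c) a = (show Alg3 c from ((a, 0, 0) : Sp3 F d r)) := by
  rw [Algebra.algebraMap_eq_smul_one]
  change a • ((1, 0, 0) : Sp3 F d r) = _
  simp

lemma nil3 (x : Alg3 c) (hx : fst3 c x = 0) : IsNilpotent x := by
  refine ⟨3, ?_⟩
  rw [pow_succ, pow_two]
  change mul3 c (mul3 c x x) x = (0, 0, 0)
  have hx' : (show Sp3 F d r from x).1 = 0 := hx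
  dsimp only at hx'
  simp [mul3, hx']

lemma fst3_alg (a : F) : fst3 c (algebraMap F _ a) = a := by
  rw [algebraMap3]; rfl

instance : IsLocalHom (fst3 c) where
  map_nonunit x hx := by
    have h1 : IsNilpotent (x - algebraMap F _ (fst3 c x)) := nil3 c _ (by
      rw [map_sub, fst3_alg, sub_self])
    have h2 : IsUnit (algebraMap F (Alg3 c) (fst3 c x)) := hx.map _
    have := h1.isUnit_add_right_of_commute h2 (Commute.all _ _)
    simpa using this

lemma local3 : IsLocalRing (Alg3 c) := RingHom.domain_isLocalRing (fst3 c)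

lemma finrank3 : finrank F (Alg3 c) = 1 + (d + r) := by
  change finrank F (Sp3 F d r) = _
  simp

noncomputable def toLFA (n : ℕ) (hn : 1 + (d + r) = n) (c : Sym2 (Fin d) → Fin r → F) :
    LocalFinDimAlg F n where
  carrier := Alg3 c
  finrank_eq := (finrank3 c).trans hn
  isLocalRing := local3 c
  residue_bijective := by
    have := local3 c
    constructor
    · exact ((Ideal.Quotient.mk (IsLocalRing.maximalIdeal (Alg3 c))).comp
        (algebraMap F (Alg3 c))).injective
    · intro y
      obtain ⟨x, rfl⟩ := Ideal.Quotient.mk_surjective y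
      refine ⟨fst3 c x, ?_⟩
      refine Ideal.Quotient.eq.2 ?_
      rw [IsLocalRing.mem_maximalIdeal]
      intro hu
      have := hu.map (fst3 c)
      rw [map_sub, fst3_alg, sub_self] at this
      exact not_isUnit_zero this

lemma mul3_inj (c c' : Sym2 (Fin d) → Fin r → F) (h : ∀ x y, mul3 c x y = mul3 c' x y) : c = c' := by
  funext s
  induction s using Sym2.ind with
  | _ i j =>
  have := congrArg (fun p => p.2.2) (h (0, Pi.single i 1, 0) (0, Pi.single j 1, 0))
  simpa [mul3, symB_single] using this

lemma lower_card [Fintype F] (n : ℕ) (hn : 1 + (d + r) = n)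
    (hfin : Finite (Quot (LocalFinDimAlg.Iso (F := F) (n := n)))) :
    Fintype.card F ^ ((d + 1).choose 2 * r) ≤ localAlgCount F n * Fintype.card F ^ (n * n) := by
  classical
  let cl : (Sym2 (Fin d) → Fin r → F) → Quot (LocalFinDimAlg.Iso (F := F) (n := n)) :=
    fun c => Quot.mk _ (toLFA n hn c)
  have hsymm : Equivalence (LocalFinDimAlg.Iso (F := F) (n := n)) :=
    ⟨fun A => ⟨AlgEquiv.refl⟩, fun ⟨e⟩ => ⟨e.symm⟩, fun ⟨e⟩ ⟨f⟩ => ⟨e.trans f⟩⟩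
  have hex : ∀ c, ∃ φ : Sp3 F d r →ₗ[F] Sp3 F d r, Function.Surjective φ ∧
      ∀ x y, φ (mul3 (Function.invFun cl (cl c)) x y) = mul3 c (φ x) (φ y) := by
    intro c
    have h1 : cl (Function.invFun cl (cl c)) = cl c := Function.invFun_eq ⟨c, rfl⟩
    have h2 := (Equivalence.quot_mk_eq_iff hsymm _ _).1 h1
    obtain ⟨e⟩ := h2
    let e' : Alg3 (Function.invFun cl (cl c)) ≃ₐ[F] Alg3 c := e
    exact ⟨e'.toLinearMap, e'.surjective, fun x y => e'.map_mul' x y⟩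
  choose φ hφ1 hφ2 using hex
  have hinj : Function.Injective fun c => (cl c, φ c) := by
    intro c c' h
    simp only [Prod.mk.injEq] at h
    apply mul3_inj
    intro x y
    obtain ⟨x, rfl⟩ := hφ1 c x
    obtain ⟨y, rfl⟩ := hφ1 c y
    rw [← hφ2, h.2, ← hφ2, h.1]
  have hE : Finite (Sp3 F d r →ₗ[F] Sp3 F d r) := Module.finite_of_finite F
  have := Nat.card_le_card_of_injective _ hinj
  rw [Nat.card_prod, Module.natCard_eq_pow_finrank (K := F) (V := Sp3 F d r →ₗ[F] Sp3 F d r),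
    Module.natCard_eq_pow_finrank (K := F) (V := Sym2 (Fin d) → Fin r → F)] at this
  simp only [Module.finrank_linearMap, Module.finrank_prod, Module.finrank_pi_fintype,
    Module.finrank_self, Finset.sum_const, Finset.card_univ, Fintype.card_fin, Sym2.card,
    smul_eq_mul, mul_one, hn, Nat.card_eq_fintype_card] at this
  exact this

end Lower

lemma lower_num (n : ℕ) (hn : 1 ≤ n) : (2 / 27 : ℝ) * (n : ℝ) ^ 3 - 30 * (n : ℝ) ^ ((8 : ℝ) / 3)
    + ((n * n : ℕ) : ℝ) ≤ (((2 * n / 3 + 1).choose 2 * (n - 1 - 2 * n / 3) : ℕ) : ℝ) := by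
  have hn0 : (0 : ℝ) < n := by exact_mod_cast hn
  have hn1 : (1 : ℝ) ≤ n := by exact_mod_cast hn
  have h83 : (n : ℝ) ^ 2 ≤ (n : ℝ) ^ ((8 : ℝ) / 3) := by
    rw [← Real.rpow_natCast]
    exact Real.rpow_le_rpow_of_exponent_le hn1 (by norm_num)
  obtain ⟨d, hd⟩ : ∃ d, d = 2 * n / 3 := ⟨_, rfl⟩
  obtain ⟨r, hr⟩ : ∃ r, r = n - 1 - 2 * n / 3 := ⟨_, rfl⟩
  rw [← hr, ← hd]
  have a1 : 2 * n ≤ 3 * d + 2 := by omega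
  have a2 : n ≤ 3 * r + 3 := by omega
  have b1 : 2 * (n : ℝ) ≤ 3 * d + 2 := by exact_mod_cast a1
  have b2 : (n : ℝ) ≤ 3 * r + 3 := by exact_mod_cast a2
  have hr0 : (0 : ℝ) ≤ r := by positivity
  push_cast [Nat.cast_choose_two]
  have c1 : 4 * (n : ℝ) * (n - 1) / 9 ≤ (d + 1) * d := by nlinarith
  have c2 : 4 * (n : ℝ) * (n - 1) / 9 * r ≤ (d + 1) * d * r := mul_le_mul_of_nonneg_right c1 hr0
  have c3 : 4 * (n : ℝ) * (n - 1) / 9 * ((n - 3) / 3) ≤ 4 * (n : ℝ) * (n - 1) / 9 * r := by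
    apply mul_le_mul_of_nonneg_left (by linarith)
    have : (0 : ℝ) ≤ n - 1 := by linarith
    positivity
  nlinarith

lemma lower_bound {F : Type} [Field F] [Fintype F] {n : ℕ} (hn : 1 ≤ n)
    (hfin : Finite (Quot (LocalFinDimAlg.Iso (F := F) (n := n)))) :
    (Fintype.card F : ℝ) ^ ((2 / 27 : ℝ) * (n : ℝ) ^ 3 - 30 * (n : ℝ) ^ ((8 : ℝ) / 3))
      ≤ (localAlgCount F n : ℝ) := by
  have h := lower_card (F := F) (d := 2 * n / 3) (r := n - 1 - 2 * n / 3) n (by omega) hfin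
  have hq : (2 : ℝ) ≤ Fintype.card F := by exact_mod_cast Fintype.one_lt_card (α := F)
  have hq0 : (0 : ℝ) < Fintype.card F := by linarith
  have h' : (Fintype.card F : ℝ) ^ ((2 * n / 3 + 1).choose 2 * (n - 1 - 2 * n / 3))
      ≤ localAlgCount F n * (Fintype.card F : ℝ) ^ (n * n) := by exact_mod_cast h
  have h2 := Real.rpow_le_rpow_of_exponent_le (by linarith : (1 : ℝ) ≤ Fintype.card F)
    (lower_num n hn)
  rw [Real.rpow_natCast, Real.rpow_add hq0, Real.rpow_natCast] at h2
  exact le_of_mul_le_mul_right (h2.trans h') (by positivity)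

/-- There is a constant `C > 0` such that for every prime power `q` (realized as
the cardinality of a finite field `F`) and every `n ≥ 1`, the number `L(q,n)` of
isomorphism classes of `n`-dimensional local commutative `F_q`-algebras with
residue field `F_q` satisfies
`q^((2/27)n³ - C n^(8/3)) ≤ L(q,n) ≤ q^((2/27)n³ + C n^(8/3))`. -/
theorem stmt18 :
    ∃ C : ℝ, 0 < C ∧
      ∀ (F : Type) [Field F] [Fintype F] (n : ℕ), 1 ≤ n →
        (Fintype.card F : ℝ) ^ ((2 / 27 : ℝ) * (n : ℝ) ^ 3 - C * (n : ℝ) ^ ((8 : ℝ) / 3))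
            ≤ (localAlgCount F n : ℝ) ∧
        (localAlgCount F n : ℝ)
            ≤ (Fintype.card F : ℝ) ^ ((2 / 27 : ℝ) * (n : ℝ) ^ 3 + C * (n : ℝ) ^ ((8 : ℝ) / 3)) := by
  refine ⟨30, by norm_num, fun F _ _ n hn => ?_⟩
  obtain ⟨h1, h2⟩ := upper_bound (F := F) hn
  exact ⟨lower_bound hn h1, h2⟩
end

section
/- For every prime p and every integer n ≥ 1, the number of isomorphism classes of finite commutative rings of cardinality p^n is at most p^{n^2+n} times the number of isomorphism classes of commutative F_p-algebras of dimension n as an F_p-vector space. -/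
/-- A finite commutative (unital) ring of cardinality `m`, bundled with its
carrier type. -/
structure FinCommRingOfCard (m : ℕ) : Type 1 where
  carrier : Type
  [commRing : CommRing carrier]
  card_eq : Nat.card carrier = m

attribute [instance] FinCommRingOfCard.commRing

/-- Two bundled rings are isomorphic when there is a ring isomorphism between them. -/
def FinCommRingOfCard.Iso {m : ℕ} (A B : FinCommRingOfCard m) : Prop :=
  Nonempty (A.carrier ≃+* B.carrier)

/-- The number of isomorphism classes of commutative rings of cardinality `m`. -/
noncomputable def ringCount (m : ℕ) : ℕ :=
  Nat.card (Quot (FinCommRingOfCard.Iso (m := m)))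

/-- A (commutative, associative, unital) `F`-algebra of dimension `n` as an
`F`-vector space, bundled with its carrier type. -/
structure FinDimAlg (F : Type) [CommRing F] (n : ℕ) : Type 1 where
  carrier : Type
  [commRing : CommRing carrier]
  [algebra : Algebra F carrier]
  finrank_eq : Module.finrank F carrier = n

attribute [instance] FinDimAlg.commRing FinDimAlg.algebra

/-- Two bundled algebras are isomorphic when there is an `F`-algebra isomorphism
between them. -/
def FinDimAlg.Iso {F : Type} [CommRing F] {n : ℕ} (A B : FinDimAlg F n) : Prop :=
  Nonempty (A.carrier ≃ₐ[F] B.carrier)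

/-- The number of isomorphism classes of `n`-dimensional `F`-algebras. -/
noncomputable def algCount (F : Type) [CommRing F] (n : ℕ) : ℕ :=
  Nat.card (Quot (FinDimAlg.Iso (F := F) (n := n)))

structure MulStr (G : Type) [AddCommGroup G] where
  mul : G →+ G →+ G
  comm : ∀ x y, mul x y = mul y x
  assoc : ∀ x y z, mul (mul x y) z = mul x (mul y z)
  ex_one : ∃ u, ∀ x, mul u x = x

theorem MulStr.ext' {G : Type} [AddCommGroup G] {a b : MulStr G}
    (h : ∀ x y, a.mul x y = b.mul x y) : a = b := by
  cases a; cases b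
  congr
  ext x y
  exact h x y

section
variable {G : Type} [AddCommGroup G] (p : ℕ)

/-- p^k G -/
def HH (G : Type) [AddCommGroup G] (p k : ℕ) : AddSubgroup G := (nsmulAddMonoidHom (α := G) (p ^ k)).range

def JJ (G : Type) [AddCommGroup G] (p k : ℕ) : AddSubgroup G :=
  (HH G p (k+1)).comap (nsmulAddMonoidHom (α := G) (p ^ k))

theorem mem_HH {k : ℕ} {x : G} : x ∈ HH G p k ↔ ∃ y, p ^ k • y = x := by
  simp [HH, AddMonoidHom.mem_range]

theorem mem_JJ {k : ℕ} {x : G} : x ∈ JJ G p k ↔ p ^ k • x ∈ HH G p (k+1) := by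
  simp [JJ]

theorem HH_anti {k l : ℕ} (h : k ≤ l) : HH G p l ≤ HH G p k := by
  intro x hx
  rw [mem_HH] at *
  obtain ⟨y, rfl⟩ := hx
  obtain ⟨d, rfl⟩ := Nat.exists_eq_add_of_le h
  exact ⟨p ^ d • y, by rw [smul_smul, pow_add]⟩

theorem HH_map (f : G →+ G) {k : ℕ} {x : G} (hx : x ∈ HH G p k) : f x ∈ HH G p k := by
  rw [mem_HH] at *
  obtain ⟨y, rfl⟩ := hx
  exact ⟨f y, by rw [map_nsmul]⟩

theorem JJ_map (f : G →+ G) {k : ℕ} {x : G} (hx : x ∈ JJ G p k) : f x ∈ JJ G p k := by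
  rw [mem_JJ] at *
  rw [← map_nsmul]
  exact HH_map p f hx

theorem mem_JJ_zero {x : G} : x ∈ JJ G p 0 ↔ ∃ y, p • y = x := by
  rw [mem_JJ, mem_HH]; simp

theorem JJ_zero_le (k : ℕ) : JJ G p 0 ≤ JJ G p k := by
  intro x hx
  obtain ⟨y, rfl⟩ := (mem_JJ_zero p).1 hx
  rw [mem_JJ, mem_HH]
  exact ⟨y, by rw [smul_smul, pow_succ]⟩

theorem card_quot (hG : Nat.card G = p ^ n) [Finite G] :
    Nat.card ((k : Fin n) → G ⧸ JJ G p k) = p ^ n := by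
  have h1 : ∀ k, (JJ G p k).index = (HH G p (k+1)).relIndex (HH G p k) := by
    intro k; rw [JJ, AddSubgroup.index_comap]; rfl
  have h2 : ∀ m, ∏ k ∈ Finset.range m, (HH G p (k+1)).relIndex (HH G p k) =
      (HH G p m).relIndex (HH G p 0) := by
    intro m
    induction m with
    | zero => simp
    | succ m ih =>
      rw [Finset.prod_range_succ, ih, mul_comm,
        AddSubgroup.relIndex_mul_relIndex _ _ _ (HH_anti p (Nat.le_succ m)) (HH_anti p (Nat.zero_le m))]
  have h3 : HH G p n = ⊥ := by
    rw [eq_bot_iff]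
    intro x hx
    obtain ⟨y, rfl⟩ := (mem_HH p).1 hx
    rw [← hG, card_nsmul_eq_zero']
    exact AddSubgroup.zero_mem _
  have h4 : HH G p 0 = ⊤ := by
    rw [eq_top_iff]; intro x _; rw [mem_HH]; exact ⟨x, by simp⟩
  rw [Nat.card_pi]
  have : ∀ k : Fin n, Nat.card (G ⧸ JJ G p k) = (HH G p (k+1)).relIndex (HH G p k) := by
    intro k; rw [← h1]; rfl
  simp_rw [this]
  rw [Finset.prod_range (fun k => (HH G p (k+1)).relIndex (HH G p k)) |>.symm, h2, h3, h4]
  simpa using hG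

/-- congruence of multiplications mod p^k -/
def mcong (k : ℕ) : Setoid (MulStr G) where
  r a b := ∀ x y, a.mul x y - b.mul x y ∈ HH G p k
  iseqv := ⟨fun a x y => by simp, fun {a b} h x y => by
    rw [← neg_sub]; exact neg_mem (h x y), fun {a b c} h h' x y => by
    have := add_mem (h x y) (h' x y); simpa using this⟩

noncomputable def base (k : ℕ) (a : MulStr G) : MulStr G := (Quotient.mk (mcong p k) a).out

theorem base_spec (k : ℕ) (a : MulStr G) (x y : G) :
    a.mul x y - (base p k a).mul x y ∈ HH G p k :=
  (mcong p k).symm (Quotient.mk_out (s := mcong p k) a) x y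

theorem base_eq (k : ℕ) (a b : MulStr G) (h : ∀ x y, a.mul x y - b.mul x y ∈ HH G p k) :
    base p k a = base p k b := by
  unfold base
  rw [Quotient.sound (s := mcong p k) h]

noncomputable def hh (k : ℕ) (a : MulStr G) (x y : G) : G :=
  ((mem_HH p).1 (base_spec p k a x y)).choose

theorem hh_spec (k : ℕ) (a : MulStr G) (x y : G) :
    p ^ k • hh p k a x y = a.mul x y - (base p k a).mul x y :=
  ((mem_HH p).1 (base_spec p k a x y)).choose_spec

theorem JJ_of_smul_zero {k : ℕ} {x : G} (h : p ^ k • x = 0) : x ∈ JJ G p k := by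
  rw [mem_JJ, h]; exact zero_mem _

theorem hh_add (k : ℕ) (a : MulStr G) (x x' y : G) :
    hh p k a (x + x') y - hh p k a x y - hh p k a x' y ∈ JJ G p k := by
  apply JJ_of_smul_zero
  simp only [smul_sub, hh_spec, map_add, AddMonoidHom.add_apply]
  abel

theorem hh_comm (k : ℕ) (a : MulStr G) (x y : G) :
    hh p k a x y - hh p k a y x ∈ JJ G p k := by
  apply JJ_of_smul_zero
  simp only [smul_sub, hh_spec, a.comm x y, (base p k a).comm x y]
  abel

theorem hh_zero (k : ℕ) (a : MulStr G) (x y : G) (hx : x ∈ JJ G p 0) :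
    hh p k a x y ∈ JJ G p k := by
  obtain ⟨z, rfl⟩ := (mem_JJ_zero p).1 hx
  rw [mem_JJ, hh_spec]
  obtain ⟨w, hw⟩ := (mem_HH p).1 (base_spec p k a z y)
  rw [mem_HH]
  refine ⟨w, ?_⟩
  simp only [map_nsmul, AddMonoidHom.nsmul_apply, ← smul_sub, ← hw, smul_smul, pow_succ']

theorem hh_cocycle (k : ℕ) (hk : k ≠ 0) (a : MulStr G) (x y z : G) :
    a.mul z (hh p k a x y) + hh p k a (a.mul x y) z
      - a.mul x (hh p k a y z) - hh p k a x (a.mul y z) ∈ JJ G p k := by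
  rw [mem_JJ]
  simp only [smul_sub, smul_add, ← map_nsmul, hh_spec]
  set b := base p k a
  have key : ∀ x y z, a.mul (a.mul x y - b.mul x y) z - b.mul (a.mul x y - b.mul x y) z
      ∈ HH G p (k+1) := by
    intro x y z
    obtain ⟨w, hw⟩ := (mem_HH p).1 (base_spec p k a x y)
    obtain ⟨w', hw'⟩ := (mem_HH p).1 (base_spec p k a w z)
    refine HH_anti p (show k + 1 ≤ k + k by omega) ?_
    rw [mem_HH]
    refine ⟨w', ?_⟩
    rw [← hw]
    simp only [map_nsmul, AddMonoidHom.nsmul_apply, ← smul_sub]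
    rw [← hw', smul_smul, pow_add]
  have := sub_mem (key x y z) (key y z x)
  convert this using 1
  have e1 := a.assoc x y z
  have e2 := b.assoc x y z
  simp only [map_sub, AddMonoidHom.sub_apply]
  rw [a.comm z (a.mul x y), a.comm z (b.mul x y), a.comm x (a.mul y z), a.comm x (b.mul y z),
    b.comm x (a.mul y z)]
  rw [b.comm x (b.mul y z)] at e2
  rw [a.comm x (a.mul y z)] at e1
  rw [e1, e2]
  abel
variable {N : ℕ}

noncomputable def mm (a : MulStr G) (v w : Fin (N+1) → G) : Fin (N+1) → G := fun k =>
  if k = 0 then a.mul (v 0) (w 0)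
  else a.mul (v 0) (w k) + a.mul (w 0) (v k) + hh p k a (v 0) (w 0)

theorem mm_zero (a : MulStr G) (v w : Fin (N+1) → G) : mm p a v w 0 = a.mul (v 0) (w 0) := by
  simp [mm]

theorem mm_ne (a : MulStr G) (v w : Fin (N+1) → G) {k : Fin (N+1)} (hk : k ≠ 0) :
    mm p a v w k = a.mul (v 0) (w k) + a.mul (w 0) (v k) + hh p k a (v 0) (w 0) := by
  simp [mm, hk]

theorem mm_add (a : MulStr G) (v v' w : Fin (N+1) → G) (k : Fin (N+1)) :
    mm p a (v + v') w k - (mm p a v w k + mm p a v' w k) ∈ JJ G p k := by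
  by_cases hk : k = 0
  · subst hk
    simp [mm_zero]
  · simp only [mm_ne p a _ _ hk]
    convert hh_add p k a (v 0) (v' 0) (w 0) using 1
    simp only [Pi.add_apply, map_add, AddMonoidHom.add_apply]
    abel

theorem mm_comm (a : MulStr G) (v w : Fin (N+1) → G) (k : Fin (N+1)) :
    mm p a v w k - mm p a w v k ∈ JJ G p k := by
  by_cases hk : k = 0
  · subst hk
    simp [mm_zero, a.comm (v 0) (w 0)]
  · simp only [mm_ne p a _ _ hk]
    convert hh_comm p k a (v 0) (w 0) using 1
    abel

theorem mm_mem (a : MulStr G) (v w : Fin (N+1) → G) (hv : ∀ k : Fin (N+1), v k ∈ JJ G p k)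
    (k : Fin (N+1)) : mm p a v w k ∈ JJ G p k := by
  have h0 : v 0 ∈ JJ G p 0 := by simpa using hv 0
  by_cases hk : k = 0
  · subst hk
    rw [mm_zero, a.comm]
    exact JJ_map p _ (hv 0)
  · simp only [mm_ne p a _ _ hk]
    refine add_mem (add_mem ?_ ?_) (hh_zero p k a _ _ h0)
    · rw [a.comm]
      exact JJ_map p _ (JJ_zero_le p k h0)
    · exact JJ_map p _ (hv k)

theorem mm_assoc (a : MulStr G) (u v w : Fin (N+1) → G) (k : Fin (N+1)) :
    mm p a (mm p a u v) w k - mm p a u (mm p a v w) k ∈ JJ G p k := by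
  by_cases hk : k = 0
  · subst hk
    simp [mm_zero, a.assoc]
  · have hk' : (k : ℕ) ≠ 0 := by
      intro h; exact hk (Fin.ext h)
    simp only [mm_ne p a _ _ hk, mm_zero]
    convert hh_cocycle p k hk' a (u 0) (v 0) (w 0) using 1
    simp only [map_add]
    rw [a.assoc (u 0) (v 0) (w k)]
    have e1 : a.mul (w 0) (a.mul (u 0) (v k)) = a.mul (u 0) (a.mul (w 0) (v k)) := by
      rw [← a.assoc, ← a.assoc, a.comm (w 0) (u 0)]
    have e2 : a.mul (w 0) (a.mul (v 0) (u k)) = a.mul (a.mul (v 0) (w 0)) (u k) := by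
      rw [← a.assoc, a.comm (w 0) (v 0)]
    rw [e1, e2]
    abel

theorem mm_one (a : MulStr G) (u : G) (hu : ∀ x, a.mul u x = x) (v : Fin (N+1) → G)
    (k : Fin (N+1)) :
    mm p a (fun k => if k = 0 then u else - hh p k a u u) v k - v k ∈ JJ G p k := by
  by_cases hk : k = 0
  · subst hk
    simp [mm_zero, hu]
  · have hk' : (k : ℕ) ≠ 0 := by
      intro h; exact hk (Fin.ext h)
    simp only [mm_ne p a _ _ hk, hk, if_true, if_false, hu]
    have := neg_mem (hh_cocycle p k hk' a u u (v 0))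
    convert this using 1
    simp only [map_neg, hu]
    abel

abbrev VV (G : Type) [AddCommGroup G] (p N : ℕ) : Type := (k : Fin (N+1)) → G ⧸ JJ G p k

def pr (v : Fin (N+1) → G) : VV G p N := fun k => (v k : G ⧸ JJ G p k)

theorem pr_eq (v w : Fin (N+1) → G) : pr p v = pr p w ↔ ∀ k : Fin (N+1), v k - w k ∈ JJ G p k := by
  rw [funext_iff]
  refine forall_congr' fun k => ?_
  exact QuotientAddGroup.eq_iff_sub_mem

theorem pr_add (v w : Fin (N+1) → G) : pr p (v + w) = pr p v + pr p w := rfl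

theorem pr_surj : Function.Surjective (pr (G := G) (N := N) p) := by
  intro v
  exact ⟨fun k => (v k).out, funext fun k => Quotient.out_eq' _⟩

noncomputable def vm (a : MulStr G) (v w : VV G p N) : VV G p N :=
  pr p (mm p a (fun k => (v k).out) (fun k => (w k).out))

theorem mm_congr (a : MulStr G) (v v' w : Fin (N+1) → G) (h : pr p v = pr p v') :
    pr p (mm p a v w) = pr p (mm p a v' w) := by
  rw [pr_eq] at h
  have h1 : pr p (mm p a (v - v' + v') w) = pr p (mm p a (v - v') w + mm p a v' w) :=
    (pr_eq p _ _).2 fun k => mm_add p a (v - v') v' w k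
  rw [sub_add_cancel] at h1
  rw [h1, pr_add]
  have h2 : pr p (mm p a (v - v') w) = pr p 0 := by
    rw [pr_eq]
    intro k
    simpa using mm_mem p a (v - v') w h k
  rw [h2, ← pr_add, zero_add]

theorem mm_comm' (a : MulStr G) (v w : Fin (N+1) → G) :
    pr p (mm p a v w) = pr p (mm p a w v) := (pr_eq p _ _).2 (mm_comm p a v w)

theorem vm_pr (a : MulStr G) (v w : Fin (N+1) → G) :
    vm p a (pr p v) (pr p w) = pr p (mm p a v w) := by
  have h : ∀ v : Fin (N+1) → G, pr p (fun k => (pr p v k).out) = pr p v := fun v =>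
    funext fun k => Quotient.out_eq' _
  unfold vm
  rw [mm_congr p a _ _ _ (h v), mm_comm', mm_congr p a _ _ _ (h w), mm_comm']

theorem vm_add (a : MulStr G) (v v' w : VV G p N) :
    vm p a (v + v') w = vm p a v w + vm p a v' w := by
  obtain ⟨v, rfl⟩ := pr_surj p v
  obtain ⟨v', rfl⟩ := pr_surj p v'
  obtain ⟨w, rfl⟩ := pr_surj p w
  rw [← pr_add]
  simp only [vm_pr]
  rw [← pr_add, pr_eq]
  exact mm_add p a v v' w

theorem vm_comm (a : MulStr G) (v w : VV G p N) : vm p a v w = vm p a w v := by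
  obtain ⟨v, rfl⟩ := pr_surj p v
  obtain ⟨w, rfl⟩ := pr_surj p w
  simp only [vm_pr]
  exact mm_comm' p a v w

theorem vm_assoc (a : MulStr G) (u v w : VV G p N) :
    vm p a (vm p a u v) w = vm p a u (vm p a v w) := by
  obtain ⟨u, rfl⟩ := pr_surj p u
  obtain ⟨v, rfl⟩ := pr_surj p v
  obtain ⟨w, rfl⟩ := pr_surj p w
  simp only [vm_pr]
  rw [pr_eq]
  exact mm_assoc p a u v w

theorem vm_one (a : MulStr G) : ∃ e : VV G p N, ∀ v, vm p a e v = v := by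
  obtain ⟨u, hu⟩ := a.ex_one
  refine ⟨pr p (fun k => if k = 0 then u else - hh p k a u u), fun v => ?_⟩
  obtain ⟨v, rfl⟩ := pr_surj p v
  rw [vm_pr, pr_eq]
  exact mm_one p a u hu v

theorem vm_inj [Finite G] (hG : Nat.card G = p ^ (N+1)) (a b : MulStr G)
    (h : ∀ v w : VV G p N, vm p a v w = vm p b v w) : a = b := by
  have h' : ∀ (v w : Fin (N+1) → G) (k : Fin (N+1)), mm p a v w k - mm p b v w k ∈ JJ G p k := by
    intro v w
    rw [← pr_eq, ← vm_pr, ← vm_pr, h]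
  have ind : ∀ k, k ≤ N + 1 → ∀ x y, a.mul x y - b.mul x y ∈ HH G p k := by
    intro k
    induction k with
    | zero => intro _ x y; rw [mem_HH]; exact ⟨_, by rw [pow_zero, one_smul]⟩
    | succ k ih =>
      intro hk x y
      have ih := ih (by omega)
      have h0 := h' (Pi.single 0 x) (Pi.single 0 y) ⟨k, by omega⟩
      by_cases hk0 : k = 0
      · subst hk0
        have h1 := h' (Pi.single 0 x) (Pi.single 0 y) 0
        rw [mm_zero, mm_zero, mem_JJ] at h1
        simpa using h1
      · have hk1 : (⟨k, by omega⟩ : Fin (N+1)) ≠ 0 := by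
          intro h; exact hk0 (congrArg Fin.val h)
        rw [mm_ne p a _ _ hk1, mm_ne p b _ _ hk1, mem_JJ] at h0
        simp only [Pi.single_eq_same, Pi.single_eq_of_ne hk1, map_zero, zero_add, smul_sub,
          hh_spec, base_eq p k a b ih] at h0
        simpa using h0
  apply MulStr.ext'
  intro x y
  obtain ⟨z, hz⟩ := (mem_HH p).1 (ind (N+1) le_rfl x y)
  rw [← hG, card_nsmul_eq_zero'] at hz
  exact (sub_eq_zero.1 hz.symm)

theorem VV_smul (v : VV G p N) : p • v = 0 := by
  obtain ⟨v, rfl⟩ := pr_surj p v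
  have : p • pr p v = pr p (p • v) := rfl
  have h0 : (0 : VV G p N) = pr p 0 := rfl
  rw [this, h0, pr_eq]
  intro k
  apply JJ_zero_le
  rw [mem_JJ_zero]
  exact ⟨v k, by simp⟩

end

set_option linter.style.haveILetI false
theorem finrank_of_card (p n : ℕ) [Fact p.Prime] (M : Type) [AddCommGroup M] [Module (ZMod p) M]
    [Finite M] (h : Nat.card M = p ^ n) : Module.finrank (ZMod p) M = n := by
  haveI : Module.Finite (ZMod p) M := Module.Finite.of_finite
  have h1 : Nat.card M = Nat.card (ZMod p) ^ Module.finrank (ZMod p) M :=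
    Module.natCard_eq_pow_finrank
  rw [h, Nat.card_zmod] at h1
  exact (Nat.pow_right_injective (Fact.out : p.Prime).two_le h1).symm

theorem coords_of_card' (p n : ℕ) [Fact p.Prime] (M : Type) [AddCommGroup M] [Module (ZMod p) M]
    [Finite M] (h : Nat.card M = p ^ n) : Nonempty (M ≃+ (Fin n → ZMod p)) := by
  haveI : Module.Finite (ZMod p) M := Module.Finite.of_finite
  have hf := finrank_of_card p n M h
  exact ⟨(LinearEquiv.ofFinrankEq (R := ZMod p) M (Fin n → ZMod p) (by rw [hf]; simp)).toAddEquiv⟩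

theorem coords_of_card (p n : ℕ) [Fact p.Prime] (M : Type) [AddCommGroup M] [Finite M]
    (hM : ∀ x : M, p • x = 0) (h : Nat.card M = p ^ n) : Nonempty (M ≃+ (Fin n → ZMod p)) :=
  @coords_of_card' p n _ M _ (AddCommGroup.zmodModule hM) _ h

/-- the algebra attached to a ring structure -/
theorem exists_alg (p N : ℕ) (hp : p.Prime) (G : Type) [AddCommGroup G] [Finite G]
    (hG : Nat.card G = p ^ (N+1)) (a : MulStr G) :
    ∃ (B : FinDimAlg (ZMod p) (N+1)) (L : B.carrier ≃+ VV G p N),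
      ∀ x y, L (x * y) = vm p a (L x) (L y) := by
  haveI : Fact p.Prime := ⟨hp⟩
  obtain ⟨e, he⟩ := vm_one (N := N) p a
  letI m1 : Module (ZMod p) (VV G p N) := AddCommGroup.zmodModule (VV_smul p)
  haveI : Module.Finite (ZMod p) (VV G p N) := Module.Finite.of_finite
  have hf : Module.finrank (ZMod p) (VV G p N) = N + 1 :=
    finrank_of_card p (N+1) _ (card_quot p hG)
  have hadd' : ∀ u v w : VV G p N, vm p a u (v + w) = vm p a u v + vm p a u w := by
    intro u v w
    rw [vm_comm, vm_add, vm_comm p a v, vm_comm p a w]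
  letI r1 : CommRing (VV G p N) :=
    { (inferInstance : AddCommGroup (VV G p N)) with
      mul := vm p a
      one := e
      left_distrib := hadd'
      right_distrib := vm_add p a
      zero_mul := fun v => by
        have := vm_add p a 0 0 v
        rw [add_zero] at this
        exact left_eq_add.1 this
      mul_zero := fun v => by
        have := hadd' v 0 0
        rw [add_zero] at this
        exact left_eq_add.1 this
      mul_assoc := vm_assoc p a
      mul_comm := vm_comm p a
      one_mul := he
      mul_one := fun v => (vm_comm p a v e).trans (he v) }
  have hs : ∀ (r : ZMod p) (x y : VV G p N), r • x * y = r • (x * y) := by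
    intro r x y
    exact ZMod.map_smul (AddMonoidHom.mulRight y) r x
  letI a1 : Algebra (ZMod p) (VV G p N) := Algebra.ofModule hs (by
    intro r x y
    rw [mul_comm, hs, mul_comm])
  exact ⟨⟨VV G p N, hf⟩, AddEquiv.refl _, fun x y => rfl⟩

theorem alg_iso_equiv (F : Type) [CommRing F] (n : ℕ) :
    Equivalence (FinDimAlg.Iso (F := F) (n := n)) :=
  ⟨fun _ => ⟨AlgEquiv.refl⟩, fun ⟨e⟩ => ⟨e.symm⟩, fun ⟨e⟩ ⟨f⟩ => ⟨e.trans f⟩⟩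

theorem ring_iso_equiv (m : ℕ) :
    Equivalence (FinCommRingOfCard.Iso (m := m)) :=
  ⟨fun _ => ⟨RingEquiv.refl _⟩, fun ⟨e⟩ => ⟨e.symm⟩, fun ⟨e⟩ ⟨f⟩ => ⟨e.trans f⟩⟩

theorem quot_iso {α : Type*} {r : α → α → Prop} (h : Equivalence r) {a b : α} (hab : Quot.mk r a = Quot.mk r b) :
    r a b := (Equivalence.eqvGen_iff h).1 (Quot.eqvGen_exact hab)

theorem alg_coord (p n : ℕ) (hp : p.Prime) (hn : 1 ≤ n) (B : FinDimAlg (ZMod p) n) :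
    Nonempty (B.carrier ≃ₗ[ZMod p] (Fin n → ZMod p)) := by
  haveI : Fact p.Prime := ⟨hp⟩
  haveI : Module.Finite (ZMod p) B.carrier :=
    Module.finite_of_finrank_pos (by rw [B.finrank_eq]; omega)
  exact ⟨LinearEquiv.ofFinrankEq _ _ (by rw [B.finrank_eq]; simp)⟩

theorem finite_alg (p n : ℕ) (hp : p.Prime) (hn : 1 ≤ n) :
    Finite (Quot (FinDimAlg.Iso (F := ZMod p) (n := n))) := by
  haveI : Fact p.Prime := ⟨hp⟩
  let b := fun B => (alg_coord p n hp hn B).some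
  let W := Fin n → ZMod p
  refine Finite.of_injective (β := W → W → W)
    (fun q v w => b q.out ((b q.out).symm v * (b q.out).symm w)) ?_
  intro q q' h
  rw [← q.out_eq, ← q'.out_eq]
  refine Quot.sound ⟨?_⟩
  let L := (b q.out).trans (b q'.out).symm
  have hm : ∀ x y, L (x * y) = L x * L y := by
    intro x y
    have := congrFun (congrFun h (b q.out x)) (b q.out y)
    simp only [LinearEquiv.symm_apply_apply] at this
    simp only [L, LinearEquiv.trans_apply, this, LinearEquiv.symm_apply_apply]
  have h1 : L 1 = 1 := by
    have := hm (L.symm 1) 1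
    simp only [mul_one, LinearEquiv.apply_symm_apply, one_mul] at this
    exact this.symm
  exact AlgEquiv.ofLinearEquiv L h1 hm

def GG (p : ℕ) {n : ℕ} (c : Composition n) : Type := (i : Fin c.length) → ZMod (p ^ c.blocksFun i)

noncomputable instance (p n : ℕ) (c : Composition n) : AddCommGroup (GG p c) := by
  unfold GG; infer_instance

theorem exists_comp (p n : ℕ) (hp : p.Prime) (R : Type) [AddCommGroup R]
    (hR : Nat.card R = p ^ n) : ∃ c : Composition n, Nonempty (R ≃+ GG p c) := by
  have hpos : Nat.card R ≠ 0 := by rw [hR]; exact pow_ne_zero _ hp.ne_zero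
  haveI : Finite R := Nat.finite_of_card_ne_zero hpos
  obtain ⟨ι, _, f, hf, ⟨e⟩⟩ := AddCommGroup.equiv_directSum_zmod_of_finite' R
  classical
  let e1 : R ≃+ ((i : ι) → ZMod (f i)) := e.trans (DirectSum.addEquivProd _)
  have hc : ∏ i, f i = p ^ n := by
    rw [← hR, Nat.card_congr e1.toEquiv, Nat.card_pi]
    simp
  have hk : ∀ i, ∃ k, f i = p ^ k := by
    intro i
    have : f i ∣ p ^ n := hc ▸ Finset.dvd_prod_of_mem f (Finset.mem_univ i)
    obtain ⟨k, _, h⟩ := (Nat.dvd_prime_pow hp).1 this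
    exact ⟨k, h⟩
  choose k hk using hk
  obtain rfl : f = fun i => p ^ k i := funext hk
  have hs : ∑ i, k i = n := by
    rw [Finset.prod_pow_eq_pow_sum] at hc
    exact Nat.pow_right_injective hp.two_le hc
  have hkpos : ∀ i, 0 < k i := by
    intro i
    rcases Nat.eq_zero_or_pos (k i) with h | h
    · have := hf i; simp [h] at this
    · exact h
  let l : List ℕ := (Finset.univ : Finset ι).toList.map k
  let c : Composition n := ⟨l, by
    intro i hi
    obtain ⟨j, _, rfl⟩ := List.mem_map.1 hi
    exact hkpos j, by simp [l, hs]⟩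
  have hlen : c.length = Fintype.card ι := by simp [c, l, Composition.length]
  have hlen' : (Finset.univ : Finset ι).toList.length = Fintype.card ι := by simp
  let g : Fin c.length → ι := fun i => (Finset.univ : Finset ι).toList.get ⟨i, by
    have := i.2; omega⟩
  have hg : Function.Bijective g := by
    rw [Fintype.bijective_iff_injective_and_card]
    refine ⟨?_, by simp [hlen]⟩
    intro i j hij
    have := (List.nodup_iff_injective_get.1 (Finset.nodup_toList (Finset.univ : Finset ι))) hij
    exact Fin.ext (by simpa using this)
  have hgk : ∀ i, c.blocksFun i = k (g i) := by
    intro i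
    simp [Composition.blocksFun, c, l, g]
  let e2 : ((i : Fin c.length) → ZMod (p ^ k (g i))) ≃+ ((i : ι) → ZMod (p ^ k i)) :=
    (RingEquiv.piCongrLeft (fun i => ZMod (p ^ k i)) (Equiv.ofBijective g hg)).toAddEquiv
  let e3 : GG p c ≃+ ((i : Fin c.length) → ZMod (p ^ k (g i))) :=
    AddEquiv.piCongrRight fun i => (ZMod.ringEquivCongr (by rw [hgk])).toAddEquiv
  exact ⟨c, ⟨e1.trans (e2.symm.trans e3.symm)⟩⟩

theorem card_W (p n : ℕ) (hp : p.Prime) :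
    Nat.card ((Fin n → ZMod p) →ₗ[ZMod p] (Fin n → ZMod p)) = p ^ (n ^ 2) := by
  haveI : Fact p.Prime := ⟨hp⟩
  rw [Nat.card_congr (LinearMap.toMatrix' (R := ZMod p) (m := Fin n) (n := Fin n)).toEquiv]
  simp [Matrix, pow_two, ← pow_mul]

/-- transfer of a ring structure -/
theorem exists_mul (R : Type) [CommRing R] (G : Type) [AddCommGroup G] (e : R ≃+ G) :
    ∃ a : MulStr G, ∀ x y, e (x * y) = a.mul (e x) (e y) := by
  let m : G →+ G →+ G := AddMonoidHom.mk' (fun x => AddMonoidHom.mk' (fun y => e (e.symm x * e.symm y))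
    (by intro y z; simp [mul_add])) (by intro x y; ext z; simp [add_mul])
  have hm : ∀ x y, m x y = e (e.symm x * e.symm y) := fun _ _ => rfl
  refine ⟨⟨m, ?_, ?_, ⟨e 1, ?_⟩⟩, ?_⟩
  · intro x y; rw [hm, hm, mul_comm]
  · intro x y z; simp [hm, mul_assoc]
  · intro x; simp [hm]
  · intro x y; simp [hm]

/-- For every prime `p` and every `n ≥ 1`, the number of isomorphism classes of
finite commutative rings of cardinality `pⁿ` is at most `p^(n²+n)` times the
number of isomorphism classes of commutative `F_p`-algebras of dimension `n`. -/
theorem stmt19 (p n : ℕ) (hp : p.Prime) (hn : 1 ≤ n) :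
    ringCount (p ^ n) ≤ p ^ (n ^ 2 + n) * algCount (ZMod p) n := by
  haveI : Fact p.Prime := ⟨hp⟩
  obtain ⟨N, rfl⟩ : ∃ N, n = N + 1 := ⟨n - 1, by omega⟩
  let W := Fin (N+1) → ZMod p
  let b := fun B => (alg_coord p (N+1) hp hn B).some
  haveI := finite_alg p (N+1) hp hn
  let QA := Quot (FinDimAlg.Iso (F := ZMod p) (n := N+1))
  -- coordinates on the graded spaces
  have hV : ∀ c : Composition (N+1), Nat.card (GG p c) = p ^ (N+1) →
      Nonempty (VV (GG p c) p N ≃+ W) := by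
    intro c hc
    haveI : Finite (GG p c) := Nat.finite_of_card_ne_zero (by rw [hc]; exact pow_ne_zero _ hp.ne_zero)
    exact coords_of_card p (N+1) _ (VV_smul p) (card_quot p hc)
  let t := fun c hc => (hV c hc).some
  let P : Quot (FinCommRingOfCard.Iso (m := p ^ (N+1))) →
      Composition (N+1) × (W →ₗ[ZMod p] W) × QA → Prop := fun q d =>
    ∃ (hc : Nat.card (GG p d.1) = p ^ (N+1)) (a : MulStr (GG p d.1))
      (e : q.out.carrier ≃+ GG p d.1),
      (∀ x y, e (x * y) = a.mul (e x) (e y)) ∧ Function.Surjective d.2.1 ∧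
      ∀ x y, (t d.1 hc).symm (d.2.1 (b d.2.2.out (x * y))) =
        vm p a ((t d.1 hc).symm (d.2.1 (b d.2.2.out x))) ((t d.1 hc).symm (d.2.1 (b d.2.2.out y)))
  have hP : ∀ q, ∃ d, P q d := by
    intro q
    obtain ⟨c, ⟨e⟩⟩ := exists_comp p (N+1) hp q.out.carrier q.out.card_eq
    have hc : Nat.card (GG p c) = p ^ (N+1) := by
      rw [← Nat.card_congr e.toEquiv, q.out.card_eq]
    haveI : Finite (GG p c) := Nat.finite_of_card_ne_zero (by rw [hc]; exact pow_ne_zero _ hp.ne_zero)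
    obtain ⟨a, ha⟩ := exists_mul _ _ e
    obtain ⟨B, L, hL⟩ := exists_alg p N hp (GG p c) hc a
    let q' : QA := Quot.mk _ B
    obtain ⟨i⟩ : FinDimAlg.Iso q'.out B := quot_iso (alg_iso_equiv _ _) q'.out_eq
    let T : W ≃+ W := (b q'.out).symm.toAddEquiv.trans (i.toRingEquiv.toAddEquiv.trans (L.trans (t c hc)))
    have hT : ∀ x, T (b q'.out x) = t c hc (L (i x)) := by
      intro x
      simp [T]
    refine ⟨(c, T.toAddMonoidHom.toZModLinearMap p, q'), hc, a, e, ha, T.surjective, ?_⟩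
    intro x y
    change (t c hc).symm (T (b q'.out (x * y))) =
      vm p a ((t c hc).symm (T (b q'.out x))) ((t c hc).symm (T (b q'.out y)))
    simp only [hT, AddEquiv.symm_apply_apply, map_mul, hL]
  choose Φ hΦ using hP
  have hinj : Function.Injective Φ := by
    intro q q' h
    have h1 := hΦ q
    have h2 := hΦ q'
    rw [← h] at h2
    obtain ⟨hc, a, e, he, hs, hm⟩ := h1
    obtain ⟨hc', a', e', he', -, hm'⟩ := h2
    haveI : Finite (GG p (Φ q).1) :=
      Nat.finite_of_card_ne_zero (by rw [hc]; exact pow_ne_zero _ hp.ne_zero)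
    have haa : a = a' := by
      apply vm_inj p hc
      have hsur : Function.Surjective fun x => (t (Φ q).1 hc).symm ((Φ q).2.1 (b (Φ q).2.2.out x)) :=
        (t (Φ q).1 hc).symm.surjective.comp (hs.comp (b (Φ q).2.2.out).surjective)
      intro v w
      obtain ⟨x, rfl⟩ := hsur v
      obtain ⟨y, rfl⟩ := hsur w
      exact (hm x y).symm.trans (hm' x y)
    subst haa
    rw [← q.out_eq, ← q'.out_eq]
    refine Quot.sound ⟨RingEquiv.mk (e.trans e'.symm).toEquiv ?_ ?_⟩
    · intro x y
      apply e'.injective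
      simp [he, he']
    · intro x y
      simp
  haveI : Finite QA := finite_alg p (N+1) hp hn
  haveI : Finite (W →ₗ[ZMod p] W) := Nat.finite_of_card_ne_zero (by
    rw [card_W p (N+1) hp]; exact pow_ne_zero _ hp.ne_zero)
  have hcard := Nat.card_le_card_of_injective Φ hinj
  rw [Nat.card_prod, Nat.card_prod, card_W p (N+1) hp] at hcard
  have hC : Nat.card (Composition (N+1)) ≤ p ^ (N+1) := by
    rw [Nat.card_eq_fintype_card, composition_card]
    calc 2 ^ (N + 1 - 1) ≤ 2 ^ (N+1) := Nat.pow_le_pow_right (by norm_num) (by omega)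
      _ ≤ p ^ (N+1) := Nat.pow_le_pow_left hp.two_le _
  unfold ringCount algCount
  calc _ ≤ _ := hcard
    _ ≤ p ^ (N+1) * (p ^ ((N+1)^2) * Nat.card QA) := Nat.mul_le_mul_right _ hC
    _ = _ := by rw [pow_add]; ring
end
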